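/- arXiv:1902.10315 — 13 statements merged into one kernel-verified Lean document; each statement's English description precedes it below -/
import Mathlib

section
/- Let n ≥ 1 and c > 1, and let p and q be pricings of lotteries over n items satisfying q(λ)/c ≤ p(λ) ≤ q(λ) for every lottery λ. Then there exists a probability distribution μ on scaling factors α ∈ [1/(2c), 1], depending only on c, such that for every valuation v for which buyer-optimal lotteries exist under p and under α·q for every α (and for which α ↦ Rev_v(α·q) is measurable), E_{α∼μ}[Rev_v(α·q)] ≥ Rev_v(p) / (2·ln(2c)). -/
open MeasureTheory

/-- The expected value of a valuation `v` under a lottery (probability distribution over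
subsets of items) `lam`. -/
noncomputable def lotVal {n : ℕ} (v : Finset (Fin n) → ℝ) (lam : PMF (Finset (Fin n))) : ℝ :=
  ∑ S : Finset (Fin n), (lam S).toReal * v S

/-- If `f` is antitone and every increment of `u` is bounded by the left-endpoint rectangle of
`f`, then halving the interval `k` times improves the error in the integral bound to
`(f x - f y) * (y - x) / 2 ^ k`. -/
lemma sub_le_integral_add_of_antitoneOn {f u : ℝ → ℝ} {a b : ℝ} (hf : AntitoneOn f (Set.Icc a b))
    (hu : ∀ x ∈ Set.Icc a b, ∀ y ∈ Set.Icc a b, x ≤ y → u x - u y ≤ f x * (y - x)) (k : ℕ) :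
    ∀ x ∈ Set.Icc a b, ∀ y ∈ Set.Icc a b, x ≤ y →
      u x - u y ≤ (∫ t in x..y, f t) + (f x - f y) * (y - x) / 2 ^ k := by
  have hint : ∀ x ∈ Set.Icc a b, ∀ y ∈ Set.Icc a b, x ≤ y → IntervalIntegrable f volume x y := by
    intro x hx y hy hxy
    apply AntitoneOn.intervalIntegrable
    rw [Set.uIcc_of_le hxy]
    exact hf.mono (Set.Icc_subset_Icc hx.1 hy.2)
  induction k with
  | zero =>
    intro x hx y hy hxy
    have h : ∫ _ in x..y, f y ≤ ∫ t in x..y, f t := by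
      refine intervalIntegral.integral_mono_on hxy (by simp) (hint x hx y hy hxy) fun t ht => ?_
      exact hf ⟨hx.1.trans ht.1, ht.2.trans hy.2⟩ hy ht.2
    rw [intervalIntegral.integral_const, smul_eq_mul] at h
    have := hu x hx y hy hxy
    rw [pow_zero, div_one]
    linarith
  | succ k ih =>
    intro x hx y hy hxy
    have hm : (x + y) / 2 ∈ Set.Icc a b :=
      ⟨by linarith [hx.1, hy.1], by linarith [hx.2, hy.2]⟩
    have hxm : x ≤ (x + y) / 2 := by linarith
    have hmy : (x + y) / 2 ≤ y := by linarith
    have h₁ := ih x hx _ hm hxm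
    have h₂ := ih _ hm y hy hmy
    rw [← intervalIntegral.integral_add_adjacent_intervals (hint x hx _ hm hxm)
      (hint _ hm y hy hmy)]
    have h₃ : (f x - f y) * (y - x) / 2 ^ (k + 1) =
        (f x - f ((x + y) / 2)) * ((x + y) / 2 - x) / 2 ^ k +
          (f ((x + y) / 2) - f y) * (y - (x + y) / 2) / 2 ^ k := by
      rw [pow_succ]
      field_simp
      ring
    linarith

/-- If `f` is antitone and `-f` is a subgradient of `u`, then the decrease of `u` over an interval
is at most the integral of `f`. -/
lemma sub_le_integral_of_antitoneOn {f u : ℝ → ℝ} {a b : ℝ} (hab : a ≤ b)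
    (hf : AntitoneOn f (Set.Icc a b))
    (hu : ∀ x ∈ Set.Icc a b, ∀ y ∈ Set.Icc a b, x ≤ y → u x - u y ≤ f x * (y - x)) :
    u a - u b ≤ ∫ t in a..b, f t := by
  have hlim : Filter.Tendsto
      (fun k : ℕ => (∫ t in a..b, f t) + (f a - f b) * (b - a) * (1 / 2 : ℝ) ^ k)
      Filter.atTop (nhds ((∫ t in a..b, f t) + (f a - f b) * (b - a) * 0)) :=
    ((tendsto_pow_atTop_nhds_zero_of_lt_one (by norm_num) (by norm_num)).const_mul _).const_add _
  rw [mul_zero, add_zero] at hlim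
  refine ge_of_tendsto' hlim fun k => ?_
  have h := sub_le_integral_add_of_antitoneOn hf hu k a (Set.left_mem_Icc.2 hab) b
    (Set.right_mem_Icc.2 hab) hab
  rwa [one_div, inv_pow, ← div_eq_mul_inv]

/-- The probability distribution on `(a, 1]` with density proportional to `1 / α`. -/
noncomputable def logUniform (a : ℝ) : Measure ℝ :=
  (volume.restrict (Set.Ioc a 1)).withDensity
    fun α => ENNReal.ofReal (1 / α * (Real.log (1 / a))⁻¹)

lemma isProbabilityMeasure_logUniform {a : ℝ} (ha : 0 < a) (ha1 : a < 1) :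
    IsProbabilityMeasure (logUniform a) := by
  have hL : 0 < Real.log (1 / a) := Real.log_pos (by rw [lt_div_iff₀ ha]; linarith)
  have hii : IntervalIntegrable (fun α : ℝ => 1 / α * (Real.log (1 / a))⁻¹) volume a 1 := by
    refine IntervalIntegrable.mul_const (intervalIntegral.intervalIntegrable_one_div ?_
      continuousOn_id) _
    intro x hx
    rw [Set.uIcc_of_le ha1.le] at hx
    exact (ha.trans_le hx.1).ne'
  constructor
  rw [logUniform, withDensity_apply _ MeasurableSet.univ, Measure.restrict_univ,
    ← ofReal_integral_eq_lintegral_ofReal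
      ((intervalIntegrable_iff_integrableOn_Ioc_of_le ha1.le).1 hii),
    ← intervalIntegral.integral_of_le ha1.le, intervalIntegral.integral_mul_const,
    integral_one_div_of_pos ha one_pos, mul_inv_cancel₀ hL.ne', ENNReal.ofReal_one]
  refine (ae_restrict_iff' measurableSet_Ioc).2 (Filter.Eventually.of_forall fun x hx => ?_)
  have : 0 < x := ha.trans hx.1
  simp only [Pi.zero_apply]
  positivity

lemma logUniform_compl_Icc (a : ℝ) : logUniform a (Set.Icc a 1)ᶜ = 0 := by
  apply withDensity_absolutelyContinuous
  rw [Measure.restrict_apply measurableSet_Icc.compl]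
  convert measure_empty (μ := (volume : Measure ℝ))
  ext x
  simp only [Set.mem_inter_iff, Set.mem_compl_iff, Set.mem_Icc, Set.mem_Ioc,
    Set.mem_empty_iff_false, iff_false]
  rintro ⟨h, h₁, h₂⟩
  exact h ⟨h₁.le, h₂⟩

lemma integral_mul_logUniform {a : ℝ} (ha : 0 < a) (ha1 : a < 1) (f : ℝ → ℝ) :
    ∫ α, α * f α ∂logUniform a = (∫ α in a..1, f α) / Real.log (1 / a) := by
  have hL : 0 < Real.log (1 / a) := Real.log_pos (by rw [lt_div_iff₀ ha]; linarith)
  rw [logUniform, integral_withDensity_eq_integral_toReal_smul (by fun_prop)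
    (Filter.Eventually.of_forall fun _ => ENNReal.ofReal_lt_top),
    intervalIntegral.integral_of_le ha1.le, ← integral_div]
  refine setIntegral_congr_fun measurableSet_Ioc fun x hx => ?_
  have hx0 : 0 < x := ha.trans hx.1
  simp only [smul_eq_mul]
  rw [ENNReal.toReal_ofReal (by positivity)]
  field_simp

/-- for `c > 1` there is a probability distribution `μ` over scaling factors
`α ∈ [1/(2c), 1]`, depending only on `c`, such that whenever `q` point-wise
`c`-approximates `p` (i.e. `q(λ)/c ≤ p(λ) ≤ q(λ)` for every lottery `λ`), for every
valuation `v` for which buyer-optimal lotteries exist under `p` and under `α·q` for each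
`α` (with measurable revenue in `α`), we have
`E_{α∼μ}[Rev_v(α·q)] ≥ Rev_v(p) / (2 ln(2c))`. -/
theorem buy_many_scaling (c : ℝ) (hc : 1 < c) :
    ∃ μ : Measure ℝ, IsProbabilityMeasure μ ∧ μ (Set.Icc (1 / (2 * c)) 1)ᶜ = 0 ∧
      ∀ n : ℕ, 1 ≤ n →
        ∀ p q : PMF (Finset (Fin n)) → ℝ,
          (∀ lam, 0 ≤ p lam) → (∀ lam, 0 ≤ q lam) →
          (∀ lam, q lam / c ≤ p lam ∧ p lam ≤ q lam) →
          ∀ v : Finset (Fin n) → ℝ, (∀ S, 0 ≤ v S) →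
            ∀ lamStar : PMF (Finset (Fin n)),
              (∀ lam, lotVal v lam - p lam ≤ lotVal v lamStar - p lamStar) →
              ∀ sel : ℝ → PMF (Finset (Fin n)),
                (∀ α ∈ Set.Icc (1 / (2 * c)) 1,
                  ∀ lam, lotVal v lam - α * q lam ≤ lotVal v (sel α) - α * q (sel α)) →
                Measurable (fun α : ℝ => α * q (sel α)) →
                p lamStar / (2 * Real.log (2 * c)) ≤ ∫ α, α * q (sel α) ∂μ := by
  have ha : 0 < 1 / (2 * c) := by positivity
  have ha1 : 1 / (2 * c) < 1 := by rw [div_lt_one (by positivity)]; linarith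
  refine ⟨logUniform (1 / (2 * c)), isProbabilityMeasure_logUniform ha ha1,
    logUniform_compl_Icc _, ?_⟩
  intro n _ p q _ _ hpq v _ lamStar hStar sel hsel _
  have hL : 0 < Real.log (2 * c) := Real.log_pos (by linarith)
  rw [integral_mul_logUniform ha ha1 fun α => q (sel α), one_div_one_div, ← div_div]
  refine div_le_div_of_nonneg_right ?_ hL.le
  have hanti : AntitoneOn (fun α => q (sel α)) (Set.Icc (1 / (2 * c)) 1) := by
    intro x hx y hy hxy
    rcases hxy.eq_or_lt with rfl | hlt
    · exact le_rfl
    · have h₁ := hsel x hx (sel y)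
      have h₂ := hsel y hy (sel x)
      refine le_of_mul_le_mul_left ?_ (sub_pos.2 hlt)
      linarith
  have hint := sub_le_integral_of_antitoneOn (u := fun α => lotVal v (sel α) - α * q (sel α))
    ha1.le hanti fun x _ y hy _ => by linarith [hsel y hy (sel x)]
  have hlow := hsel _ (Set.left_mem_Icc.2 ha1.le) lamStar
  have hhigh := hStar (sel 1)
  have hq := (hpq lamStar).1
  have hp := (hpq (sel 1)).2
  have heq : 1 / (2 * c) * q lamStar = q lamStar / c / 2 := by field_simp
  linarith
end

section
/- Let q be a pricing of lotteries over n items, let 0 < ℓ < h, and let v be a valuation. For each α ∈ [ℓ, h] let λ_α be a buyer-optimal lottery for v under the pricing α·q (assume such maximizers exist and that α ↦ q(λ_α) is measurable). If α is drawn from [ℓ, h] with probability density 1/(α·ln(h/ℓ)), then E_α[α·q(λ_α)] ≥ (u(v, ℓ·q) − u(v, h·q)) / ln(h/ℓ), where u(v, r) = sup_λ (v(λ) − r(λ)). Equivalently, ∫_ℓ^h q(λ_α) dα ≥ u(v, ℓ·q) − u(v, h·q). -/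
open MeasureTheory intervalIntegral

/-- The buyer's utility `u(v, r) = sup_λ (v(λ) − r(λ))` under a pricing `r`. -/
noncomputable def util {n : ℕ} (v : Finset (Fin n) → ℝ) (r : PMF (Finset (Fin n)) → ℝ) : ℝ :=
  ⨆ lam : PMF (Finset (Fin n)), (lotVal v lam - r lam)

/-- If every decrease of `F` from `x` to `y` is bounded by `(y - x) * (g x - g y)`, then the
endpoint values of `F` are ordered: subdividing the interval makes the total decrease vanish. -/
lemma le_of_sub_le_mul_sub {F g : ℝ → ℝ} {a b : ℝ} (hab : a < b)
    (hFg : ∀ x ∈ Set.Icc a b, ∀ y ∈ Set.Icc a b, x ≤ y → F x - F y ≤ (y - x) * (g x - g y)) :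
    F a ≤ F b := by
  have subdiv : ∀ N : ℕ, 0 < N → N * (F a - F b) ≤ (b - a) * (g a - g b) := by
    intro N hN
    have hN' : (0 : ℝ) < N := Nat.cast_pos.mpr hN
    obtain ⟨δ, hδ⟩ : ∃ δ : ℝ, δ = (b - a) / N := ⟨_, rfl⟩
    have hδN : N * δ = b - a := by rw [hδ]; field_simp
    have hδ0 : 0 < δ := hδ ▸ div_pos (sub_pos.mpr hab) hN'
    have node : ∀ k : ℕ, k ≤ N → a + k * δ ∈ Set.Icc a b := by
      intro k hk
      have hk' : (k : ℝ) ≤ N := Nat.cast_le.mpr hk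
      constructor <;> nlinarith [mul_nonneg k.cast_nonneg hδ0.le]
    have partial_sum : ∀ k : ℕ, k ≤ N → F a - F (a + k * δ) ≤ δ * (g a - g (a + k * δ)) := by
      intro k
      induction k with
      | zero => simp
      | succ k ih =>
        intro hk
        have h1 := ih (by omega)
        have h2 := hFg _ (node k (by omega)) _ (node (k + 1) hk) (by push_cast; linarith)
        have h3 : a + ((k + 1 : ℕ) : ℝ) * δ - (a + k * δ) = δ := by push_cast; ring
        rw [h3] at h2
        linarith
    have hlast := partial_sum N le_rfl
    rw [show a + N * δ = b by linarith] at hlast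
    calc N * (F a - F b) ≤ N * (δ * (g a - g b)) := mul_le_mul_of_nonneg_left hlast hN'.le
      _ = (b - a) * (g a - g b) := by rw [← mul_assoc, hδN]
  by_contra! hlt
  have hpos : 0 < F a - F b := sub_pos.mpr hlt
  obtain ⟨N, hN⟩ := exists_nat_gt ((b - a) * (g a - g b) / (F a - F b))
  rw [div_lt_iff₀ hpos] at hN
  have h1 := subdiv (N + 1) N.succ_pos
  push_cast at h1
  linarith

/-- If `-g x` is a subgradient of `U` at every `x ∈ [a, b]`, then `U a - U b ≤ ∫ g`. -/
lemma sub_le_integral_of_subgradient {U g : ℝ → ℝ} {a b : ℝ} (hab : a < b)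
    (hsub : ∀ x ∈ Set.Icc a b, ∀ y ∈ Set.Icc a b, U x - (y - x) * g x ≤ U y) :
    U a - U b ≤ ∫ x in a..b, g x := by
  have anti : AntitoneOn g (Set.Icc a b) := by
    intro x hx y hy hxy
    rcases hxy.eq_or_lt with rfl | hlt
    · rfl
    · nlinarith [hsub x hx y hy, hsub y hy x hx]
  have integrable : ∀ x ∈ Set.Icc a b, ∀ y ∈ Set.Icc a b, x ≤ y →
      IntervalIntegrable g volume x y := by
    intro x hx y hy hxy
    apply AntitoneOn.intervalIntegrable
    rw [Set.uIcc_of_le hxy]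
    exact anti.mono (Set.Icc_subset_Icc hx.1 hy.2)
  have key : U a + ∫ t in a..a, g t ≤ U b + ∫ t in a..b, g t := by
    apply le_of_sub_le_mul_sub (F := fun x => U x + ∫ t in a..x, g t) (g := g) hab
    intro x hx y hy hxy
    have ha : a ∈ Set.Icc a b := Set.left_mem_Icc.mpr hab.le
    have hadd := integral_add_adjacent_intervals (integrable a ha x hx hx.1)
      (integrable x hx y hy hxy)
    have hlow : (y - x) * g y ≤ ∫ t in x..y, g t := by
      have hmono := integral_mono_on hxy (intervalIntegrable_const (c := g y))
        (integrable x hx y hy hxy)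
        (fun t ht => anti ⟨hx.1.trans ht.1, ht.2.trans hy.2⟩ hy ht.2)
      simpa using hmono
    have hU := hsub x hx y hy
    linarith
  rw [integral_same] at key
  linarith

/-- The supremum defining the utility is attained at any buyer-optimal lottery. -/
lemma util_eq_of_forall_le {n : ℕ} {v : Finset (Fin n) → ℝ} {r : PMF (Finset (Fin n)) → ℝ}
    {lam : PMF (Finset (Fin n))} (hopt : ∀ mu, lotVal v mu - r mu ≤ lotVal v lam - r lam) :
    util v r = lotVal v lam - r lam :=
  haveI : Nonempty (PMF (Finset (Fin n))) := ⟨lam⟩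
  le_antisymm (ciSup_le hopt)
    (le_ciSup (f := fun mu => lotVal v mu - r mu) ⟨_, Set.forall_mem_range.mpr hopt⟩ lam)

/-- drawing the scaling factor `α` from `[ℓ, h]` with density `1/(α ln(h/ℓ))`,
the expected revenue from a buyer purchasing optimally under `α·q` is at least
`(u(v, ℓq) − u(v, hq)) / ln(h/ℓ)`; equivalently, `∫_ℓ^h q(λ_α) dα ≥ u(v, ℓq) − u(v, hq)`. -/
theorem util_as_rev (n : ℕ) (q : PMF (Finset (Fin n)) → ℝ) (hq0 : ∀ lam, 0 ≤ q lam)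
    (ℓ h : ℝ) (hℓ : 0 < ℓ) (hℓh : ℓ < h)
    (v : Finset (Fin n) → ℝ) (hv0 : ∀ S, 0 ≤ v S)
    (sel : ℝ → PMF (Finset (Fin n)))
    (hsel : ∀ α ∈ Set.Icc ℓ h,
      ∀ lam, lotVal v lam - α * q lam ≤ lotVal v (sel α) - α * q (sel α))
    (hmeas : Measurable fun α : ℝ => q (sel α)) :
    (util v (fun lam => ℓ * q lam) - util v (fun lam => h * q lam)) / Real.log (h / ℓ) ≤
        ∫ α in ℓ..h, (α * q (sel α)) * (1 / (α * Real.log (h / ℓ))) ∧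
    util v (fun lam => ℓ * q lam) - util v (fun lam => h * q lam) ≤
        ∫ α in ℓ..h, q (sel α) := by
  have bound : util v (fun lam => ℓ * q lam) - util v (fun lam => h * q lam) ≤
      ∫ α in ℓ..h, q (sel α) := by
    rw [util_eq_of_forall_le (hsel ℓ (Set.left_mem_Icc.mpr hℓh.le)),
      util_eq_of_forall_le (hsel h (Set.right_mem_Icc.mpr hℓh.le))]
    apply sub_le_integral_of_subgradient (U := fun α => lotVal v (sel α) - α * q (sel α))
      (g := fun α => q (sel α)) hℓh
    intro x _ y hy
    have hopt := hsel y hy (sel x)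
    linarith
  refine ⟨?_, bound⟩
  have hlog : 0 < Real.log (h / ℓ) := Real.log_pos ((one_lt_div hℓ).mpr hℓh)
  have hdensity : ∫ α in ℓ..h, (α * q (sel α)) * (1 / (α * Real.log (h / ℓ))) =
      (∫ α in ℓ..h, q (sel α)) / Real.log (h / ℓ) := by
    rw [← intervalIntegral.integral_div]
    apply integral_congr
    intro α hα
    rw [Set.uIcc_of_le hℓh.le] at hα
    have hα0 : α ≠ 0 := (hℓ.trans_le hα.1).ne'
    field_simp
  rw [hdensity]
  exact div_le_div_of_nonneg_right bound hlog.le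
end

section
/- There is an absolute constant C > 0 such that for every n ≥ 2, every Sybil-proof pricing p of lotteries over n items, and every distribution D over monotone valuations (assuming buyer-optimal lotteries exist for p and for the item pricings considered, with the relevant expectations well-defined), there exists an item pricing q with Rev_D(p) ≤ C·(log n)·Rev_D(q). In particular, SybilProofRev_D ≤ O(log n)·SRev_D for arbitrary correlated distributions over arbitrary monotone valuations. -/
open MeasureTheory

/-- The distribution of the union of independent draws from the lotteries in the list `L`. -/
noncomputable def unionPMF {n : ℕ} : List (PMF (Finset (Fin n))) → PMF (Finset (Fin n))
  | [] => PMF.pure ∅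
  | l :: ls => (unionPMF ls).bind fun T => l.map fun S => S ∪ T

/-- `lam` dominates `lam'`: there is a coupling whose marginals are `lam` and `lam'` and
under which the draw from `lam'` is almost surely a subset of the draw from `lam`. -/
def Dominates {n : ℕ} (lam lam' : PMF (Finset (Fin n))) : Prop :=
  ∃ μ : PMF (Finset (Fin n) × Finset (Fin n)),
    μ.map Prod.fst = lam ∧ μ.map Prod.snd = lam' ∧ ∀ x ∈ μ.support, x.2 ⊆ x.1

/-- A pricing `p` is Sybil-proof (buy-many) if every finite multiset of lotteries is
dominated by a single lottery that is no more expensive. -/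
def SybilProof {n : ℕ} (p : PMF (Finset (Fin n)) → ℝ) : Prop :=
  ∀ L : List (PMF (Finset (Fin n))),
    ∃ lam, Dominates lam (unionPMF L) ∧ p lam ≤ (L.map p).sum

/-- The probability that item `i` is allocated by lottery `lam`. -/
noncomputable def itemProb {n : ℕ} (lam : PMF (Finset (Fin n))) (i : Fin n) : ℝ :=
  ∑ S : Finset (Fin n), (lam S).toReal * (if i ∈ S then 1 else 0)

/-- The price of a lottery under an item pricing with item prices `qi`. -/
noncomputable def itemPrice {n : ℕ} (qi : Fin n → ℝ) (lam : PMF (Finset (Fin n))) : ℝ :=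
  ∑ i : Fin n, qi i * itemProb lam i

/-- The expectation of `f` under a distribution `μ` on a finite type. -/
noncomputable def pmfExpect {α : Type*} [Fintype α] (μ : PMF α) (f : α → ℝ) : ℝ :=
  ∑ a, (μ a).toReal * f a

section Expectation

variable {α β : Type*} [Fintype α] [Fintype β]

lemma pmfExpect_const (μ : PMF α) (c : ℝ) : pmfExpect μ (fun _ => c) = c := by
  have h : ∑ a, (μ a).toReal = 1 := by
    rw [← ENNReal.toReal_sum (fun a _ => μ.apply_ne_top a), ← tsum_fintype (L := .unconditional _),
      μ.tsum_coe, ENNReal.toReal_one]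
  rw [pmfExpect, ← Finset.sum_mul, h, one_mul]

lemma pmfExpect_mono (μ : PMF α) {f g : α → ℝ} (h : ∀ a ∈ μ.support, f a ≤ g a) :
    pmfExpect μ f ≤ pmfExpect μ g := by
  refine Finset.sum_le_sum fun a _ => ?_
  by_cases ha : a ∈ μ.support
  · exact mul_le_mul_of_nonneg_left (h a ha) ENNReal.toReal_nonneg
  · simp [(μ.apply_eq_zero_iff a).2 ha]

lemma pmfExpect_sub (μ : PMF α) (f g : α → ℝ) :
    pmfExpect μ (fun a => f a - g a) = pmfExpect μ f - pmfExpect μ g := by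
  simp [pmfExpect, mul_sub]

lemma pmfExpect_mul_const (μ : PMF α) (f : α → ℝ) (c : ℝ) :
    pmfExpect μ (fun a => f a * c) = pmfExpect μ f * c := by
  simp [pmfExpect, Finset.sum_mul, mul_assoc]

lemma pmfExpect_sum {ι : Type*} (s : Finset ι) (μ : PMF α) (f : ι → α → ℝ) :
    pmfExpect μ (fun a => ∑ i ∈ s, f i a) = ∑ i ∈ s, pmfExpect μ (f i) := by
  simp only [pmfExpect, Finset.mul_sum]
  exact Finset.sum_comm

lemma pmfExpect_pure (a : α) (f : α → ℝ) : pmfExpect (PMF.pure a) f = f a := by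
  classical
  rw [pmfExpect, Finset.sum_eq_single a]
  · simp
  · intro b _ hb
    simp [PMF.pure_apply, hb]
  · simp

lemma pmfExpect_bind (μ : PMF α) (κ : α → PMF β) (f : β → ℝ) :
    pmfExpect (μ.bind κ) f = pmfExpect μ fun a => pmfExpect (κ a) f := by
  have h (b : β) : (μ.bind κ b).toReal = ∑ a, (μ a).toReal * (κ a b).toReal := by
    rw [PMF.bind_apply, tsum_fintype, ENNReal.toReal_sum]
    · simp [ENNReal.toReal_mul]
    · exact fun a _ => ENNReal.mul_ne_top (μ.apply_ne_top a) ((κ a).apply_ne_top b)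
  simp only [pmfExpect, h, Finset.sum_mul, Finset.mul_sum, mul_assoc]
  exact Finset.sum_comm

lemma pmfExpect_map (μ : PMF α) (g : α → β) (f : β → ℝ) :
    pmfExpect (μ.map g) f = pmfExpect μ (f ∘ g) := by
  rw [PMF.map, pmfExpect_bind]
  simp [pmfExpect_pure, Function.comp_def]

end Expectation

section Lotteries

variable {n : ℕ}

lemma itemProb_nonneg (lam : PMF (Finset (Fin n))) (i : Fin n) : 0 ≤ itemProb lam i :=
  Finset.sum_nonneg fun S _ => mul_nonneg ENNReal.toReal_nonneg (by split_ifs <;> norm_num)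

lemma itemProb_le_one (lam : PMF (Finset (Fin n))) (i : Fin n) : itemProb lam i ≤ 1 := by
  rw [← pmfExpect_const lam 1]
  exact pmfExpect_mono lam fun S _ => by split_ifs <;> norm_num

lemma one_sub_itemProb (lam : PMF (Finset (Fin n))) (i : Fin n) :
    1 - itemProb lam i = pmfExpect lam fun S => if i ∈ S then 0 else 1 := by
  have h : itemProb lam i = pmfExpect lam fun S => if i ∈ S then 1 else 0 := rfl
  have h1 := pmfExpect_sub lam (fun _ => 1) fun S => if i ∈ S then 1 else 0
  rw [pmfExpect_const, ← h] at h1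
  rw [← h1]
  congr 1
  funext S
  split_ifs <;> norm_num

lemma itemPrice_eq_pmfExpect (q : Fin n → ℝ) (lam : PMF (Finset (Fin n))) :
    itemPrice q lam = pmfExpect lam fun S => ∑ i ∈ S, q i := by
  simp only [itemPrice, itemProb, pmfExpect, Finset.mul_sum]
  rw [Finset.sum_comm]
  refine Finset.sum_congr rfl fun S _ => ?_
  rw [← Finset.sum_filter_add_sum_filter_not Finset.univ (· ∈ S)]
  simp only [Finset.filter_univ_mem]
  rw [Finset.sum_congr rfl (g := fun i => (lam S).toReal * q i)
      (fun i hi => by simp [hi, mul_comm]),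
    Finset.sum_eq_zero (s := Finset.univ.filter fun i => i ∉ S) (fun i hi => by simp_all), add_zero]

lemma itemPrice_smul (c : ℝ) (q : Fin n → ℝ) (lam : PMF (Finset (Fin n))) :
    itemPrice (fun i => c * q i) lam = c * itemPrice q lam := by
  simp [itemPrice, Finset.mul_sum, mul_assoc]

lemma itemPrice_nonneg {q : Fin n → ℝ} (hq : ∀ i, 0 ≤ q i) (lam : PMF (Finset (Fin n))) :
    0 ≤ itemPrice q lam :=
  Finset.sum_nonneg fun i _ => mul_nonneg (hq i) (itemProb_nonneg lam i)

/-- A monotone valuation prefers a dominating lottery. -/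
lemma Dominates.lotVal_le {lam lam' : PMF (Finset (Fin n))} (h : Dominates lam lam')
    {v : Finset (Fin n) → ℝ} (hv : Monotone v) : lotVal v lam' ≤ lotVal v lam := by
  obtain ⟨μ, rfl, rfl, hμ⟩ := h
  change pmfExpect _ v ≤ pmfExpect _ v
  rw [pmfExpect_map, pmfExpect_map]
  exact pmfExpect_mono μ fun x hx => hv (hμ x hx)

/-- Independent draws all miss item `i` with the product of the individual probabilities. -/
lemma pmfExpect_unionPMF_notMem (L : List (PMF (Finset (Fin n)))) (i : Fin n) :
    pmfExpect (unionPMF L) (fun S => if i ∈ S then 0 else 1) =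
      (L.map fun l => 1 - itemProb l i).prod := by
  induction L with
  | nil => simp [unionPMF, pmfExpect_pure]
  | cons l ls ih =>
    rw [unionPMF, pmfExpect_bind, List.map_cons, List.prod_cons, ← ih, one_sub_itemProb, mul_comm,
      ← pmfExpect_mul_const]
    congr 1
    funext T
    rw [pmfExpect_map, mul_comm, ← pmfExpect_mul_const]
    congr 1
    funext S
    by_cases hS : i ∈ S <;> by_cases hT : i ∈ T <;> simp [hS, hT]

lemma List.sum_map_flatMap {ι κ : Type*} (l : List ι) (f : ι → List κ) (g : κ → ℝ) :
    ((l.flatMap f).map g).sum = (l.map fun x => ((f x).map g).sum).sum := by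
  induction l with
  | nil => simp
  | cons a l ih => simp [ih]

lemma List.Sublist.prod_map_le {ι : Type*} {f : ι → ℝ} (h0 : ∀ x, 0 ≤ f x) (h1 : ∀ x, f x ≤ 1)
    {l₁ l₂ : List ι} (h : l₁.Sublist l₂) : (l₂.map f).prod ≤ (l₁.map f).prod := by
  have hnn (l : List ι) : 0 ≤ (l.map f).prod :=
    List.prod_nonneg fun x hx => by
      obtain ⟨y, -, rfl⟩ := List.mem_map.1 hx
      exact h0 y
  induction h with
  | slnil => simp
  | cons a _ ih =>
    rw [List.map_cons, List.prod_cons]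
    exact (mul_le_of_le_one_left (hnn _) (h1 a)).trans ih
  | cons_cons a _ ih =>
    simp only [List.map_cons, List.prod_cons]
    exact mul_le_mul_of_nonneg_left ih (h0 a)

lemma one_sub_pow_ceil_le_exp_neg {x t : ℝ} (hx : 0 < x) (hx1 : x ≤ 1) :
    (1 - x) ^ ⌈t / x⌉₊ ≤ Real.exp (-t) := by
  calc (1 - x) ^ ⌈t / x⌉₊ ≤ Real.exp (-x) ^ ⌈t / x⌉₊ :=
        pow_le_pow_left₀ (by linarith) (by linarith [Real.add_one_le_exp (-x)]) _
    _ = Real.exp (-(⌈t / x⌉₊ * x)) := by rw [← Real.exp_nat_mul]; ring_nf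
    _ ≤ Real.exp (-t) := by
        have := (div_le_iff₀ hx).1 (Nat.le_ceil (t / x))
        gcongr

/-- If the sets of a sequence ending in `∅` have decreasing values, the value of `T` falls short
of that of the first set by at most the decrements at those sets not contained in `T`. -/
lemma le_add_sum_decrements {v : Finset (Fin n) → ℝ} (hv : Monotone v) (T : Finset (Fin n))
    (M : ℕ) (S : ℕ → Finset (Fin n)) (hS : Antitone fun k => v (S k)) (hM : S M = ∅) :
    v (S 0) ≤ v T + ∑ k ∈ Finset.range M,
      (∑ i ∈ S k, if i ∈ T then 0 else 1) * (v (S k) - v (S (k + 1))) := by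
  have hnn (S' : Finset (Fin n)) : (0 : ℝ) ≤ ∑ i ∈ S', if i ∈ T then 0 else 1 :=
    Finset.sum_nonneg fun i _ => by split_ifs <;> norm_num
  have hd (k : ℕ) : 0 ≤ v (S k) - v (S (k + 1)) := sub_nonneg.2 (hS k.le_succ)
  induction M generalizing S with
  | zero => simpa [hM] using hv (Finset.empty_subset T)
  | succ M ih =>
    by_cases hsub : S 0 ⊆ T
    · exact (hv hsub).trans
        (le_add_of_nonneg_right (Finset.sum_nonneg fun k _ => mul_nonneg (hnn _) (hd k)))
    · have h1 := ih (fun k => S (k + 1)) (fun a b hab => hS (Nat.succ_le_succ hab)) hM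
        (fun k => hd (k + 1))
      obtain ⟨i, hi, hiT⟩ := Finset.not_subset.1 hsub
      have h2 : (1 : ℝ) ≤ ∑ i ∈ S 0, if i ∈ T then 0 else 1 := by
        have := Finset.single_le_sum (f := fun i => if i ∈ T then (0 : ℝ) else 1)
          (fun j _ => by split_ifs <;> norm_num) hi
        simpa [hiT] using this
      rw [Finset.sum_range_succ']
      nlinarith [hd 0, mul_le_mul_of_nonneg_right h2 (hd 0)]

/-- A buyer facing a Sybil-proof pricing who can buy each item `i` at unit cost `q i` secures
nearly the value of `S 0`, by buying all the sets `S k` with failure probabilities `exp (-t k)`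
per item. -/
lemma SybilProof.exists_lottery_of_sequence {p : PMF (Finset (Fin n)) → ℝ} (hp : SybilProof p)
    {v : Finset (Fin n) → ℝ} (hv : Monotone v) {q : Fin n → ℝ} (hq : ∀ i, 0 ≤ q i)
    {single : Fin n → PMF (Finset (Fin n))} (hpos : ∀ i, 0 < itemProb (single i) i)
    (hprice : ∀ i, p (single i) ≤ q i * itemProb (single i) i)
    {M : ℕ} {S : ℕ → Finset (Fin n)} (hS : Antitone fun k => v (S k)) (hM : S M = ∅)
    {t : ℕ → ℝ} (ht : ∀ k, 0 ≤ t k) :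
    ∃ lam, v (S 0) ≤ lotVal v lam - p lam + ∑ k ∈ Finset.range M,
      ((S k).card * Real.exp (-t k) * (v (S k) - v (S (k + 1))) +
        (t k + 1) * ∑ i ∈ S k, q i) := by
  let copies (k : ℕ) (i : Fin n) : List (PMF (Finset (Fin n))) :=
    List.replicate ⌈t k / itemProb (single i) i⌉₊ (single i)
  let bundle (k : ℕ) : List (PMF (Finset (Fin n))) := (S k).toList.flatMap (copies k)
  let L := (Finset.range M).toList.flatMap bundle
  obtain ⟨lam, hdom, hcost⟩ := hp L
  refine ⟨lam, ?_⟩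
  have hcopies (k : ℕ) (i : Fin n) : ((copies k i).map p).sum ≤ (t k + 1) * q i := by
    simp only [copies, List.map_replicate, List.sum_replicate, nsmul_eq_mul]
    have hx := hpos i
    have hc := (Nat.ceil_lt_add_one (div_nonneg (ht k) hx.le)).le
    calc (⌈t k / itemProb (single i) i⌉₊ : ℝ) * p (single i)
        ≤ (t k / itemProb (single i) i + 1) * (q i * itemProb (single i) i) := by
          refine (mul_le_mul_of_nonneg_left (hprice i) (Nat.cast_nonneg _)).trans ?_
          exact mul_le_mul_of_nonneg_right hc (mul_nonneg (hq i) hx.le)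
      _ = (t k + itemProb (single i) i) * q i := by field_simp
      _ ≤ (t k + 1) * q i :=
          mul_le_mul_of_nonneg_right (by linarith [itemProb_le_one (single i) i]) (hq i)
  have hL : (L.map p).sum ≤ ∑ k ∈ Finset.range M, (t k + 1) * ∑ i ∈ S k, q i := by
    have hL' : (L.map p).sum =
        ∑ k ∈ Finset.range M, ∑ i ∈ S k, ((copies k i).map p).sum := by
      simp only [L, bundle, List.sum_map_flatMap, Finset.sum_map_toList]
    rw [hL']
    refine Finset.sum_le_sum fun k _ => ?_
    rw [Finset.mul_sum]
    exact Finset.sum_le_sum fun i _ => hcopies k i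
  have hmiss {k : ℕ} (hk : k < M) {i : Fin n} (hi : i ∈ S k) :
      pmfExpect (unionPMF L) (fun T => if i ∈ T then 0 else 1) ≤ Real.exp (-t k) := by
    rw [pmfExpect_unionPMF_notMem]
    have hsub : (copies k i).Sublist L :=
      (List.sublist_flatten_of_mem (List.mem_map_of_mem (Finset.mem_toList.2 hi))).trans
        (List.sublist_flatten_of_mem
          (List.mem_map_of_mem (Finset.mem_toList.2 (Finset.mem_range.2 hk))))
    refine (hsub.prod_map_le (fun l => by linarith [itemProb_le_one l i])
      (fun l => by linarith [itemProb_nonneg l i])).trans ?_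
    simp only [copies, List.map_replicate, List.prod_replicate]
    exact one_sub_pow_ceil_le_exp_neg (hpos i) (itemProb_le_one _ _)
  have hval : v (S 0) ≤ lotVal v (unionPMF L) + ∑ k ∈ Finset.range M,
      (S k).card * Real.exp (-t k) * (v (S k) - v (S (k + 1))) := by
    have h := pmfExpect_mono (unionPMF L) (f := fun T => v (S 0) - v T)
      fun T _ => sub_le_iff_le_add'.2 (le_add_sum_decrements hv T M S hS hM)
    rw [pmfExpect_sub, pmfExpect_const, pmfExpect_sum] at h
    refine (sub_le_iff_le_add'.1 h).trans (add_le_add le_rfl (Finset.sum_le_sum fun k hk => ?_))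
    rw [pmfExpect_mul_const, pmfExpect_sum]
    refine mul_le_mul_of_nonneg_right ?_ (sub_nonneg.2 (hS k.le_succ))
    refine (Finset.sum_le_card_nsmul _ _ _ fun i hi => hmiss (Finset.mem_range.1 hk) hi).trans ?_
    rw [nsmul_eq_mul]
  have := hdom.lotVal_le hv
  rw [Finset.sum_add_distrib]
  linarith

/-- The cheapest unit cost of item `i`, up to `η`. -/
lemma exists_unit_cost {p : PMF (Finset (Fin n)) → ℝ} (hp : ∀ lam, 0 ≤ p lam) {η : ℝ} (hη : 0 < η)
    (i : Fin n) : ∃ c, η ≤ c ∧ (∀ lam, c * itemProb lam i ≤ p lam + η) ∧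
      ∃ lam, 0 < itemProb lam i ∧ p lam ≤ c * itemProb lam i := by
  let A : Set ℝ := {r | ∃ lam, 0 < itemProb lam i ∧ p lam / itemProb lam i = r}
  have hne : A.Nonempty := by
    have h1 : itemProb (PMF.pure (Finset.univ : Finset (Fin n))) i = 1 :=
      (pmfExpect_pure _ _).trans (by simp)
    exact ⟨_, PMF.pure Finset.univ, by rw [h1]; norm_num, rfl⟩
  have h0 : ∀ r ∈ A, 0 ≤ r := by
    rintro _ ⟨lam, hl, rfl⟩
    exact div_nonneg (hp lam) hl.le
  refine ⟨sInf A + η, by linarith [Real.sInf_nonneg h0], fun lam => ?_, ?_⟩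
  · have h1 : sInf A * itemProb lam i ≤ p lam := by
      rcases (itemProb_nonneg lam i).eq_or_lt with h | h
      · simpa [← h] using hp lam
      · exact (le_div_iff₀ h).1 (csInf_le ⟨0, h0⟩ ⟨lam, h, rfl⟩)
    nlinarith [itemProb_le_one lam i]
  · obtain ⟨_, ⟨lam, hl, rfl⟩, hlt⟩ := Real.lt_sInf_add_pos hne hη
    exact ⟨lam, hl, (div_le_iff₀ hl).1 hlt.le⟩

lemma itemPrice_le_card_mul {p : PMF (Finset (Fin n)) → ℝ} {η : ℝ} {q : Fin n → ℝ}
    (hq : ∀ i lam, q i * itemProb lam i ≤ p lam + η) (lam : PMF (Finset (Fin n))) :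
    itemPrice q lam ≤ n * (p lam + η) :=
  (Finset.sum_le_card_nsmul _ _ _ fun i _ => hq i lam).trans_eq (by simp [mul_add])

/-- The price of the buyer's favourite lottery under `p` is bounded by a weighted sum of the
prices she pays under the item pricings `2 ^ k / (4 * n) * q`. -/
lemma SybilProof.price_le_weighted_sum (hn : 0 < n) {p : PMF (Finset (Fin n)) → ℝ}
    (hsp : SybilProof p) {η : ℝ} (hη : 0 < η) {q : Fin n → ℝ} (hqη : ∀ i, η ≤ q i)
    (hq : ∀ i lam, q i * itemProb lam i ≤ p lam + η)
    {single : Fin n → PMF (Finset (Fin n))} (hpos : ∀ i, 0 < itemProb (single i) i)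
    (hprice : ∀ i, p (single i) ≤ q i * itemProb (single i) i)
    {v : Finset (Fin n) → ℝ} (hv : Monotone v) {opt : PMF (Finset (Fin n))}
    (hopt : ∀ lam, lotVal v lam - p lam ≤ lotVal v opt - p opt)
    {a : ℕ → PMF (Finset (Fin n))}
    (ha : ∀ k lam, lotVal v lam - 2 ^ k / (4 * n) * itemPrice q lam ≤
      lotVal v (a k) - 2 ^ k / (4 * n) * itemPrice q (a k)) (K : ℕ) :
    ∃ M, p opt - (p opt + η) / 4 - ∑ k ∈ Finset.range (K + 1), 2 ^ k / (4 * n) * itemPrice q (a k)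
      ≤ ∑ m ∈ Finset.range M, (K + m + 3) * (4 * n / 2 ^ (K + m)) *
        (2 ^ (K + m) / (4 * n) * itemPrice q (a (K + m))) := by
  have hn' : (0 : ℝ) < n := Nat.cast_pos.2 hn
  have hq0 (i : Fin n) : 0 ≤ q i := hη.le.trans (hqη i)
  let c (k : ℕ) : ℝ := 2 ^ k / (4 * n)
  have hc (k : ℕ) : 0 < c k := by positivity
  have hcs (k : ℕ) : c (k + 1) = 2 * c k := by simp only [c]; ring
  let Q (S : Finset (Fin n)) : ℝ := ∑ i ∈ S, q i
  have hQ0 (S : Finset (Fin n)) : 0 ≤ Q S := Finset.sum_nonneg fun i _ => hq0 i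
  have hmax (k : ℕ) : ∃ S, ∀ T, v T - c k * Q T ≤ v S - c k * Q S := by
    obtain ⟨S, -, hS⟩ := Finset.exists_max_image Finset.univ (fun T => v T - c k * Q T)
      Finset.univ_nonempty
    exact ⟨S, fun T => hS T (Finset.mem_univ T)⟩
  choose S hS using hmax
  have hSlot (k : ℕ) (lam : PMF (Finset (Fin n))) :
      lotVal v lam - c k * itemPrice q lam ≤ v (S k) - c k * Q (S k) := by
    have h := pmfExpect_mono lam fun T _ => hS k T
    rw [pmfExpect_const, pmfExpect_sub, show pmfExpect lam v = lotVal v lam from rfl] at h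
    have h2 := pmfExpect_mul_const lam Q (c k)
    rw [itemPrice_eq_pmfExpect, mul_comm (c k), ← h2]
    simpa only [mul_comm (c k)] using h
  have haS (k : ℕ) (T : Finset (Fin n)) :
      v T - c k * Q T ≤ lotVal v (a k) - c k * itemPrice q (a k) := by
    have h := ha k (PMF.pure T)
    rw [itemPrice_eq_pmfExpect q (PMF.pure T), pmfExpect_pure] at h
    have h2 : lotVal v (PMF.pure T) = v T := pmfExpect_pure T v
    rwa [h2] at h
  have hdrop (k : ℕ) : (v (S k) - c k * Q (S k)) - (v (S (k + 1)) - c (k + 1) * Q (S (k + 1)))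
      ≤ c k * itemPrice q (a k) := by
    have h1 := haS k (S k)
    have h2 := hSlot (k + 1) (a k)
    rw [hcs] at h2 ⊢
    linarith
  have hQa (k : ℕ) : Q (S (k + 1)) ≤ itemPrice q (a k) := by
    have h1 := haS k (S (k + 1))
    have h2 := hSlot (k + 1) (a k)
    rw [hcs] at h2
    exact le_of_mul_le_mul_left (by linarith) (hc k)
  have hQs (k : ℕ) : Q (S (k + 1)) ≤ Q (S k) := by
    have h1 := hS k (S (k + 1))
    have h2 := hS (k + 1) (S k)
    rw [hcs] at h2
    exact le_of_mul_le_mul_left (by linarith) (hc k)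
  have hvs (k : ℕ) : v (S (k + 1)) ≤ v (S k) := by
    linarith [hS k (S (k + 1)), mul_le_mul_of_nonneg_left (hQs k) (hc k).le]
  have hvd (k : ℕ) : v (S k) - v (S (k + 1)) ≤ 2 * c k * Q (S k) := by
    have h2 := hS (k + 1) (S k)
    rw [hcs] at h2
    linarith [mul_nonneg (hc k).le (hQ0 (S (k + 1)))]
  have hempty : ∃ M, S (K + 1 + M) = ∅ := by
    obtain ⟨M, hM⟩ := pow_unbounded_of_one_lt ((v Finset.univ - v ∅) / η * (4 * n)) one_lt_two
    have hcM : v Finset.univ - v ∅ < c (K + 1 + M) * η := by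
      rw [← div_lt_iff₀ hη, lt_div_iff₀ (by positivity)]
      exact hM.trans_le (pow_le_pow_right₀ one_le_two (by omega))
    refine ⟨M, Finset.not_nonempty_iff_eq_empty.1 fun ⟨i, hi⟩ => ?_⟩
    have h1 := hS (K + 1 + M) ∅
    have h2 : η ≤ Q (S (K + 1 + M)) :=
      (hqη i).trans (Finset.single_le_sum (f := q) (fun j _ => hq0 j) hi)
    have h3 : Q ∅ = 0 := Finset.sum_empty
    rw [h3] at h1
    linarith [mul_le_mul_of_nonneg_left h2 (hc (K + 1 + M)).le,
      hv (Finset.subset_univ (S (K + 1 + M)))]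
  obtain ⟨M, hM⟩ := hempty
  refine ⟨M, ?_⟩
  obtain ⟨lam, hlam⟩ := hsp.exists_lottery_of_sequence hv hq0 hpos hprice
    (S := fun m => S (K + 1 + m)) (M := M)
    (antitone_nat_of_succ_le fun m => hvs (K + 1 + m)) hM
    (t := fun m => ((K + 1 + m : ℕ) : ℝ)) (fun m => Nat.cast_nonneg _)
  have hloss (k : ℕ) : (S k).card * Real.exp (-(k : ℝ)) * (v (S k) - v (S (k + 1))) ≤ Q (S k) := by
    have hcard : ((S k).card : ℝ) ≤ n := by
      exact_mod_cast (Finset.card_le_univ (S k)).trans (by simp)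
    have hexp : (2 : ℝ) ^ k ≤ Real.exp k := by
      rw [← mul_one (k : ℝ), Real.exp_nat_mul]
      exact pow_le_pow_left₀ zero_le_two (by linarith [Real.add_one_le_exp 1]) k
    calc (S k).card * Real.exp (-(k : ℝ)) * (v (S k) - v (S (k + 1)))
        ≤ n * (2 ^ k)⁻¹ * (2 * c k * Q (S k)) := by
          rw [Real.exp_neg]
          refine mul_le_mul ?_ (hvd k) (sub_nonneg.2 (hvs k)) (by positivity)
          exact mul_le_mul hcard (inv_anti₀ (by positivity) hexp) (by positivity) hn'.le
      _ = Q (S k) / 2 := by simp only [c]; field_simp; ring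
      _ ≤ Q (S k) := by linarith [hQ0 (S k)]
  have hterm : ∑ m ∈ Finset.range M,
      ((S (K + 1 + m)).card * Real.exp (-((K + 1 + m : ℕ) : ℝ)) *
        (v (S (K + 1 + m)) - v (S (K + 1 + (m + 1)))) +
        (((K + 1 + m : ℕ) : ℝ) + 1) * Q (S (K + 1 + m))) ≤
      ∑ m ∈ Finset.range M, (K + m + 3) * (4 * n / 2 ^ (K + m)) *
        (2 ^ (K + m) / (4 * n) * itemPrice q (a (K + m))) := by
    refine Finset.sum_le_sum fun m _ => ?_
    have h1 := hloss (K + 1 + m)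
    have h2 := hQa (K + m)
    rw [show K + m + 1 = K + 1 + m by ring] at h2
    have h3 : (K + m + 3) * (4 * n / 2 ^ (K + m)) *
        (2 ^ (K + m) / (4 * n) * itemPrice q (a (K + m))) =
        (K + m + 3) * itemPrice q (a (K + m)) := by field_simp
    rw [h3, ← add_assoc (K + 1) m 1]
    have h4 := mul_le_mul_of_nonneg_left h2 (by positivity : (0 : ℝ) ≤ K + m + 3)
    push_cast at h1 ⊢
    linarith
  have htel : (v (S 0) - c 0 * Q (S 0)) - (v (S (K + 1)) - c (K + 1) * Q (S (K + 1))) ≤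
      ∑ k ∈ Finset.range (K + 1), c k * itemPrice q (a k) := by
    rw [← Finset.sum_range_sub' (fun k => v (S k) - c k * Q (S k))]
    exact Finset.sum_le_sum fun k _ => hdrop k
  have hstart : lotVal v opt - (p opt + η) / 4 ≤ v (S 0) - c 0 * Q (S 0) := by
    have h1 := hSlot 0 opt
    have h2 := mul_le_mul_of_nonneg_left (itemPrice_le_card_mul hq opt) (hc 0).le
    have h3 : c 0 * (n * (p opt + η)) = (p opt + η) / 4 := by simp only [c]; field_simp
    linarith
  have hl := hopt lam
  have hend := mul_nonneg (hc (K + 1)).le (hQ0 (S (K + 1)))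
  simp only [add_zero] at hlam
  linarith

end Lotteries

/-- An integrable function that is pointwise below some partial sum of nonnegative functions has
integral at most any bound on the sums of their integrals. -/
lemma integral_le_of_le_partial_sums {Ω : Type*} [MeasurableSpace Ω] {μ : Measure Ω} {F : Ω → ℝ}
    (hF : Integrable F μ) {g : ℕ → Ω → ℝ} (hg : ∀ m, Integrable (g m) μ) (hg0 : ∀ m x, 0 ≤ g m x)
    (hFg : ∀ᵐ x ∂μ, ∃ M, F x ≤ ∑ m ∈ Finset.range M, g m x) {B : ℝ}
    (hB : ∀ M, ∑ m ∈ Finset.range M, ∫ x, g m x ∂μ ≤ B) : ∫ x, F x ∂μ ≤ B := by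
  have hG (M : ℕ) : Integrable (fun x => ∑ m ∈ Finset.range M, g m x) μ :=
    integrable_finsetSum _ fun m _ => hg m
  have hG0 (M : ℕ) (x : Ω) : 0 ≤ ∑ m ∈ Finset.range M, g m x :=
    Finset.sum_nonneg fun m _ => hg0 m x
  have hlim := tendsto_integral_of_dominated_convergence (μ := μ)
    (F := fun M x => min (F x) (∑ m ∈ Finset.range M, g m x)) (f := F) (fun x => |F x|)
    (fun M => (hF.inf (hG M)).aestronglyMeasurable) hF.abs
    (fun M => Filter.Eventually.of_forall fun x => by
      rw [Real.norm_eq_abs, abs_le]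
      refine ⟨le_min (neg_abs_le _) ((neg_nonpos.2 (abs_nonneg _)).trans (hG0 M x)),
        (min_le_left _ _).trans (le_abs_self _)⟩)
    (by
      filter_upwards [hFg] with x ⟨M, hM⟩
      refine tendsto_const_nhds.congr' ?_
      filter_upwards [Filter.eventually_ge_atTop M] with N hN
      refine (min_eq_left (hM.trans ?_)).symm
      exact Finset.sum_le_sum_of_subset_of_nonneg (Finset.range_subset_range.2 hN)
        fun m _ _ => hg0 m x)
  refine le_of_tendsto' hlim fun M => ?_
  calc ∫ x, min (F x) (∑ m ∈ Finset.range M, g m x) ∂μ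
      ≤ ∫ x, ∑ m ∈ Finset.range M, g m x ∂μ :=
        integral_mono (hF.inf (hG M)) (hG M) fun x => min_le_right _ _
    _ = ∑ m ∈ Finset.range M, ∫ x, g m x ∂μ := integral_finsetSum _ fun m _ => hg m
    _ ≤ B := hB M

lemma sum_arith_geom_le (K M : ℕ) :
    ∑ m ∈ Finset.range M, ((K + m + 3 : ℝ) * (1 / 2 ^ (K + m))) ≤ 2 * (K + 4) / 2 ^ K := by
  have h : ∑ m ∈ Finset.range M, ((K + m + 3 : ℝ) * (1 / 2 ^ (K + m))) =
      2 * (K + 4) / 2 ^ K - 2 * (K + M + 4) / 2 ^ (K + M) := by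
    induction M with
    | zero => simp
    | succ M ih =>
      rw [Finset.sum_range_succ, ih, ← add_assoc, pow_succ]
      push_cast
      field_simp
      ring
  rw [h]
  exact sub_le_self _ (by positivity)

lemma Nat.clog_two_le_four_mul_log {n : ℕ} (hn : 2 ≤ n) : (Nat.clog 2 n : ℝ) ≤ 4 * Real.log n := by
  have hlt : 2 ^ (Nat.clog 2 n - 1) < n := Nat.pow_pred_clog_lt_self one_lt_two hn
  have h1 : 1 ≤ Nat.clog 2 n := Nat.clog_pos one_lt_two hn
  have h2 : ((Nat.clog 2 n - 1 : ℕ) : ℝ) * Real.log 2 ≤ Real.log n := by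
    rw [← Real.log_pow]
    exact Real.log_le_log (by positivity) (by exact_mod_cast hlt.le)
  have h3 : Real.log 2 ≤ Real.log n := Real.log_le_log two_pos (by exact_mod_cast hn)
  rw [Nat.cast_sub h1, Nat.cast_one] at h2
  have h4 := Real.log_two_gt_d9
  have h5 : (Nat.clog 2 n : ℝ) * Real.log 2 ≤ 2 * Real.log n := by linarith
  nlinarith [(Nat.clog 2 n).cast_nonneg (α := ℝ)]

/-- there is an absolute constant `C > 0` such that for every `n ≥ 2`, every
Sybil-proof pricing `p`, and every distribution `D` over monotone valuations, some item
pricing `q` satisfies `Rev_D(p) ≤ C (log n) Rev_D(q)`: i.e.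
`SybilProofRev_D ≤ O(log n)·SRev_D`. -/
theorem sybilproof_le_srev :
    ∃ C : ℝ, 0 < C ∧
      ∀ n : ℕ, 2 ≤ n →
        ∀ p : PMF (Finset (Fin n)) → ℝ, (∀ lam, 0 ≤ p lam) → SybilProof p →
          ∀ D : Measure (Finset (Fin n) → ℝ), IsProbabilityMeasure D →
            (∀ᵐ v ∂D, (∀ S, 0 ≤ v S) ∧ ∀ S T : Finset (Fin n), S ⊆ T → v S ≤ v T) →
            ∀ selp : (Finset (Fin n) → ℝ) → PMF (Finset (Fin n)),
              (∀ᵐ v ∂D, ∀ lam, lotVal v lam - p lam ≤ lotVal v (selp v) - p (selp v)) →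
              Integrable (fun v => p (selp v)) D →
              ∃ qi : Fin n → ℝ, (∀ i, 0 ≤ qi i) ∧
                ∀ selq : (Finset (Fin n) → ℝ) → PMF (Finset (Fin n)),
                  (∀ᵐ v ∂D, ∀ lam, lotVal v lam - itemPrice qi lam ≤
                      lotVal v (selq v) - itemPrice qi (selq v)) →
                  Integrable (fun v => itemPrice qi (selq v)) D →
                  (∫ v, p (selp v) ∂D) ≤
                    C * Real.log n * ∫ v, itemPrice qi (selq v) ∂D := by
  refine ⟨400, by norm_num, ?_⟩
  intro n hn p hp hsp D hD hmono selp hselp hint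
  have hn0 : 0 < n := by omega
  have hn' : (0 : ℝ) < n := Nat.cast_pos.2 hn0
  set R := ∫ v, p (selp v) ∂D with hR
  have hRnn : 0 ≤ R := integral_nonneg fun v => hp (selp v)
  rcases hRnn.eq_or_lt with hR0 | hRpos
  · refine ⟨fun _ => 0, fun _ => le_rfl, fun selq _ _ => ?_⟩
    rw [← hR0]
    simp [itemPrice]
  by_contra! hcon
  choose q hqη hq single hpos hprice using exists_unit_cost hp hRpos
  have hq0 (i : Fin n) : 0 ≤ q i := hRpos.le.trans (hqη i)
  choose a ha hint_a hrev using fun k : ℕ => hcon (fun i => 2 ^ k / (4 * n) * q i)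
    fun i => mul_nonneg (by positivity) (hq0 i)
  let K := Nat.clog 2 n
  let B := R / (400 * Real.log n)
  let rev (k : ℕ) (v : Finset (Fin n) → ℝ) : ℝ := 2 ^ k / (4 * n) * itemPrice q (a k v)
  have hrev_eq (k : ℕ) : (fun v => itemPrice (fun i => 2 ^ k / (4 * n) * q i) (a k v)) = rev k :=
    funext fun v => itemPrice_smul _ _ _
  have hlog : 0 < Real.log n := Real.log_pos (by exact_mod_cast hn)
  have hrevB (k : ℕ) : ∫ v, rev k v ∂D ≤ B := by
    have h := hrev k
    rw [hrev_eq] at h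
    rw [le_div_iff₀ (by positivity)]
    linarith
  have hrev_int (k : ℕ) : Integrable (rev k) D := hrev_eq k ▸ hint_a k
  have hrev0 (k : ℕ) (v : Finset (Fin n) → ℝ) : 0 ≤ rev k v :=
    mul_nonneg (by positivity) (itemPrice_nonneg hq0 _)
  have hB : 0 < B := by positivity
  have hsum_int : Integrable (fun v => ∑ k ∈ Finset.range (K + 1), rev k v) D :=
    integrable_finsetSum _ fun k _ => hrev_int k
  have hshift_int : Integrable (fun v => (p (selp v) + R) / 4) D :=
    (hint.add (integrable_const R)).div_const 4
  have hdiff_int : Integrable (fun v => p (selp v) - (p (selp v) + R) / 4) D :=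
    hint.sub hshift_int
  have hpoint : ∀ᵐ v ∂D, ∃ M, p (selp v) - (p (selp v) + R) / 4 -
      ∑ k ∈ Finset.range (K + 1), rev k v ≤
      ∑ m ∈ Finset.range M, (K + m + 3) * (4 * n / 2 ^ (K + m)) * rev (K + m) v := by
    filter_upwards [hmono, hselp, ae_all_iff.2 ha] with v hv hopt hav
    refine hsp.price_le_weighted_sum hn0 hRpos hqη hq hpos hprice (fun S T h => hv.2 S T h) hopt
      (a := fun k => a k v) (fun k lam => ?_) K
    simpa only [itemPrice_smul] using hav k lam
  have hmain := integral_le_of_le_partial_sums (hdiff_int.sub hsum_int)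
    (fun m => (hrev_int (K + m)).const_mul ((K + m + 3) * (4 * n / 2 ^ (K + m))))
    (fun m v => mul_nonneg (by positivity) (hrev0 _ v)) hpoint (B := 8 * (K + 4) * B) ?_
  · have hF : ∫ v, (p (selp v) - (p (selp v) + R) / 4 - ∑ k ∈ Finset.range (K + 1), rev k v) ∂D =
        R - (R + R) / 4 - ∑ k ∈ Finset.range (K + 1), ∫ v, rev k v ∂D := by
      rw [integral_sub hdiff_int hsum_int, integral_sub hint hshift_int,
        integral_finsetSum _ fun k _ => hrev_int k, integral_div,
        integral_add hint (integrable_const R), integral_const]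
      simp [← hR]
    have hhead : ∑ k ∈ Finset.range (K + 1), ∫ v, rev k v ∂D ≤ (K + 1) * B :=
      (Finset.sum_le_card_nsmul _ _ _ fun k _ => hrevB k).trans (by simp)
    have hbound : R ≤ 2 * ((9 * K + 33) * B) := by
      have h := hF.symm.trans_le hmain
      linarith
    have hK1 : (1 : ℝ) ≤ K := by exact_mod_cast Nat.clog_pos one_lt_two hn
    have hK : (K : ℝ) ≤ 4 * Real.log n := Nat.clog_two_le_four_mul_log hn
    have hBR : B * (400 * Real.log n) = R := div_mul_cancel₀ _ (by positivity)
    nlinarith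
  · intro M
    have hnK : (n : ℝ) ≤ 2 ^ K := by exact_mod_cast Nat.le_pow_clog one_lt_two n
    calc ∑ m ∈ Finset.range M, ∫ v, (K + m + 3) * (4 * n / 2 ^ (K + m)) * rev (K + m) v ∂D
        ≤ ∑ m ∈ Finset.range M, ((K + m + 3 : ℝ) * (1 / 2 ^ (K + m))) * (4 * n * B) := by
          refine Finset.sum_le_sum fun m _ => ?_
          rw [integral_const_mul]
          refine (mul_le_mul_of_nonneg_left (hrevB (K + m)) (by positivity)).trans_eq ?_
          ring
      _ ≤ 2 * (K + 4) / 2 ^ K * (4 * n * B) := by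
          rw [← Finset.sum_mul]
          exact mul_le_mul_of_nonneg_right (sum_arith_geom_le K M) (by positivity)
      _ = 8 * (K + 4) * B * (n / 2 ^ K) := by ring
      _ ≤ 8 * (K + 4) * B :=
          mul_le_of_le_one_right (by positivity) ((div_le_one (by positivity)).2 hnK)
end

section
/- Let n ≥ 2, let p : 2^[n] → ℝ≥0 be a monotone subadditive deterministic pricing with p(∅) = 0, and let D be any distribution over valuations (assuming buyer-optimal sets exist for all pricings considered and the relevant expectations are well-defined). Then there exists a scalar α ∈ [1/(2n), 1] such that the item pricing q_α given by q_α(S) = α·Σ_{i∈S} p({i}) satisfies Rev_D(q_α) ≥ Rev_D(p) / (2·ln(2n)). Consequently the optimal deterministic Sybil-proof revenue satisfies DetSybilProofRev_D ≤ 2·ln(2n)·SRev_D. -/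
open MeasureTheory

/-- A function whose decrements on `[x, y]` are at most quadratic in the step does not decrease
from `x` to `y`. -/
lemma le_of_sub_le_mul_sq {H : ℝ → ℝ} {K x y : ℝ} (hxy : x ≤ y)
    (h : ∀ s t, x ≤ s → s ≤ t → t ≤ y → H s - H t ≤ K * (t - s) ^ 2) : H x ≤ H y := by
  by_contra! hlt
  obtain ⟨N, hN⟩ := exists_nat_gt (K * (y - x) ^ 2 / (H x - H y))
  have hpos : 0 < H x - H y := sub_pos.2 hlt
  have hK : H x - H y ≤ K * (y - x) ^ 2 := h x y le_rfl hxy le_rfl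
  have hN0 : (0 : ℝ) < N := lt_trans (div_pos (hpos.trans_le hK) hpos) hN
  set d := (y - x) / N with hd
  have hd0 : 0 ≤ d := div_nonneg (sub_nonneg.2 hxy) hN0.le
  have hNd : N * d = y - x := by rw [hd]; field_simp
  have key : ∀ k : ℕ, k ≤ N → H x - H (x + k * d) ≤ k * (K * d ^ 2) := by
    intro k
    induction k with
    | zero => intro _; simp
    | succ k ih =>
      intro hk
      have hkN : ((k + 1 : ℕ) : ℝ) * d ≤ N * d :=
        mul_le_mul_of_nonneg_right (by exact_mod_cast hk) hd0
      have hkd : 0 ≤ (k : ℝ) * d := by positivity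
      push_cast at hkN ⊢
      have step := h (x + k * d) (x + (k + 1) * d) (by linarith) (by linarith) (by linarith)
      have heq : x + (k + 1) * d - (x + k * d) = d := by ring
      rw [heq] at step
      linarith [ih (by omega)]
  have hfin := key N le_rfl
  rw [hNd, add_sub_cancel] at hfin
  rw [div_lt_iff₀ hpos] at hN
  have hsq : N * (N * (K * d ^ 2)) = K * (y - x) ^ 2 := by rw [← hNd]; ring
  have := mul_le_mul_of_nonneg_left hfin hN0.le
  linarith

/-- If the slope `g` of the decreasing function `F` satisfies `α * g α < c` on `[a, 1]`, then
`F` drops by less than `c * log (1 / a)` from `a` to `1`. -/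
lemma sub_lt_neg_mul_log {F g : ℝ → ℝ} {a c : ℝ} (ha : 0 < a) (ha1 : a < 1)
    (hF : ∀ α β, a ≤ α → α ≤ β → β ≤ 1 → F α - F β ≤ (β - α) * g α)
    (hg : ∀ α, a ≤ α → α ≤ 1 → 0 ≤ g α)
    (hc : ∀ α, a ≤ α → α ≤ 1 → α * g α < c) :
    F a - F 1 < -(c * Real.log a) := by
  have hga := hg a le_rfl ha1.le
  have hca := hc a le_rfl ha1.le
  have hc0 : 0 < c := (mul_nonneg ha.le hga).trans_lt hca
  have hlog : ∀ s t : ℝ, 0 < s → s ≤ t → (t - s) / t ≤ Real.log t - Real.log s := by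
    intro s t hs hst
    have ht : 0 < t := hs.trans_le hst
    have h := Real.one_sub_inv_le_log_of_pos (div_pos ht hs)
    rw [Real.log_div ht.ne' hs.ne', inv_div] at h
    rwa [sub_div, div_self ht.ne']
  obtain ⟨b, hab, hb1, hgb⟩ : ∃ b, a < b ∧ b ≤ 1 ∧ b * g a < c := by
    obtain h | h := hga.eq_or_lt
    · exact ⟨1, ha1, le_rfl, by rw [← h]; simpa using hc0⟩
    · obtain ⟨b, hab, hb⟩ := exists_between (lt_min ha1 ((lt_div_iff₀ h).2 hca))
      exact ⟨b, hab, (hb.trans_le (min_le_left _ _)).le,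
        (lt_div_iff₀ h).1 (hb.trans_le (min_le_right _ _))⟩
  have hb0 : 0 < b := ha.trans hab
  have hfirst : F a - F b < c * (Real.log b - Real.log a) :=
    calc F a - F b ≤ (b - a) * g a := hF a b le_rfl hab.le hb1
      _ < (b - a) * (c / b) :=
        mul_lt_mul_of_pos_left ((lt_div_iff₀ hb0).2 (by linarith)) (sub_pos.2 hab)
      _ = c * ((b - a) / b) := by ring
      _ ≤ c * (Real.log b - Real.log a) :=
        mul_le_mul_of_nonneg_left (hlog a b ha hab.le) hc0.le
  have hrest : F b + c * Real.log b ≤ F 1 + c * Real.log 1 := by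
    refine le_of_sub_le_mul_sq (H := fun x => F x + c * Real.log x) (K := c / a ^ 2) hb1 ?_
    intro s t hbs hst ht1
    have has : a ≤ s := hab.le.trans hbs
    have hs : 0 < s := ha.trans_le has
    have ht : 0 < t := hs.trans_le hst
    have hgs : g s ≤ c / s := (le_div_iff₀ hs).2 (by linarith [hc s has (hst.trans ht1)])
    have hinv : 1 / (s * t) ≤ 1 / a ^ 2 := by
      apply one_div_le_one_div_of_le (by positivity)
      nlinarith
    calc F s + c * Real.log s - (F t + c * Real.log t)
        = (F s - F t) - c * (Real.log t - Real.log s) := by ring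
      _ ≤ (t - s) * (c / s) - c * ((t - s) / t) :=
        sub_le_sub ((hF s t has hst ht1).trans
          (mul_le_mul_of_nonneg_left hgs (sub_nonneg.2 hst)))
          (mul_le_mul_of_nonneg_left (hlog s t hs hst) hc0.le)
      _ = c * (t - s) ^ 2 * (1 / (s * t)) := by field_simp
      _ ≤ c * (t - s) ^ 2 * (1 / a ^ 2) := mul_le_mul_of_nonneg_left hinv (by positivity)
      _ = c / a ^ 2 * (t - s) ^ 2 := by ring
  rw [Real.log_one] at hrest
  linarith

lemma le_sum_singleton {ι : Type*} [DecidableEq ι] {p : Finset ι → ℝ}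
    (hsub : ∀ S T : Finset ι, p (S ∪ T) ≤ p S + p T) (hempty : p ∅ = 0) (S : Finset ι) :
    p S ≤ ∑ i ∈ S, p {i} := by
  induction S using Finset.induction_on with
  | empty => simp [hempty]
  | insert i S hi ih =>
    rw [Finset.sum_insert hi, Finset.insert_eq]
    exact (hsub _ _).trans (by linarith)

section Pricing

variable {ι : Type*} [Fintype ι]

/-- The optimal utility of a buyer with valuation `v` when each set `S` is priced at `q S`. -/
noncomputable def buyerUtility (q v : Finset ι → ℝ) : ℝ :=
  Finset.univ.sup' Finset.univ_nonempty fun S => v S - q S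

lemma le_buyerUtility (q v : Finset ι → ℝ) (S : Finset ι) : v S - q S ≤ buyerUtility q v :=
  Finset.le_sup' (fun S => v S - q S) (Finset.mem_univ S)

lemma buyerUtility_le {q v : Finset ι → ℝ} {x : ℝ} (h : ∀ S, v S - q S ≤ x) :
    buyerUtility q v ≤ x :=
  Finset.sup'_le _ _ fun S _ => h S

lemma measurable_buyerUtility (q : Finset ι → ℝ) : Measurable (buyerUtility q) := by
  have h : Measurable (Finset.univ.sup' Finset.univ_nonempty
      fun (S : Finset ι) (v : Finset ι → ℝ) => v S - q S) :=
    Finset.measurable_sup' _ fun S _ => (measurable_pi_apply S).sub_const _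
  convert h using 1
  ext v
  simp [buyerUtility, Finset.sup'_apply]

lemma buyerUtility_sub_le {q r : Finset ι → ℝ} {C : ℝ} (h : ∀ S, r S - q S ≤ C)
    (v : Finset ι → ℝ) : buyerUtility q v - buyerUtility r v ≤ C := by
  rw [sub_le_iff_le_add]
  exact buyerUtility_le fun S => by linarith [h S, le_buyerUtility r v S]

lemma integrable_buyerUtility_sub (D : Measure (Finset ι → ℝ)) [IsFiniteMeasure D]
    (q r : Finset ι → ℝ) : Integrable (fun v => buyerUtility q v - buyerUtility r v) D := by
  obtain ⟨C, hC⟩ := (Set.finite_range fun S => |q S - r S|).bddAbove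
  have hC' : ∀ S, |q S - r S| ≤ C := fun S => hC ⟨S, rfl⟩
  refine Integrable.of_bound
    ((measurable_buyerUtility q).sub (measurable_buyerUtility r)).aestronglyMeasurable C
    (Filter.Eventually.of_forall fun v => abs_le.2 ⟨?_, ?_⟩)
  · have := buyerUtility_sub_le (q := r) (r := q) (fun S => (abs_le.1 (hC' S)).2) v
    linarith
  · exact buyerUtility_sub_le (fun S => by linarith [(abs_le.1 (hC' S)).1]) v

lemma sum_singleton_le_card_mul {p : Finset ι → ℝ} (hp0 : ∀ S, 0 ≤ p S)
    (hmono : ∀ S T : Finset ι, S ⊆ T → p S ≤ p T) (S : Finset ι) :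
    ∑ i ∈ S, p {i} ≤ Fintype.card ι * p S :=
  calc ∑ i ∈ S, p {i} ≤ S.card * p S := by
        rw [← nsmul_eq_mul]
        exact Finset.sum_le_card_nsmul _ _ _ fun i hi =>
          hmono _ _ (Finset.singleton_subset_iff.2 hi)
    _ ≤ Fintype.card ι * p S :=
        mul_le_mul_of_nonneg_right (by exact_mod_cast Finset.card_le_univ S) (hp0 S)

end Pricing

/-- for any `n ≥ 2`, any monotone subadditive deterministic pricing `p` with
`p ∅ = 0`, and any distribution `D` over valuations, there is a scaling factor
`α ∈ [1/(2n), 1]` such that the item pricing `q_α(S) = α·Σ_{i∈S} p({i})` obtains revenue at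
least `Rev_D(p) / (2 ln (2n))`; consequently `DetSybilProofRev_D ≤ 2 ln(2n) · SRev_D`. -/
theorem det_sybilproof_le_srev (n : ℕ) (hn : 2 ≤ n)
    (p : Finset (Fin n) → ℝ) (hp0 : ∀ S, 0 ≤ p S)
    (hmono : ∀ S T : Finset (Fin n), S ⊆ T → p S ≤ p T)
    (hsub : ∀ S T : Finset (Fin n), p (S ∪ T) ≤ p S + p T)
    (hempty : p ∅ = 0)
    (D : Measure (Finset (Fin n) → ℝ)) (hD : IsProbabilityMeasure D)
    (hDval : ∀ᵐ v ∂D, ∀ S : Finset (Fin n), 0 ≤ v S)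
    (selp : (Finset (Fin n) → ℝ) → Finset (Fin n))
    (hselp : ∀ᵐ v ∂D, ∀ T : Finset (Fin n), v T - p T ≤ v (selp v) - p (selp v))
    (hintp : Integrable (fun v => p (selp v)) D) :
    ∃ α : ℝ, α ∈ Set.Icc (1 / (2 * (n : ℝ))) 1 ∧
      ∀ selq : (Finset (Fin n) → ℝ) → Finset (Fin n),
        (∀ᵐ v ∂D, ∀ T : Finset (Fin n),
          v T - α * ∑ i ∈ T, p {i} ≤ v (selq v) - α * ∑ i ∈ selq v, p {i}) →
        Integrable (fun v => α * ∑ i ∈ selq v, p {i}) D →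
        (∫ v, p (selp v) ∂D) / (2 * Real.log (2 * n)) ≤
          ∫ v, α * ∑ i ∈ selq v, p {i} ∂D := by

  have hn' : (2 : ℝ) ≤ n := by exact_mod_cast hn
  set a : ℝ := 1 / (2 * (n : ℝ)) with ha
  have ha0 : 0 < a := by positivity
  have ha1 : a < 1 := by rw [ha, div_lt_one (by positivity)]; linarith
  have hlog : Real.log a = -Real.log (2 * n) := by rw [ha, one_div, Real.log_inv]
  have hL : 0 < Real.log (2 * n) := Real.log_pos (by linarith)
  set P : Finset (Fin n) → ℝ := fun S => ∑ i ∈ S, p {i}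
  have hP0 : ∀ S, 0 ≤ P S := fun S => Finset.sum_nonneg fun i _ => hp0 _
  set R := ∫ v, p (selp v) ∂D with hR
  let u : ℝ → (Finset (Fin n) → ℝ) → ℝ := fun α => buyerUtility fun S => α * P S
  have hu : ∀ α β, Integrable (fun v => u α v - u β v) D := fun α β =>
    integrable_buyerUtility_sub D _ _
  let F : ℝ → ℝ := fun α => ∫ v, (u α v - u 1 v) ∂D
  have hFsub : ∀ α β, F α - F β = ∫ v, (u α v - u β v) ∂D := by
    intro α β
    rw [← integral_sub (hu α 1) (hu β 1)]
    simp
  have hdrop : R / 2 ≤ F a - F 1 := by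
    rw [hFsub, hR, ← integral_div]
    refine integral_mono_ae (hintp.div_const 2) (hu a 1) ?_
    filter_upwards [hselp] with v hv
    have h1 : u 1 v ≤ v (selp v) - p (selp v) := buyerUtility_le fun S => by
      have : p S ≤ P S := le_sum_singleton hsub hempty S
      linarith [hv S]
    have h2 : v (selp v) - a * P (selp v) ≤ u a v :=
      le_buyerUtility (fun S => a * P S) v (selp v)
    have h3 : P (selp v) ≤ n * p (selp v) := by
      simpa using sum_singleton_le_card_mul hp0 hmono (selp v)
    have h4 : a * P (selp v) ≤ p (selp v) / 2 :=
      (mul_le_mul_of_nonneg_left h3 ha0.le).trans_eq (by rw [ha]; field_simp)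
    linarith
  by_contra! hcon
  choose! sel hsel hint hlt using hcon
  have hint' : ∀ α, a ≤ α → α ≤ 1 → Integrable (fun v => P (sel α v)) D := fun α h h1 =>
    (integrable_const_mul_iff (isUnit_iff_ne_zero.2 (ha0.trans_le h).ne') _).1 (hint α ⟨h, h1⟩)
  have hbound : F a - F 1 < -(R / (2 * Real.log (2 * n)) * Real.log a) := by
    refine sub_lt_neg_mul_log (g := fun α => ∫ v, P (sel α v) ∂D) ha0 ha1 ?_ ?_ ?_
    · intro α β hα hαβ hβ
      rw [hFsub, ← integral_const_mul]
      refine integral_mono_ae (hu α β) ((hint' α hα (hαβ.trans hβ)).const_mul _) ?_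
      filter_upwards [hsel α ⟨hα, hαβ.trans hβ⟩] with v hv
      have h1 : u α v ≤ v (sel α v) - α * P (sel α v) := buyerUtility_le hv
      have h2 : v (sel α v) - β * P (sel α v) ≤ u β v :=
        le_buyerUtility (fun S => β * P S) v (sel α v)
      linarith
    · intro α _ _
      exact integral_nonneg fun v => hP0 _
    · intro α hα h1
      rw [← integral_const_mul]
      exact hlt α ⟨hα, h1⟩
  have hmul : R / (2 * Real.log (2 * n)) * Real.log (2 * n) = R / 2 := by field_simp
  rw [hlog] at hbound
  linarith
end

section
/- Let c > 1 and let p and q be pricings of lotteries over n items satisfying q(λ)/c ≤ p(λ) ≤ q(λ) for every lottery λ. Let v be a valuation and suppose λ* is a buyer-optimal lottery for v under p. Then: (i) u(v, (1/(2c))·q) ≥ u(v, p) + (1/2)·p(λ*); and (ii) u(v, q) ≤ u(v, p); where u(v, r) = sup_λ (v(λ) − r(λ)). -/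
/-- The expected value of a lottery is at most the sum of all values of the valuation. -/
theorem lotVal_le_sum {n : ℕ} (v : Finset (Fin n) → ℝ) (hv0 : ∀ S, 0 ≤ v S)
    (lam : PMF (Finset (Fin n))) : lotVal v lam ≤ ∑ S, v S :=
  Finset.sum_le_sum fun S _ => mul_le_of_le_one_left (hv0 S)
    (ENNReal.toReal_le_of_le_ofReal zero_le_one (by simpa using lam.coe_le_one S))

/-- Under a nonnegative pricing the buyer's utilities are bounded above. -/
theorem bddAbove_range_lotVal_sub {n : ℕ} (v : Finset (Fin n) → ℝ) (hv0 : ∀ S, 0 ≤ v S)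
    (r : PMF (Finset (Fin n)) → ℝ) (hr0 : ∀ lam, 0 ≤ r lam) :
    BddAbove (Set.range fun lam => lotVal v lam - r lam) := by
  refine ⟨∑ S, v S, ?_⟩
  rintro _ ⟨lam, rfl⟩
  exact (sub_le_self _ (hr0 lam)).trans (lotVal_le_sum v hv0 lam)

/-- if `q` point-wise `c`-approximates `p` and `λ*` is buyer-optimal for `v`
under `p`, then (i) `u(v, (1/(2c))·q) ≥ u(v, p) + p(λ*)/2`, and (ii) `u(v, q) ≤ u(v, p)`. -/
theorem utility_bounds (n : ℕ) (c : ℝ) (hc : 1 < c)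
    (p q : PMF (Finset (Fin n)) → ℝ)
    (hp0 : ∀ lam, 0 ≤ p lam) (hq0 : ∀ lam, 0 ≤ q lam)
    (happrox : ∀ lam, q lam / c ≤ p lam ∧ p lam ≤ q lam)
    (v : Finset (Fin n) → ℝ) (hv0 : ∀ S, 0 ≤ v S)
    (lamStar : PMF (Finset (Fin n)))
    (hopt : ∀ lam, lotVal v lam - p lam ≤ lotVal v lamStar - p lamStar) :
    util v p + (1 / 2) * p lamStar ≤ util v (fun lam => (1 / (2 * c)) * q lam) ∧
    util v q ≤ util v p := by
  have hc0 : 0 < c := one_pos.trans hc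
  have : Nonempty (PMF (Finset (Fin n))) := ⟨lamStar⟩
  constructor
  · have hup : util v p ≤ lotVal v lamStar - p lamStar := ciSup_le hopt
    have hlow : lotVal v lamStar - 1 / (2 * c) * q lamStar ≤
        util v (fun lam => (1 / (2 * c)) * q lam) :=
      le_ciSup (bddAbove_range_lotVal_sub v hv0 (fun lam => (1 / (2 * c)) * q lam)
        fun lam => mul_nonneg (by positivity) (hq0 lam)) lamStar
    have hhalf : 1 / (2 * c) * q lamStar = 1 / 2 * (q lamStar / c) := by
      field_simp
    linarith [(happrox lamStar).1]
  · exact ciSup_mono (bddAbove_range_lotVal_sub v hv0 p hp0)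
      fun lam => sub_le_sub_left (happrox lam).2 _
end

section
/- Let p be a Sybil-proof pricing of lotteries over n items and let v be a monotone valuation. Then for every finite multiset Λ = {λ_1,...,λ_k} of lotteries there is a single lottery λ with v(λ) − p(λ) ≥ E[v(S_1 ∪ ... ∪ S_k)] − Σ_{i=1}^k p(λ_i), where S_i ∼ λ_i are independent draws. Consequently, the supremum of the buyer's utility over multisets of purchases equals the supremum over single-lottery purchases, so it is optimal for the buyer to purchase a single lottery. -/
/-- The expectation of `v` under the image of a distribution on a finite type is the
expectation of the composition. -/
theorem lotVal_map {n : ℕ} {α : Type*} [Fintype α] (v : Finset (Fin n) → ℝ)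
    (μ : PMF α) (f : α → Finset (Fin n)) :
    lotVal v (μ.map f) = ∑ x, (μ x).toReal * v (f x) := by
  classical
  have h (S : Finset (Fin n)) :
      ((μ.map f) S).toReal = ∑ x, if S = f x then (μ x).toReal else 0 := by
    rw [PMF.map_apply, tsum_fintype, ENNReal.toReal_sum]
    · refine Finset.sum_congr rfl fun x _ => ?_
      split_ifs <;> simp
    · intro x _
      split_ifs
      · exact μ.apply_ne_top x
      · simp
  simp only [lotVal, h, Finset.sum_mul]
  rw [Finset.sum_comm]
  simp

theorem lotVal_le_of_dominates {n : ℕ} {v : Finset (Fin n) → ℝ}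
    (hmono : ∀ S T : Finset (Fin n), S ⊆ T → v S ≤ v T)
    {lam lam' : PMF (Finset (Fin n))} (h : Dominates lam lam') :
    lotVal v lam' ≤ lotVal v lam := by
  obtain ⟨μ, rfl, rfl, hsub⟩ := h
  rw [lotVal_map, lotVal_map]
  refine Finset.sum_le_sum fun x _ => ?_
  by_cases hx : x ∈ μ.support
  · exact mul_le_mul_of_nonneg_left (hmono _ _ (hsub x hx)) ENNReal.toReal_nonneg
  · simp [(μ.apply_eq_zero_iff x).2 hx]

theorem lotVal_le_univ {n : ℕ} {v : Finset (Fin n) → ℝ}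
    (hmono : ∀ S T : Finset (Fin n), S ⊆ T → v S ≤ v T) (lam : PMF (Finset (Fin n))) :
    lotVal v lam ≤ v Finset.univ := by
  have hsum : ∑ S, (lam S).toReal = 1 := by
    have h := lam.tsum_coe
    rw [tsum_fintype] at h
    rw [← ENNReal.toReal_sum fun S _ => lam.apply_ne_top S, h, ENNReal.toReal_one]
  calc lotVal v lam ≤ ∑ S, (lam S).toReal * v Finset.univ :=
        Finset.sum_le_sum fun S _ =>
          mul_le_mul_of_nonneg_left (hmono _ _ S.subset_univ) ENNReal.toReal_nonneg
    _ = v Finset.univ := by rw [← Finset.sum_mul, hsum, one_mul]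

theorem unionPMF_singleton {n : ℕ} (lam : PMF (Finset (Fin n))) : unionPMF [lam] = lam := by
  simp only [unionPMF, PMF.pure_bind, Finset.union_empty]
  exact PMF.map_id lam

/-- under a Sybil-proof pricing, for every finite multiset of lotteries there
is a single lottery giving a monotone buyer at least as much utility at no greater price;
consequently the supremum utility over multisets of purchases equals the supremum over
single-lottery purchases, so buying a single lottery is optimal. -/
theorem single_purchase_optimal (n : ℕ) (p : PMF (Finset (Fin n)) → ℝ)
    (hp0 : ∀ lam, 0 ≤ p lam) (hsp : SybilProof p)
    (v : Finset (Fin n) → ℝ) (hv0 : ∀ S, 0 ≤ v S)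
    (hmono : ∀ S T : Finset (Fin n), S ⊆ T → v S ≤ v T) :
    (∀ L : List (PMF (Finset (Fin n))),
      ∃ lam, lotVal v (unionPMF L) - (L.map p).sum ≤ lotVal v lam - p lam) ∧
    (⨆ L : List (PMF (Finset (Fin n))), (lotVal v (unionPMF L) - (L.map p).sum)) =
      ⨆ lam : PMF (Finset (Fin n)), (lotVal v lam - p lam) := by
  have hsingle (L : List (PMF (Finset (Fin n)))) :
      ∃ lam, lotVal v (unionPMF L) - (L.map p).sum ≤ lotVal v lam - p lam := by
    obtain ⟨lam, hdom, hprice⟩ := hsp L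
    exact ⟨lam, sub_le_sub (lotVal_le_of_dominates hmono hdom) hprice⟩
  have hbound (lam : PMF (Finset (Fin n))) : lotVal v lam - p lam ≤ v Finset.univ :=
    (sub_le_self _ (hp0 lam)).trans (lotVal_le_univ hmono lam)
  have hbdd : BddAbove (Set.range fun lam => lotVal v lam - p lam) :=
    ⟨v Finset.univ, Set.forall_mem_range.2 hbound⟩
  have hbddList : BddAbove (Set.range fun L : List (PMF (Finset (Fin n))) =>
      lotVal v (unionPMF L) - (L.map p).sum) := by
    refine ⟨v Finset.univ, Set.forall_mem_range.2 fun L => ?_⟩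
    obtain ⟨lam, h⟩ := hsingle L
    exact h.trans (hbound lam)
  have : Nonempty (PMF (Finset (Fin n))) := ⟨PMF.pure ∅⟩
  refine ⟨hsingle, le_antisymm (ciSup_le fun L => ?_) (ciSup_le fun lam => ?_)⟩
  · obtain ⟨lam, h⟩ := hsingle L
    exact h.trans (le_ciSup hbdd lam)
  · have h := le_ciSup hbddList [lam]
    simpa only [unionPMF_singleton, List.map_cons, List.map_nil, List.sum_singleton] using h
end

section
/- For all sufficiently large n the following holds. Let N = ⌊2^{n^{1/6}/8}⌋. There exists a collection of subsets S_1, S_2, ..., S_N of [n] such that: (a) |S_i| = ⌊n^{1/3}⌋ for every i; (b) |S_i ∩ S_j| ≤ n^{1/6} for all i ≠ j; and (c) for every vector of integers (b_1,...,b_N) with ⌈n^{1/6}⌉ ≤ b_i ≤ ⌊n^{1/3}⌋ for all i, there exists a matroid M on ground set [n] whose rank function r satisfies r(S_i) = b_i for all i ∈ [N]. -/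
open Finset

/-- Resampling one coordinate of a function does not change averages. -/
lemma sum_sum_update {ι β : Type*} [Fintype ι] [DecidableEq ι] [Fintype β]
    (φ : (ι → β) → ℝ) (i : ι) :
    ∑ f, ∑ a, φ (Function.update f i a) = Fintype.card β * ∑ f, φ f := by
  classical
  let σ : (ι → β) × β → (ι → β) × β := fun p => (Function.update p.1 i p.2, p.1 i)
  have hσ : Function.Involutive σ := fun p => by simp [σ]
  calc ∑ f, ∑ a, φ (Function.update f i a)
      = ∑ p : (ι → β) × β, φ (σ p).1 := (Fintype.sum_prod_type' _).symm
    _ = ∑ p : (ι → β) × β, φ p.1 := Equiv.sum_comp (Function.Involutive.toPerm σ hσ) fun p => φ p.1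
    _ = Fintype.card β * ∑ f, φ f := by
      rw [Fintype.sum_prod_type]
      simp [mul_sum]

/-- Exponential moment of the number of collisions of a random function on a small set. -/
lemma sum_four_pow_collisions_le {ι β : Type*} [Fintype ι] [DecidableEq ι] [Fintype β]
    [DecidableEq β] [Nonempty β] {T : ℕ} (J : Finset ι) (hJ : #J ≤ T) :
    ∑ f : ι → β, (4 : ℝ) ^ (#J - #(J.image f)) ≤
      (Fintype.card β : ℝ) ^ Fintype.card ι * (1 + 4 * T / Fintype.card β) ^ #J := by
  have hq : (0 : ℝ) < Fintype.card β := by exact_mod_cast Fintype.card_pos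
  induction J using Finset.induction_on with
  | empty => simp
  | insert i J hi ih =>
    rw [card_insert_of_notMem hi] at hJ ⊢
    specialize ih (by omega)
    refine le_of_mul_le_mul_left ?_ hq
    rw [← sum_sum_update _ i]
    have hstep (f : ι → β) :
        ∑ a, (4 : ℝ) ^ (#J + 1 - #((insert i J).image (Function.update f i a))) ≤
          (4 : ℝ) ^ (#J - #(J.image f)) * (Fintype.card β + 4 * T) := by
      have himg (a : β) : (insert i J).image (Function.update f i a) = insert a (J.image f) := by
        rw [image_insert, Function.update_self]
        congr 1
        exact image_congr fun j hj => Function.update_of_ne (ne_of_mem_of_not_mem hj hi) _ _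
      have hle : #(J.image f) ≤ #J := card_image_le
      have hterm (a : β) : (4 : ℝ) ^ (#J + 1 - #((insert i J).image (Function.update f i a))) ≤
          (4 : ℝ) ^ (#J - #(J.image f)) * (1 + if a ∈ J.image f then 4 else 0) := by
        rw [himg]
        split_ifs with ha
        · rw [insert_eq_self.2 ha, Nat.sub_add_comm hle, pow_succ]
          gcongr
          norm_num
        · rw [card_insert_of_notMem ha, Nat.add_sub_add_right]
          simp
      refine (sum_le_sum fun a _ => hterm a).trans ?_
      rw [← mul_sum, sum_add_distrib]
      gcongr
      · simp
      · rw [sum_ite_mem, univ_inter, sum_const, nsmul_eq_mul, mul_comm]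
        gcongr
        omega
    refine (sum_le_sum fun f _ => hstep f).trans ?_
    rw [← sum_mul]
    refine (mul_le_mul_of_nonneg_right ih (by positivity)).trans_eq ?_
    rw [pow_succ]
    field_simp

/-- Random functions have few collisions on every small index set. -/
lemma exists_few_collisions {N d q k T : ℕ} (hq : 0 < q) (hT : 4 * T * d ≤ q)
    (hN : 12 * N ≤ 2 ^ (k / 2)) :
    ∃ F : Fin d → Fin N → Fin q, ∀ J : Finset (Fin N), J.Nonempty → #J ≤ T →
      2 * (#J * d) ≤ 2 * ∑ x, #(J.image (F x)) + (#J - 1) * k := by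
  classical
  have : Nonempty (Fin q) := ⟨⟨0, hq⟩⟩
  have hq' : (0 : ℝ) < q := by exact_mod_cast hq
  let 𝒥 : Finset (Finset (Fin N)) := univ.filter fun J => 2 ≤ #J ∧ #J ≤ T
  let loss : (Fin d → Fin N → Fin q) → Finset (Fin N) → ℕ :=
    fun F J => ∑ x, (#J - #(J.image (F x)))
  set y : ℝ := 3 / 2 ^ (k / 2) with hy
  have hy0 : 0 < y := by positivity
  have hbase : (1 + 4 * (T : ℝ) / q) ^ d ≤ 3 := by
    calc (1 + 4 * (T : ℝ) / q) ^ d ≤ Real.exp (4 * T / q) ^ d := by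
          gcongr
          linarith [Real.add_one_le_exp (4 * (T : ℝ) / q)]
      _ = Real.exp (d * (4 * T / q)) := (Real.exp_nat_mul _ _).symm
      _ ≤ Real.exp 1 := by
          gcongr
          have : (4 * T * d : ℝ) ≤ q := by exact_mod_cast hT
          rw [← mul_div_assoc, div_le_one hq']
          linarith
      _ ≤ 3 := by linarith [Real.exp_one_lt_d9]
  have hmoment : ∀ J ∈ 𝒥, ∑ F, (4 : ℝ) ^ loss F J / 2 ^ ((#J - 1) * k) ≤
      (q : ℝ) ^ (N * d) * y ^ #J := by
    intro J hJ
    obtain ⟨h2, hJT⟩ := (mem_filter.1 hJ).2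
    have hpow : ((2 : ℝ) ^ (k / 2)) ^ #J ≤ 2 ^ ((#J - 1) * k) := by
      rw [← pow_mul]
      refine pow_le_pow_right₀ (by norm_num) ?_
      obtain ⟨t, ht⟩ : ∃ t, #J = t + 2 := ⟨#J - 2, by omega⟩
      have hk : 2 * (k / 2) ≤ k := Nat.mul_div_le k 2
      rw [ht]
      simp only [Nat.add_succ_sub_one]
      nlinarith
    have hsum : ∑ F, (4 : ℝ) ^ loss F J ≤ (q : ℝ) ^ (N * d) * 3 ^ #J := by
      calc ∑ F, (4 : ℝ) ^ loss F J
          = (∑ f : Fin N → Fin q, (4 : ℝ) ^ (#J - #(J.image f))) ^ d := by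
            rw [Fintype.sum_pow]
            simp only [loss, prod_pow_eq_pow_sum]
        _ ≤ ((q : ℝ) ^ N * (1 + 4 * T / q) ^ #J) ^ d := by
            gcongr
            simpa using sum_four_pow_collisions_le (β := Fin q) J hJT
        _ = (q : ℝ) ^ (N * d) * ((1 + 4 * T / q) ^ d) ^ #J := by
            rw [mul_pow, ← pow_mul, ← pow_mul, ← pow_mul, mul_comm d]
        _ ≤ _ := by gcongr
    rw [← sum_div, hy, div_pow, ← mul_div_assoc]
    gcongr
  have htotal : ∑ J ∈ 𝒥, y ^ #J < 1 := by
    have hsub : 𝒥 ⊆ univ.erase ∅ := by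
      intro J hJ
      have := (mem_filter.1 hJ).2.1
      refine mem_erase.2 ⟨?_, mem_univ _⟩
      rintro rfl
      simp at this
    have h1 : ∑ J ∈ 𝒥, y ^ #J ≤ ∑ J ∈ univ.erase (∅ : Finset (Fin N)), y ^ #J :=
      sum_le_sum_of_subset_of_nonneg hsub fun _ _ _ => by positivity
    have h2 : ∑ J : Finset (Fin N), y ^ #J = (y + 1) ^ N := by
      simpa using Fintype.sum_pow_mul_eq_add_pow (Fin N) y 1
    have h3 := add_sum_erase univ (fun J : Finset (Fin N) => y ^ #J) (mem_univ ∅)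
    simp only [card_empty, pow_zero] at h3
    have h4 : (y + 1) ^ N < 2 := by
      calc (y + 1) ^ N ≤ Real.exp y ^ N := by gcongr; exact Real.add_one_le_exp y
        _ = Real.exp (N * y) := (Real.exp_nat_mul _ _).symm
        _ < 2 := by
          rw [← Real.lt_log_iff_exp_lt (by norm_num)]
          have : (12 * N : ℝ) ≤ 2 ^ (k / 2) := by exact_mod_cast hN
          have : N * y ≤ 1 / 4 := by
            rw [hy, ← mul_div_assoc, div_le_iff₀ (by positivity)]
            linarith
          linarith [Real.log_two_gt_d9]
    linarith
  obtain ⟨F, -, hF⟩ : ∃ F ∈ (univ : Finset (Fin d → Fin N → Fin q)),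
      ∑ J ∈ 𝒥, (4 : ℝ) ^ loss F J / 2 ^ ((#J - 1) * k) < 1 := by
    refine exists_lt_of_sum_lt ?_
    rw [sum_comm]
    calc _ ≤ ∑ J ∈ 𝒥, (q : ℝ) ^ (N * d) * y ^ #J := sum_le_sum hmoment
      _ = (q : ℝ) ^ (N * d) * ∑ J ∈ 𝒥, y ^ #J := by rw [mul_sum]
      _ < (q : ℝ) ^ (N * d) * 1 := by gcongr
      _ = _ := by simp [pow_mul]
  refine ⟨F, fun J hne hJT => ?_⟩
  have hlossadd : loss F J + ∑ x, #(J.image (F x)) = #J * d := by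
    rw [← sum_add_distrib]
    simp [Nat.sub_add_cancel (card_image_le (s := J)), mul_comm]
  suffices 2 * loss F J ≤ (#J - 1) * k by omega
  rcases Nat.lt_or_ge #J 2 with hJ1 | hJ2
  · obtain ⟨a, rfl⟩ := card_eq_one.1 (show #J = 1 by have := hne.card_pos; omega)
    simp [loss]
  · have hlt := (single_le_sum (f := fun J => (4 : ℝ) ^ loss F J / 2 ^ ((#J - 1) * k))
      (fun _ _ => by positivity) (mem_filter.2 ⟨mem_univ J, hJ2, hJT⟩)).trans_lt hF
    rw [div_lt_one (by positivity), show (4 : ℝ) = 2 ^ 2 by norm_num, ← pow_mul] at hlt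
    exact ((pow_lt_pow_iff_right₀ (by norm_num)).1 hlt).le

/-- Nearly disjoint families of `d`-subsets of `Fin n`. -/
lemma exists_nearly_disjoint_family {n N d q k T : ℕ} (hq : 0 < q) (hdq : d * q ≤ n)
    (hT : 4 * T * d ≤ q) (hN : 12 * N ≤ 2 ^ (k / 2)) :
    ∃ S : Fin N → Finset (Fin n), (∀ i, #(S i) = d) ∧
      ∀ J : Finset (Fin N), J.Nonempty → #J ≤ T →
        2 * (#J * d) ≤ 2 * #(J.biUnion S) + (#J - 1) * k := by
  classical
  obtain ⟨F, hF⟩ := exists_few_collisions hq hT hN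
  obtain ⟨e⟩ : Nonempty ((_ : Fin d) × Fin q ↪ Fin n) :=
    Function.Embedding.nonempty_of_card_le (by simpa using hdq)
  refine ⟨fun i => (univ.sigma fun x => {F x i}).map e, fun i => by simp, fun J hne hJT => ?_⟩
  have hU : (J.biUnion fun i => (univ.sigma fun x => {F x i}).map e) =
      (univ.sigma fun x => J.image (F x)).map e := by
    ext z
    simp only [mem_biUnion, mem_map, mem_sigma, mem_univ, mem_singleton, mem_image, true_and]
    constructor
    · rintro ⟨i, hi, p, hp, rfl⟩
      exact ⟨p, ⟨i, hi, hp.symm⟩, rfl⟩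
    · rintro ⟨p, ⟨i, hi, hp⟩, rfl⟩
      exact ⟨i, hi, p, hp.symm, rfl⟩
  rw [hU, card_map, card_sigma]
  exact hF J hne hJT

/-- The parameters of the construction, for `n = m ^ 6`. -/
lemma parameter_bounds {n : ℕ} {m : ℝ} (hm : 100 ≤ m) (hn : m ^ 6 = n) :
    0 < n / ⌊m ^ 2⌋₊ ∧ 4 * (4 * ⌊m⌋₊ + 10) * ⌊m ^ 2⌋₊ ≤ n / ⌊m ^ 2⌋₊ ∧
    12 * ⌊(2 : ℝ) ^ (m / 8)⌋₊ ≤ 2 ^ (⌊m⌋₊ / 2) ∧ ⌊m ^ 2⌋₊ ≤ ⌊m⌋₊ ^ 2 + 2 * ⌊m⌋₊ := by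
  have hk : (⌊m⌋₊ : ℝ) ≤ m := Nat.floor_le (by linarith)
  have hk' : m < ⌊m⌋₊ + 1 := Nat.lt_floor_add_one m
  have hk100 : 100 ≤ ⌊m⌋₊ := Nat.le_floor (by exact_mod_cast hm)
  have hd : (⌊m ^ 2⌋₊ : ℝ) ≤ m ^ 2 := Nat.floor_le (by positivity)
  have hd0 : 0 < ⌊m ^ 2⌋₊ := Nat.floor_pos.2 (by nlinarith)
  have hmain : 4 * (4 * ⌊m⌋₊ + 10) * ⌊m ^ 2⌋₊ ≤ n / ⌊m ^ 2⌋₊ := by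
    rw [Nat.le_div_iff_mul_le hd0]
    have : ((4 * (4 * ⌊m⌋₊ + 10) * ⌊m ^ 2⌋₊ * ⌊m ^ 2⌋₊ : ℕ) : ℝ) ≤ n := by
      push_cast
      calc _ ≤ 4 * (4 * m + 10) * m ^ 2 * m ^ 2 := by gcongr
        _ ≤ m ^ 2 * m ^ 2 * m ^ 2 := by gcongr; nlinarith
        _ = n := by rw [← hn]; ring
    exact_mod_cast this
  refine ⟨lt_of_lt_of_le (by positivity) hmain, hmain, ?_, ?_⟩
  · have h1 : (2 : ℝ) ^ (m / 8) ≤ 2 ^ (⌊m⌋₊ / 2 - 4) := by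
      rw [← Real.rpow_natCast]
      refine Real.rpow_le_rpow_of_exponent_le (by norm_num) ?_
      have : ⌊m⌋₊ + 1 ≤ 8 * (⌊m⌋₊ / 2 - 4) := by omega
      have : ((⌊m⌋₊ + 1 : ℕ) : ℝ) ≤ (8 * (⌊m⌋₊ / 2 - 4) : ℕ) := by exact_mod_cast this
      push_cast at this
      linarith
    have h2 : ⌊(2 : ℝ) ^ (m / 8)⌋₊ ≤ 2 ^ (⌊m⌋₊ / 2 - 4) :=
      Nat.floor_le_of_le (by exact_mod_cast h1)
    have h3 : 2 ^ (⌊m⌋₊ / 2) = 2 ^ (⌊m⌋₊ / 2 - 4) * 2 ^ 4 := by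
      rw [← pow_add]; congr 1; omega
    omega
  · refine Nat.lt_succ_iff.1 ((Nat.floor_lt (by positivity)).2 ?_)
    push_cast
    nlinarith

/-- Uncrossing: locally tight index sets for `I` are closed under union when `I` is small. -/
lemma tight_union {α ι : Type*} [DecidableEq α] [DecidableEq ι]
    {S : ι → Finset α} {c : ι → ℕ} {τ μ : ℕ} {I : Finset α}
    (hlarge : ∀ J : Finset ι, τ ≤ #J → #J + 2 ≤ 2 * τ → ∑ j ∈ J, c j + μ ≤ #(J.biUnion S))
    (hI : ∀ J : Finset ι, #J < τ → ∑ j ∈ J, c j ≤ #(J.biUnion S \ I)) (hcard : #I < μ)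
    {J K : Finset ι} (hJ : #J < τ) (hK : #K < τ)
    (hJt : #(J.biUnion S \ I) ≤ ∑ j ∈ J, c j) (hKt : #(K.biUnion S \ I) ≤ ∑ j ∈ K, c j) :
    #(J ∪ K) < τ ∧ #((J ∪ K).biUnion S \ I) ≤ ∑ j ∈ J ∪ K, c j := by
  have hinter : #(J ∩ K) < τ := (card_le_card inter_subset_left).trans_lt hJ
  have hsum := sum_union_inter (s₁ := J) (s₂ := K) (f := c)
  have hsub := card_union_add_card_inter (J.biUnion S \ I) (K.biUnion S \ I)
  have hu : J.biUnion S \ I ∪ K.biUnion S \ I = (J ∪ K).biUnion S \ I := by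
    rw [union_biUnion, union_sdiff_distrib]
  have hi : (J ∩ K).biUnion S \ I ⊆ (J.biUnion S \ I) ∩ (K.biUnion S \ I) :=
    subset_inter
      (sdiff_subset_sdiff (biUnion_subset_biUnion_of_subset_left S inter_subset_left) subset_rfl)
      (sdiff_subset_sdiff (biUnion_subset_biUnion_of_subset_left S inter_subset_right) subset_rfl)
  have hi' := card_le_card hi
  have hik := hI _ hinter
  rw [hu] at hsub
  have htight : #((J ∪ K).biUnion S \ I) ≤ ∑ j ∈ J ∪ K, c j := by omega
  refine ⟨?_, htight⟩
  by_contra! hge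
  have hl := hlarge _ hge (by have := card_union_le J K; omega)
  have := le_card_sdiff I ((J ∪ K).biUnion S)
  omega

/-- The augmentation property of the sets that leave `c j` elements of each `S j` uncovered,
in the sense of a Hall condition restricted to small index sets. -/
lemma local_hall_augment {α ι : Type*} [DecidableEq α] [Fintype ι] [DecidableEq ι]
    {S : ι → Finset α} {c : ι → ℕ} {τ μ : ℕ} (hτ : 0 < τ) {I I' : Finset α}
    (hlarge : ∀ J : Finset ι, τ ≤ #J → #J + 2 ≤ 2 * τ → ∑ j ∈ J, c j + μ ≤ #(J.biUnion S))
    (hI : ∀ J : Finset ι, #J < τ → ∑ j ∈ J, c j ≤ #(J.biUnion S \ I))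
    (hI' : ∀ J : Finset ι, #J < τ → ∑ j ∈ J, c j ≤ #(J.biUnion S \ I'))
    (hcard' : #I' ≤ μ) (hlt : #I < #I') :
    ∃ e ∈ I', e ∉ I ∧ #(insert e I) ≤ μ ∧
      ∀ J : Finset ι, #J < τ → ∑ j ∈ J, c j ≤ #(J.biUnion S \ insert e I) := by
  by_contra! hno
  obtain ⟨K, hKmem, hKmax⟩ := exists_max_image
    (univ.filter fun J : Finset ι => #J < τ ∧ #(J.biUnion S \ I) ≤ ∑ j ∈ J, c j) card
    ⟨∅, by simp [hτ]⟩
  obtain ⟨hK, hKt⟩ := (mem_filter.1 hKmem).2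
  have hcover : I' \ I ⊆ K.biUnion S := by
    intro e he
    obtain ⟨heI', heI⟩ := mem_sdiff.1 he
    obtain ⟨J, hJ, hJv⟩ := hno e heI' heI (by rw [card_insert_of_notMem heI]; omega)
    have hJI := hI J hJ
    have heJ : e ∈ J.biUnion S := by
      by_contra hn
      rw [sdiff_insert_of_notMem hn] at hJv
      omega
    have hJt : #(J.biUnion S \ I) ≤ ∑ j ∈ J, c j := by
      rw [sdiff_insert] at hJv
      have := pred_card_le_card_erase (a := e) (s := J.biUnion S \ I)
      omega
    obtain ⟨hU, hUt⟩ := tight_union hlarge hI (hlt.trans_le hcard') hJ hK hJt hKt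
    have hle := hKmax (J ∪ K) (by simp only [mem_filter, mem_univ, true_and]; exact ⟨hU, hUt⟩)
    have heq := eq_of_subset_of_card_le (subset_union_right (s₁ := J) (s₂ := K)) hle
    have hJK : J ⊆ K := by rw [heq]; exact subset_union_left
    exact biUnion_subset_biUnion_of_subset_left S hJK heJ
  have h1 := hI' K hK
  have h2 : #(I' \ K.biUnion S) ≤ #(I \ K.biUnion S) := by
    refine card_le_card fun x hx => ?_
    rw [mem_sdiff] at hx ⊢
    refine ⟨?_, hx.2⟩
    by_contra hxI
    exact hx.2 (hcover (mem_sdiff.2 ⟨hx.1, hxI⟩))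
  have h3 := card_sdiff_add_card_inter I (K.biUnion S)
  have h4 := card_sdiff_add_card_inter I' (K.biUnion S)
  have h5 := card_sdiff_add_card_inter (K.biUnion S) I
  have h6 := card_sdiff_add_card_inter (K.biUnion S) I'
  rw [inter_comm] at h5 h6
  omega

/-- A family of `d`-sets, small subfamilies of which are nearly disjoint, admits a matroid with
prescribed ranks between `k` and `d`. -/
lemma exists_matroid_of_nearly_disjoint {α ι : Type*} [Fintype α] [DecidableEq α] [Fintype ι]
    [DecidableEq ι] {S : ι → Finset α} {d k : ℕ} (hdk : d ≤ k ^ 2 + 2 * k)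
    (hS : ∀ i, #(S i) = d)
    (hexp : ∀ J : Finset ι, J.Nonempty → #J ≤ 4 * k + 10 →
      2 * (#J * d) ≤ 2 * #(J.biUnion S) + (#J - 1) * k)
    {b : ι → ℕ} (hb : ∀ i, k ≤ b i ∧ b i ≤ d) :
    ∃ M : Matroid α, M.E = Set.univ ∧
      ∀ i, (∃ B : Finset α, B ⊆ S i ∧ M.Indep ↑B ∧ #B = b i) ∧
        ∀ A : Finset α, A ⊆ S i → M.Indep ↑A → #A ≤ b i := by
  set c : ι → ℕ := fun i => d - b i with hc
  set τ := 2 * k + 6 with hτ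
  have hsum (J : Finset ι) : ∑ j ∈ J, c j + #J * k ≤ #J * d := by
    have : ∑ j ∈ J, (c j + k) ≤ ∑ j ∈ J, d :=
      sum_le_sum fun j _ => by have := hb j; simp only [hc]; omega
    simpa [sum_add_distrib] using this
  have hlarge : ∀ J : Finset ι, τ ≤ #J → #J + 2 ≤ 2 * τ →
      ∑ j ∈ J, c j + d ≤ #(J.biUnion S) := by
    intro J h1 h2
    have h3 := hexp J (card_pos.1 (by omega)) (by omega)
    have h4 := hsum J
    obtain ⟨t, ht⟩ : ∃ t, #J = t + 1 := ⟨#J - 1, by omega⟩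
    rw [ht] at h3 h4
    simp only [Nat.add_sub_cancel] at h3
    have h5 : (2 * k + 5) * k ≤ t * k := Nat.mul_le_mul_right k (by omega)
    nlinarith
  let P : Finset α → Prop := fun I =>
    #I ≤ d ∧ ∀ J : Finset ι, #J < τ → ∑ j ∈ J, c j ≤ #(J.biUnion S \ I)
  have hbase : ∀ i (B : Finset α), B ⊆ S i → #B = b i → P B := by
    intro i B hBS hB
    refine ⟨hB.le.trans (hb i).2, fun J hJ => ?_⟩
    by_cases hi : i ∈ J
    · have h1 := hexp J ⟨i, hi⟩ (by omega)
      have h2 := hsum (J.erase i)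
      rw [card_erase_of_mem hi] at h2
      have h3 := add_sum_erase J c hi
      have h4 : #(J.biUnion S) - #B ≤ #(J.biUnion S \ B) := le_card_sdiff _ _
      obtain ⟨t, ht⟩ : ∃ t, #J = t + 1 := ⟨#J - 1, by have := card_pos.2 ⟨i, hi⟩; omega⟩
      rw [ht] at h1 h2
      simp only [Nat.add_sub_cancel, add_mul, one_mul] at h1 h2
      have h5 := hb i
      have h6 : c i = d - b i := rfl
      omega
    · have h1 := hexp (insert i J) ⟨i, mem_insert_self i J⟩
        (by rw [card_insert_of_notMem hi]; omega)
      rw [card_insert_of_notMem hi, biUnion_insert, Nat.add_sub_cancel] at h1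
      have h2 := hsum J
      have h3 : #(J.biUnion S \ S i) ≤ #(J.biUnion S \ B) :=
        card_le_card (sdiff_subset_sdiff subset_rfl hBS)
      have h4 := card_sdiff_add_card (J.biUnion S) (S i)
      rw [union_comm, hS] at h4
      simp only [add_mul, one_mul] at h1
      omega
  let M : IndepMatroid α := IndepMatroid.ofFinset Set.univ P
    ⟨by simp, fun J hJ => by
      rw [sdiff_empty]
      rcases J.eq_empty_or_nonempty with rfl | hne
      · simp
      have h1 := hexp J hne (by omega)
      have h2 := hsum J
      have h3 : (#J - 1) * k ≤ #J * k := Nat.mul_le_mul_right k (by omega)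
      omega⟩
    (fun I J hJ hIJ => ⟨(card_le_card hIJ).trans hJ.1, fun K hK =>
      (hJ.2 K hK).trans (card_le_card (sdiff_subset_sdiff subset_rfl hIJ))⟩)
    (fun I J hI hJ hlt => local_hall_augment (by omega) hlarge hI.2 hJ.2 hJ.1 hlt)
    (fun _ _ => Set.subset_univ _)
  refine ⟨M.matroid, rfl, fun i => ⟨?_, ?_⟩⟩
  · obtain ⟨B, hBS, hB⟩ := exists_subset_card_eq ((hb i).2.trans (hS i).ge)
    exact ⟨B, hBS, by simpa [M] using hbase i B hBS hB, hB⟩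
  · intro A hA hind
    have hPA : P A := by simpa [M] using hind
    have h1 := hPA.2 {i} (by simp [hτ])
    rw [sum_singleton, singleton_biUnion, card_sdiff_of_subset hA, hS] at h1
    have h2 := card_le_card hA
    rw [hS] at h2
    have h3 := hb i
    have h4 : c i = d - b i := rfl
    omega
/-- for all sufficiently large `n`, with `N = ⌊2^{n^{1/6}/8}⌋`, there are sets
`S_1, …, S_N ⊆ [n]` of size `⌊n^{1/3}⌋` with pairwise intersections of size at most
`n^{1/6}`, such that for every integer vector `b` with `⌈n^{1/6}⌉ ≤ b_i ≤ ⌊n^{1/3}⌋` there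
is a matroid on `[n]` whose rank function satisfies `r(S_i) = b_i` for all `i`. -/
theorem matroid_construction :
    ∃ n₀ : ℕ, ∀ n : ℕ, n₀ ≤ n →
      ∃ S : Fin (⌊(2 : ℝ) ^ ((n : ℝ) ^ ((1 : ℝ) / 6) / 8)⌋₊) → Finset (Fin n),
        (∀ i, (S i).card = ⌊(n : ℝ) ^ ((1 : ℝ) / 3)⌋₊) ∧
        (∀ i j, i ≠ j → ((S i ∩ S j).card : ℝ) ≤ (n : ℝ) ^ ((1 : ℝ) / 6)) ∧
        (∀ b : Fin (⌊(2 : ℝ) ^ ((n : ℝ) ^ ((1 : ℝ) / 6) / 8)⌋₊) → ℕ,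
          (∀ i, ⌈(n : ℝ) ^ ((1 : ℝ) / 6)⌉₊ ≤ b i ∧ b i ≤ ⌊(n : ℝ) ^ ((1 : ℝ) / 3)⌋₊) →
          ∃ M : Matroid (Fin n), M.E = Set.univ ∧
            ∀ i, (∃ B : Finset (Fin n), B ⊆ S i ∧ M.Indep ↑B ∧ B.card = b i) ∧
                 (∀ A : Finset (Fin n), A ⊆ S i → M.Indep ↑A → A.card ≤ b i)) := by
  refine ⟨100 ^ 6, fun n hn => ?_⟩
  set m : ℝ := (n : ℝ) ^ ((1 : ℝ) / 6) with hm_def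
  have hm6 : m ^ 6 = n := by
    rw [hm_def, ← Real.rpow_mul_natCast (Nat.cast_nonneg n)]
    norm_num
  have hm2 : (n : ℝ) ^ ((1 : ℝ) / 3) = m ^ 2 := by
    rw [hm_def, ← Real.rpow_mul_natCast (Nat.cast_nonneg n)]
    norm_num
  have hm0 : 0 ≤ m := by positivity
  have hm : 100 ≤ m := by
    refine le_of_pow_le_pow_left₀ (n := 6) (by norm_num) hm0 ?_
    rw [hm6]
    exact_mod_cast hn
  rw [hm2]
  obtain ⟨hq, hT, hN, hdk⟩ := parameter_bounds hm hm6
  obtain ⟨S, hS, hexp⟩ := exists_nearly_disjoint_family hq (Nat.mul_div_le n _) hT hN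
  refine ⟨S, hS, fun i j hij => ?_, fun b hb => ?_⟩
  · have h1 := hexp {i, j} (insert_nonempty _ _) (by rw [card_pair hij]; omega)
    rw [card_pair hij, biUnion_insert, singleton_biUnion] at h1
    have h2 := card_union_add_card_inter (S i) (S j)
    rw [hS, hS] at h2
    have h3 : #(S i ∩ S j) ≤ ⌊m⌋₊ := by omega
    exact (Nat.le_floor_iff hm0).1 h3
  · exact exists_matroid_of_nearly_disjoint hdk hS hexp fun i =>
      ⟨(Nat.floor_le_ceil m).trans (hb i).1, (hb i).2⟩
end

section
/- There is an absolute constant C ≥ 1 such that the following holds. Let S_1,...,S_N be subsets of [n], let b_min > 0, let m ≥ 1 be an integer, and let 1 ≤ c ≤ m/8. Let Q be any family of functions from 2^[n] to ℝ≥0 with |Q| ≤ C^{-1}·2^{N·4^{-m}}. Then there exists a vector β = (b_1,...,b_N) with each b_i ∈ {2^k·b_min : 1 ≤ k ≤ m} such that for every q ∈ Q, E_{i∼Unif[N]}[q(S_i)·1{q(S_i) ≤ b_i}] < (1/c)·E_{i∼Unif[N]}[b_i]; that is, no q ∈ Q c-approximates the partial pricing p_{S,β} (defined by p_{S,β}(S_i)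 = b_i) from below over the uniform distribution on {S_1,...,S_N}. -/
open Finset

/-- Exponential moment method with a union bound, for independent coordinates drawn from the
common unnormalized weight `w`. -/
theorem exists_forall_sum_lt_zero {ι κ α : Type*} [Fintype ι] [DecidableEq ι]
    (A : Finset α) (t : Finset κ) (w : κ → ℝ) (hw : ∀ k ∈ t, 0 ≤ w k) (hZ : 0 < ∑ k ∈ t, w k)
    (D : α → ι → κ → ℝ) (ρ : ℝ)
    (hD : ∀ a ∈ A, ∀ i, ∑ k ∈ t, w k * Real.exp (D a i k) ≤ (∑ k ∈ t, w k) * ρ)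
    (hA : (#A : ℝ) * ρ ^ Fintype.card ι < 1) :
    ∃ f : ι → κ, (∀ i, f i ∈ t) ∧ ∀ a ∈ A, ∑ i, D a i (f i) < 0 := by
  by_contra! H
  set Z := ∑ k ∈ t, w k
  have hweight : ∑ f ∈ Fintype.piFinset (fun _ : ι => t), ∏ i, w (f i) =
      Z ^ Fintype.card ι := by
    rw [← Finset.prod_univ_sum (fun _ : ι => t) (fun _ k => w k)]
    simp [Z, Finset.card_univ]
  have hlower : Z ^ Fintype.card ι ≤ ∑ f ∈ Fintype.piFinset (fun _ : ι => t),
      ∑ a ∈ A, ∏ i, (w (f i) * Real.exp (D a i (f i))) := by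
    rw [← hweight]
    refine Finset.sum_le_sum fun f hf => ?_
    have hf' : ∀ i, f i ∈ t := Fintype.mem_piFinset.1 hf
    have hnonneg : ∀ i, 0 ≤ w (f i) := fun i => hw _ (hf' i)
    obtain ⟨a, ha, hpos⟩ := H f hf'
    calc ∏ i, w (f i) ≤ ∏ i, (w (f i) * Real.exp (D a i (f i))) := by
          rw [Finset.prod_mul_distrib, ← Real.exp_sum]
          exact le_mul_of_one_le_right (Finset.prod_nonneg fun i _ => hnonneg i)
            (Real.one_le_exp hpos)
      _ ≤ _ := Finset.single_le_sum
          (f := fun a => ∏ i, (w (f i) * Real.exp (D a i (f i))))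
          (fun b _ => Finset.prod_nonneg fun i _ =>
            mul_nonneg (hnonneg i) (Real.exp_pos _).le) ha
  have hupper : ∑ f ∈ Fintype.piFinset (fun _ : ι => t),
      ∑ a ∈ A, ∏ i, (w (f i) * Real.exp (D a i (f i))) ≤
      Z ^ Fintype.card ι * (#A * ρ ^ Fintype.card ι) := by
    rw [Finset.sum_comm]
    calc _ ≤ ∑ a ∈ A, (Z * ρ) ^ Fintype.card ι := by
          refine Finset.sum_le_sum fun a ha => ?_
          rw [← Finset.prod_univ_sum (fun _ : ι => t)
            (fun i k => w k * Real.exp (D a i k))]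
          refine (Finset.prod_le_prod (fun i _ => Finset.sum_nonneg fun k hk =>
            mul_nonneg (hw k hk) (Real.exp_pos _).le) fun i _ => hD a ha i).trans_eq ?_
          simp [Finset.card_univ]
      _ = _ := by
          rw [Finset.sum_const, nsmul_eq_mul, mul_pow]
          ring
  have hZN : 0 < Z ^ Fintype.card ι := pow_pos hZ _
  nlinarith

theorem sum_geometric_revenue_le_ite (x : ℝ) (m : ℕ) :
    ∑ k ∈ Icc 1 m, (1 / 2 : ℝ) ^ k * (if x ≤ 2 ^ k then x else 0) ≤
      if x ≤ 2 ^ m then 2 - (1 / 2) ^ m * x else 0 := by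
  induction m with
  | zero =>
    simp only [pow_zero, one_mul]
    split_ifs <;> simp; linarith
  | succ m ih =>
    rw [Finset.sum_Icc_succ_top (by omega)]
    have hpow : (1 / 2 : ℝ) ^ (m + 1) * 2 ^ (m + 1) = 1 := by
      rw [← mul_pow]; norm_num
    have hhalf : (1 / 2 : ℝ) ^ (m + 1) = (1 / 2) ^ m * (1 / 2) := pow_succ _ _
    have hpos : (0 : ℝ) < (1 / 2) ^ (m + 1) := by positivity
    have hmono : (2 : ℝ) ^ m ≤ 2 ^ (m + 1) := pow_le_pow_right₀ (by norm_num) (by omega)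
    by_cases h : x ≤ 2 ^ m
    · have h' : x ≤ 2 ^ (m + 1) := h.trans hmono
      rw [if_pos h] at ih
      rw [if_pos h', if_pos h']
      rw [hhalf]
      linarith
    · rw [if_neg h] at ih
      by_cases h' : x ≤ 2 ^ (m + 1)
      · rw [if_pos h', if_pos h']
        nlinarith
      · rw [if_neg h', if_neg h']
        linarith

/-- A fixed price earns at most `2` against the geometric weights `2⁻ᵏ` on the values `2ᵏ`. -/
theorem sum_geometric_revenue_le_two (x : ℝ) (hx : 0 ≤ x) (m : ℕ) :
    ∑ k ∈ Icc 1 m, (1 / 2 : ℝ) ^ k * (if x ≤ 2 ^ k then x else 0) ≤ 2 := by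
  refine (sum_geometric_revenue_le_ite x m).trans ?_
  split_ifs
  · have : 0 ≤ (1 / 2 : ℝ) ^ m * x := by positivity
    linarith
  · norm_num

theorem sum_half_pow_Icc (m : ℕ) :
    ∑ k ∈ Icc 1 m, (1 / 2 : ℝ) ^ k = 1 - (1 / 2) ^ m := by
  induction m with
  | zero => simp
  | succ m ih =>
    rw [Finset.sum_Icc_succ_top (by omega), ih]
    ring

/-- Exponential moment bound for the excess of the revenue of a fixed price over `1 / c` times
the value, at rate `4⁻ᵐ`. -/
theorem sum_geometric_exp_excess_le (x : ℝ) (hx : 0 ≤ x) (m : ℕ) (c : ℝ) (hc : 1 ≤ c)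
    (hcm : c ≤ (m : ℝ) / 8) :
    ∑ k ∈ Icc 1 m, (1 / 2 : ℝ) ^ k *
        Real.exp ((1 / 4) ^ m * ((if x ≤ 2 ^ k then x else 0) - 2 ^ k / c)) ≤
      (∑ k ∈ Icc 1 m, (1 / 2 : ℝ) ^ k) * Real.exp (-5 * (1 / 4) ^ m) := by
  have hc0 : 0 < c := by linarith
  set l : ℝ := (1 / 4) ^ m with hl
  have hl0 : 0 < l := by positivity
  have hl4 : l * (2 ^ m * 2 ^ m) = 1 := by
    rw [hl, ← mul_pow, ← mul_pow]; norm_num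
  set d : ℕ → ℝ := fun k => (if x ≤ 2 ^ k then x else 0) - 2 ^ k / c with hd
  set Z : ℝ := ∑ k ∈ Icc 1 m, (1 / 2 : ℝ) ^ k with hZ
  have hZ1 : Z ≤ 1 := by
    rw [hZ, sum_half_pow_Icc]
    have : (0 : ℝ) < (1 / 2) ^ m := by positivity
    linarith
  have hZ0 : 0 ≤ Z := Finset.sum_nonneg fun k _ => by positivity
  have hterm : ∀ k ∈ Icc 1 m, Real.exp (l * d k) ≤ 1 + l + l * d k := by
    intro k hk
    have hkm : (2 : ℝ) ^ k ≤ 2 ^ m := pow_le_pow_right₀ (by norm_num) (Finset.mem_Icc.1 hk).2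
    have hk0 : (0 : ℝ) < 2 ^ k := by positivity
    have hm1 : (1 : ℝ) ≤ 2 ^ m := one_le_pow₀ (by norm_num)
    have hq0 : 0 ≤ (2 : ℝ) ^ k / c := by positivity
    have hq1 : (2 : ℝ) ^ k / c ≤ 2 ^ k := div_le_self hk0.le hc
    have habs : |d k| ≤ 2 ^ m := by
      rw [abs_le]
      simp only [hd]
      split_ifs <;> constructor <;> linarith
    have hsq : d k ^ 2 ≤ 2 ^ m * 2 ^ m := by
      have := sq_le_sq' (abs_le.1 habs).1 (abs_le.1 habs).2
      nlinarith
    have hlm : l * 2 ^ m ≤ 1 := by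
      rw [← hl4]
      exact mul_le_mul_of_nonneg_left (by nlinarith) hl0.le
    have hle1 : |l * d k| ≤ 1 := by
      rw [abs_mul, abs_of_pos hl0]
      exact (mul_le_mul_of_nonneg_left habs hl0.le).trans hlm
    have hexp := (abs_le.1 (Real.abs_exp_sub_one_sub_id_le hle1)).2
    have hquad : (l * d k) ^ 2 ≤ l := by
      calc (l * d k) ^ 2 = l * (l * d k ^ 2) := by ring
        _ ≤ l * (l * (2 ^ m * 2 ^ m)) := by gcongr
        _ = l := by rw [hl4, mul_one]
    linarith
  have hmean : ∑ k ∈ Icc 1 m, (1 / 2 : ℝ) ^ k * d k ≤ -6 := by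
    have hval : ∑ k ∈ Icc 1 m, (1 / 2 : ℝ) ^ k * (2 ^ k / c) = m / c := by
      have : ∀ k ∈ Icc 1 m, (1 / 2 : ℝ) ^ k * (2 ^ k / c) = 1 / c := by
        intro k _
        rw [← mul_div_assoc, ← mul_pow]
        norm_num
      rw [Finset.sum_congr rfl this]
      simp [div_eq_mul_inv]
    have h8 : 8 ≤ (m : ℝ) / c := by
      rw [le_div_iff₀ hc0]
      linarith
    simp only [hd, mul_sub, Finset.sum_sub_distrib]
    rw [hval]
    have := sum_geometric_revenue_le_two x hx m
    linarith
  calc ∑ k ∈ Icc 1 m, (1 / 2 : ℝ) ^ k * Real.exp (l * d k)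
      ≤ ∑ k ∈ Icc 1 m, (1 / 2 : ℝ) ^ k * (1 + l + l * d k) :=
        Finset.sum_le_sum fun k hk => mul_le_mul_of_nonneg_left (hterm k hk) (by positivity)
    _ = Z * (1 + l) + l * ∑ k ∈ Icc 1 m, (1 / 2 : ℝ) ^ k * d k := by
        rw [hZ, Finset.sum_mul, Finset.mul_sum, ← Finset.sum_add_distrib]
        exact Finset.sum_congr rfl fun k _ => by ring
    _ ≤ Z * (-5 * l + 1) := by nlinarith
    _ ≤ Z * Real.exp (-5 * l) := mul_le_mul_of_nonneg_left (Real.add_one_le_exp _) hZ0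


/-- there is an absolute constant `C ≥ 1` such that for any sets
`S_1, …, S_N ⊆ [n]`, any `b_min > 0`, any `m ≥ 1` and `1 ≤ c ≤ m/8`, and any family `Q` of
nonnegative set functions with `|Q| ≤ C⁻¹ · 2^{N·4^{-m}}`, there is a price vector `β`
with each `b_i ∈ {2^k·b_min : 1 ≤ k ≤ m}` such that no `q ∈ Q` `c`-approximates the
partial pricing `p_{S,β}` from below over the uniform distribution on `{S_1, …, S_N}`. -/
theorem no_small_family_approximates :
    ∃ C : ℝ, 1 ≤ C ∧
      ∀ (n N : ℕ), 0 < N →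
        ∀ S : Fin N → Finset (Fin n), Function.Injective S →
          ∀ bmin : ℝ, 0 < bmin →
            ∀ m : ℕ, 1 ≤ m →
              ∀ c : ℝ, 1 ≤ c → c ≤ (m : ℝ) / 8 →
                ∀ Q : Set (Finset (Fin n) → ℝ), Q.Finite →
                  (∀ q ∈ Q, ∀ T : Finset (Fin n), 0 ≤ q T) →
                  (Q.ncard : ℝ) ≤ C⁻¹ * 2 ^ ((N : ℝ) * 4 ^ (-(m : ℝ))) →
                  ∃ b : Fin N → ℝ,
                    (∀ i, ∃ k : ℕ, 1 ≤ k ∧ k ≤ m ∧ b i = 2 ^ k * bmin) ∧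
                    ∀ q ∈ Q,
                      (N : ℝ)⁻¹ * (∑ i, if q (S i) ≤ b i then q (S i) else 0) <
                        (1 / c) * ((N : ℝ)⁻¹ * ∑ i, b i) := by

  refine ⟨1, le_rfl, ?_⟩
  intro n N hN S _ bmin hb m hm c hc hcm Q hQ hQ0 hcard
  have hc0 : 0 < c := by linarith
  have hZ : 0 < ∑ k ∈ Icc 1 m, (1 / 2 : ℝ) ^ k :=
    Finset.sum_pos (fun k _ => by positivity) ⟨1, by simp [hm]⟩
  have hsmall : (#hQ.toFinset : ℝ) * Real.exp (-5 * (1 / 4) ^ m) ^ Fintype.card (Fin N) < 1 := by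
    have hfour : (4 : ℝ) ^ (-(m : ℝ)) = (1 / 4) ^ m := by
      rw [Real.rpow_neg (by norm_num), Real.rpow_natCast]
      simp
    rw [Set.ncard_eq_toFinset_card Q hQ, hfour, inv_one, one_mul,
      Real.rpow_def_of_pos (by norm_num)] at hcard
    have hx : 0 < (N : ℝ) * (1 / 4) ^ m := by positivity
    have hlog : Real.log 2 < 1 := Real.log_two_lt_d9.trans (by norm_num)
    rw [Fintype.card_fin, ← Real.exp_nat_mul]
    refine (mul_le_mul_of_nonneg_right hcard (Real.exp_pos _).le).trans_lt ?_
    rw [← Real.exp_add, Real.exp_lt_one_iff]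
    nlinarith
  obtain ⟨f, hf, hneg⟩ := exists_forall_sum_lt_zero hQ.toFinset (Icc 1 m)
    (fun k => (1 / 2 : ℝ) ^ k) (fun k _ => by positivity) hZ
    (fun q (i : Fin N) k => (1 / 4 : ℝ) ^ m *
      ((if q (S i) / bmin ≤ 2 ^ k then q (S i) / bmin else 0) - 2 ^ k / c))
    (Real.exp (-5 * (1 / 4) ^ m))
    (fun q hq i => sum_geometric_exp_excess_le _
      (div_nonneg (hQ0 q (hQ.mem_toFinset.1 hq) _) hb.le) m c hc hcm) hsmall
  refine ⟨fun i => 2 ^ f i * bmin, fun i => ⟨f i, (Finset.mem_Icc.1 (hf i)).1,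
    (Finset.mem_Icc.1 (hf i)).2, rfl⟩, fun q hq => ?_⟩
  have hsum := hneg q (hQ.mem_toFinset.2 hq)
  rw [← Finset.mul_sum] at hsum
  have hsum' := neg_of_mul_neg_right hsum (by positivity)
  have hscale : (∑ i, if q (S i) ≤ 2 ^ f i * bmin then q (S i) else 0) -
      (1 / c) * ∑ i, 2 ^ f i * bmin = bmin * ∑ i,
        ((if q (S i) / bmin ≤ 2 ^ f i then q (S i) / bmin else 0) - 2 ^ f i / c) := by
    rw [Finset.mul_sum, Finset.mul_sum, ← Finset.sum_sub_distrib]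
    refine Finset.sum_congr rfl fun i _ => ?_
    simp only [div_le_iff₀ hb]
    split_ifs <;> field_simp <;> ring
  have hlt : (∑ i, if q (S i) ≤ 2 ^ f i * bmin then q (S i) else 0) <
      (1 / c) * ∑ i, 2 ^ f i * bmin := by
    rw [← sub_neg, hscale]
    exact mul_neg_of_pos_of_neg hb hsum'
  rw [mul_left_comm]
  exact mul_lt_mul_of_pos_left hlt (by positivity)
end

section
/- Let m ≥ 1 be an integer and b_min > 0, and let b be a random variable with Pr[b = 2^k·b_min] = 2^{-k}/(1 − 2^{-m}) for k = 1, 2, ..., m (the truncated geometric distribution). Then E[b] = m·b_min/(1 − 2^{-m}), and for every real x ≥ 0, x·Pr[b ≥ x] ≤ 2·b_min. -/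
theorem sum_range_inv_two_pow_succ (m : ℕ) :
    ∑ k ∈ Finset.range m, ((2 : ℝ) ^ (k + 1))⁻¹ = 1 - ((2 : ℝ) ^ m)⁻¹ := by
  induction m with
  | zero => simp
  | succ n ih =>
    rw [Finset.sum_range_succ, ih, pow_succ]
    field_simp
    ring

/-- The unnormalized tail bound: scaling `b` by `2` shifts the index by one. -/
theorem mul_sum_range_tail_le (m : ℕ) (b x : ℝ) (hb : 0 < b) :
    x * ∑ k ∈ Finset.range m, (if x ≤ 2 ^ (k + 1) * b then ((2 : ℝ) ^ (k + 1))⁻¹ else 0) ≤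
      2 * b * (1 - ((2 : ℝ) ^ m)⁻¹) := by
  induction m generalizing b with
  | zero => simp
  | succ n ih =>
    by_cases h : x ≤ 2 * b
    · rw [← sum_range_inv_two_pow_succ]
      refine mul_le_mul h (Finset.sum_le_sum fun k _ => ?_)
        (Finset.sum_nonneg fun k _ => ?_) (by positivity)
      all_goals split_ifs <;> first | exact le_rfl | positivity
    · have hshift : ∀ k : ℕ,
          (if x ≤ 2 ^ (k + 1 + 1) * b then ((2 : ℝ) ^ (k + 1 + 1))⁻¹ else 0) =
            2⁻¹ * (if x ≤ 2 ^ (k + 1) * (2 * b) then ((2 : ℝ) ^ (k + 1))⁻¹ else 0) := by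
        intro k
        rw [pow_succ _ (k + 1), mul_assoc, mul_inv, mul_ite, mul_zero, mul_comm (2 : ℝ)⁻¹]
      rw [Finset.sum_range_succ', zero_add, pow_one, if_neg h, add_zero,
        Finset.sum_congr rfl fun k _ => hshift k, ← Finset.mul_sum]
      have key := ih (2 * b) (by positivity)
      have hpow : ((2 : ℝ) ^ (n + 1))⁻¹ ≤ ((2 : ℝ) ^ n)⁻¹ := by
        gcongr <;> norm_num
      nlinarith [mul_le_mul_of_nonneg_left hpow hb.le]

/-- for the truncated geometric distribution with
`Pr[b = 2^k·b_min] = 2^{-k}/(1 − 2^{-m})` for `k = 1, …, m`, the expectation is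
`m·b_min/(1 − 2^{-m})`, and for every `x ≥ 0` we have `x·Pr[b ≥ x] ≤ 2·b_min`. -/
theorem truncated_geometric (m : ℕ) (hm : 1 ≤ m) (bmin : ℝ) (hb : 0 < bmin) :
    (∑ k ∈ Finset.Icc 1 m, ((2 : ℝ) ^ k)⁻¹ / (1 - ((2 : ℝ) ^ m)⁻¹) * (2 ^ k * bmin)) =
        (m : ℝ) * bmin / (1 - ((2 : ℝ) ^ m)⁻¹) ∧
    ∀ x : ℝ, 0 ≤ x →
      x * (∑ k ∈ Finset.Icc 1 m,
          if x ≤ 2 ^ k * bmin then ((2 : ℝ) ^ k)⁻¹ / (1 - ((2 : ℝ) ^ m)⁻¹) else 0) ≤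
        2 * bmin := by
  have hpos : 0 < 1 - ((2 : ℝ) ^ m)⁻¹ :=
    sub_pos.2 (inv_lt_one_of_one_lt₀ (one_lt_pow₀ one_lt_two (by omega)))
  constructor
  · have hterm : ∀ k ∈ Finset.Icc 1 m,
        ((2 : ℝ) ^ k)⁻¹ / (1 - ((2 : ℝ) ^ m)⁻¹) * (2 ^ k * bmin) =
          bmin / (1 - ((2 : ℝ) ^ m)⁻¹) := by
      intro k _
      rw [div_mul_eq_mul_div, inv_mul_cancel_left₀ (by positivity)]
    rw [Finset.sum_congr rfl hterm, Finset.sum_const, Nat.card_Icc, nsmul_eq_mul,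
      Nat.add_sub_cancel, mul_div_assoc]
  · intro x _
    have hsum : (∑ k ∈ Finset.Icc 1 m,
        if x ≤ 2 ^ k * bmin then ((2 : ℝ) ^ k)⁻¹ / (1 - ((2 : ℝ) ^ m)⁻¹) else 0) =
        (∑ k ∈ Finset.range m,
          if x ≤ 2 ^ (k + 1) * bmin then ((2 : ℝ) ^ (k + 1))⁻¹ else 0) /
            (1 - ((2 : ℝ) ^ m)⁻¹) := by
      rw [← Finset.Ico_add_one_right_eq_Icc, Finset.sum_Ico_eq_sum_range, Finset.sum_div,
        Nat.add_sub_cancel]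
      refine Finset.sum_congr rfl fun k _ => ?_
      rw [add_comm 1 k, ite_div, zero_div]
    rw [hsum, ← mul_div_assoc, div_le_iff₀ hpos]
    exact mul_sum_range_tail_le m bmin x hb
end

section
/- For all sufficiently large n the following holds. There exists a distribution D over single-minded valuations on n items and a monotone submodular deterministic pricing p : 2^[n] → ℝ≥0 such that for every family Q of pricings of lotteries with |Q| ≤ 2^{2^{n^{1/6}/16}} (assuming buyer-optimal lotteries exist under each q ∈ Q for each valuation in the support of D), every q ∈ Q satisfies Rev_D(p) ≥ (log₂ n / C)·Rev_D(q), where C is an absolute constant. That is, no family of mechanisms of description complexity 2^{o(n^{1/6})} bits can obtain a o(log n) fraction of the optimal deterministic Sybil-proof revenue, even for single-minded buyers. -/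
/-- The single-minded valuation with demand set `S` and value `w`. -/
def singleMinded {n : ℕ} (S : Finset (Fin n)) (w : ℝ) : Finset (Fin n) → ℝ :=
  fun T => if S ⊆ T then w else 0

open Finset

/-- Graphs of polynomials of degree less than `t` over `ZMod q`, placed inside `Fin n`. -/
theorem exists_finset_family_small_inter {q n : ℕ} [Fact q.Prime] (hqn : q * q ≤ n) (t : ℕ) :
    ∃ A : Fin (q ^ t) → Finset (Fin n),
      (∀ i, #(A i) = q) ∧ ∀ i j, i ≠ j → #(A i ∩ A j) ≤ t := by
  classical
  obtain ⟨e⟩ : Nonempty (ZMod q × ZMod q ↪ Fin n) := by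
    apply Function.Embedding.nonempty_of_card_le
    simpa [ZMod.card] using hqn
  have hcard : Fintype.card (Fin t → ZMod q) = q ^ t := by simp [ZMod.card]
  let E : Fin (q ^ t) ≃ (Fin t → ZMod q) := (Fintype.equivFinOfCardEq hcard).symm
  let P : Fin (q ^ t) → Polynomial (ZMod q) :=
    fun i => ((Polynomial.degreeLTEquiv (ZMod q) t).symm (E i)).1
  have hPinj : Function.Injective P := fun i j hij =>
    E.injective ((Polynomial.degreeLTEquiv (ZMod q) t).symm.injective (Subtype.ext hij))
  have hPdeg : ∀ i, (P i).degree < t := fun i =>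
    Polynomial.mem_degreeLT.1 ((Polynomial.degreeLTEquiv (ZMod q) t).symm (E i)).2
  have hginj : ∀ i, Function.Injective fun x => e (x, (P i).eval x) := fun i x y hxy =>
    (Prod.ext_iff.1 (e.injective hxy)).1
  refine ⟨fun i => univ.image fun x => e (x, (P i).eval x), fun i => ?_, fun i j hij => ?_⟩
  · rw [card_image_of_injective _ (hginj i), card_univ, ZMod.card]
  · have hne : P i - P j ≠ 0 := sub_ne_zero.2 fun h => hij (hPinj h)
    have hsub : (univ.image fun x => e (x, (P i).eval x)) ∩
        (univ.image fun x => e (x, (P j).eval x)) ⊆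
        (P i - P j).roots.toFinset.image fun x => e (x, (P i).eval x) := by
      intro z hz
      simp only [mem_inter, mem_image, mem_univ, true_and] at hz
      obtain ⟨⟨x, hx⟩, y, hy⟩ := hz
      have hxy := e.injective (hx.trans hy.symm)
      simp only [Prod.mk.injEq] at hxy
      obtain ⟨rfl, h⟩ := hxy
      refine mem_image.2 ⟨x, ?_, hx⟩
      rw [Multiset.mem_toFinset, Polynomial.mem_roots hne]
      simp [Polynomial.IsRoot, h]
    have hdeg : ((P i - P j).natDegree : WithBot ℕ) ≤ t := by
      rw [← Polynomial.degree_eq_natDegree hne]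
      exact (Polynomial.degree_sub_le _ _).trans (max_le (hPdeg i).le (hPdeg j).le)
    calc _ ≤ _ := card_le_card hsub
      _ ≤ #(P i - P j).roots.toFinset := card_image_le
      _ ≤ (P i - P j).roots.card := Multiset.toFinset_card_le _
      _ ≤ (P i - P j).natDegree := Polynomial.card_roots' _
      _ ≤ t := by exact_mod_cast hdeg

/-- A union bound over `Q` with exponential moments of a uniformly random assignment. -/
theorem exists_assignment_sum_le {β : Type*} {K l : ℕ} (hl : 0 < l) (Q : Finset β)
    (Y : β → Fin K → Fin l → ℝ) (hY0 : ∀ b ∈ Q, ∀ i j, 0 ≤ Y b i j)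
    (hYsum : ∀ b ∈ Q, ∀ i, ∑ j, Y b i j ≤ 1) (hQ : (#Q : ℝ) < Real.exp (K / l)) :
    ∃ s : Fin K → Fin l, ∀ b ∈ Q, ∑ i, Y b i (s i) ≤ 3 * (K / l) := by
  by_contra! hbad
  have hl' : (0 : ℝ) < l := by exact_mod_cast hl
  have hexp : ∀ b ∈ Q, ∀ i, ∑ j, Real.exp (Y b i j) ≤ l * Real.exp (2 / l) := by
    intro b hb i
    have hY1 : ∀ j, Y b i j ≤ 1 := fun j =>
      (single_le_sum (fun k _ => hY0 b hb i k) (mem_univ j)).trans (hYsum b hb i)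
    calc ∑ j, Real.exp (Y b i j) ≤ ∑ j, (1 + 2 * Y b i j) := by
          refine sum_le_sum fun j _ => ?_
          have h0 := hY0 b hb i j
          have h1 := hY1 j
          have h := abs_le.1 (Real.abs_exp_sub_one_sub_id_le (abs_le.2 ⟨by linarith, h1⟩))
          nlinarith [h.2]
      _ ≤ l + 2 := by
          rw [sum_add_distrib, ← mul_sum]
          have := hYsum b hb i
          simp only [sum_const, card_univ, Fintype.card_fin, nsmul_eq_mul, mul_one]
          linarith
      _ = l * (2 / l + 1) := by field_simp; ring
      _ ≤ _ := by gcongr; exact Real.add_one_le_exp _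
  have hprod : ∀ b ∈ Q, ∑ s : Fin K → Fin l, Real.exp (∑ i, Y b i (s i)) ≤
      (l : ℝ) ^ K * Real.exp (2 * (K / l)) := by
    intro b hb
    calc ∑ s : Fin K → Fin l, Real.exp (∑ i, Y b i (s i))
        = ∏ i, ∑ j, Real.exp (Y b i j) := by
          simp_rw [Real.exp_sum]
          exact (Fintype.prod_sum fun i j => Real.exp (Y b i j)).symm
      _ ≤ ∏ _i : Fin K, (l : ℝ) * Real.exp (2 / l) :=
          prod_le_prod (fun i _ => sum_nonneg fun j _ => (Real.exp_pos _).le)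
            fun i _ => hexp b hb i
      _ = _ := by
          rw [prod_const, card_univ, Fintype.card_fin, mul_pow, ← Real.exp_nat_mul]
          congr 2; ring
  have hmain : (l : ℝ) ^ K * Real.exp (3 * (K / l)) ≤
      #Q * ((l : ℝ) ^ K * Real.exp (2 * (K / l))) := by
    calc (l : ℝ) ^ K * Real.exp (3 * (K / l))
        = ∑ _s : Fin K → Fin l, Real.exp (3 * (K / l)) := by simp
      _ ≤ ∑ s : Fin K → Fin l, ∑ b ∈ Q, Real.exp (∑ i, Y b i (s i)) := by
          refine sum_le_sum fun s _ => ?_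
          obtain ⟨b, hb, hlt⟩ := hbad s
          exact (Real.exp_le_exp.2 hlt.le).trans (single_le_sum
            (f := fun b => Real.exp (∑ i, Y b i (s i))) (fun c _ => (Real.exp_pos _).le) hb)
      _ = ∑ b ∈ Q, ∑ s : Fin K → Fin l, Real.exp (∑ i, Y b i (s i)) := sum_comm
      _ ≤ ∑ _b ∈ Q, (l : ℝ) ^ K * Real.exp (2 * (K / l)) := sum_le_sum hprod
      _ = _ := by rw [sum_const, nsmul_eq_mul]
  have hsplit : Real.exp (3 * ((K : ℝ) / l)) =
      Real.exp (K / l) * Real.exp (2 * (K / l)) := by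
    rw [← Real.exp_add]; congr 1; ring
  rw [hsplit] at hmain
  have hpos : 0 < (l : ℝ) ^ K * Real.exp (2 * (K / l)) := by positivity
  nlinarith

theorem sum_card_inter_le {α ι : Type*} [DecidableEq α] [DecidableEq ι] (A : ι → Finset α)
    {d : ℕ} (hA : ∀ i j, i ≠ j → #(A i ∩ A j) ≤ d) (T : Finset α) (J : Finset ι) :
    ∑ j ∈ J, #(T ∩ A j) ≤ #(T ∩ J.biUnion A) + #J * #J * d := by
  induction J using Finset.induction_on with
  | empty => simp
  | insert a J ha ih =>
    have hov : #((T ∩ A a) ∩ (T ∩ J.biUnion A)) ≤ #J * d := by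
      calc _ ≤ #(J.biUnion fun j => A a ∩ A j) := by
            apply card_le_card
            intro x hx
            simp only [mem_inter, mem_biUnion] at hx ⊢
            obtain ⟨⟨-, hxa⟩, -, j, hj, hxj⟩ := hx
            exact ⟨j, hj, hxa, hxj⟩
        _ ≤ _ := card_biUnion_le_card_mul _ _ _ fun j hj =>
            hA a j fun h => ha (h ▸ hj)
    have hun : T ∩ (insert a J).biUnion A = (T ∩ A a) ∪ (T ∩ J.biUnion A) := by
      rw [biUnion_insert, inter_union_distrib_left]
    have := card_union_add_card_inter (T ∩ A a) (T ∩ J.biUnion A)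
    rw [sum_insert ha, hun, card_insert_of_notMem ha]
    nlinarith

/-- The number of elements of `T`, where each chosen `A j` caps its own contribution at `v j`. -/
def cappedCard {α ι : Type*} [DecidableEq α] (A : ι → Finset α) (v : ι → ℝ)
    (T : Finset α) (J : Finset ι) : ℝ :=
  #T + ∑ j ∈ J, (v j - #(T ∩ A j))

theorem cappedCard_union_add_inter_le {α ι : Type*} [DecidableEq α] [DecidableEq ι]
    (A : ι → Finset α) (v : ι → ℝ) (T T' : Finset α) (J J' : Finset ι) :
    cappedCard A v (T ∪ T') (J ∪ J') + cappedCard A v (T ∩ T') (J ∩ J') ≤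
      cappedCard A v T J + cappedCard A v T' J' := by
  have hcard : (#(T ∪ T') : ℝ) + #(T ∩ T') = #T + #T' := by
    exact_mod_cast card_union_add_card_inter T T'
  have hset : ∀ j, (#((T ∪ T') ∩ A j) : ℝ) + #((T ∩ T') ∩ A j) = #(T ∩ A j) + #(T' ∩ A j) := by
    intro j
    rw [union_inter_distrib_right, inter_inter_distrib_right]
    exact_mod_cast card_union_add_card_inter (T ∩ A j) (T' ∩ A j)
  have hmono : ∀ {U V : Finset α} (j : ι), U ⊆ V → (#(U ∩ A j) : ℝ) ≤ #(V ∩ A j) :=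
    fun j h => by exact_mod_cast card_le_card (inter_subset_inter_right h)
  have hJ : J ∪ J' = (J \ J') ∪ (J' \ J) ∪ (J ∩ J') := by ext; simp; tauto
  have hd1 : Disjoint ((J \ J') ∪ (J' \ J)) (J ∩ J') := by
    rw [disjoint_left]; intro x; simp; tauto
  have hd2 : Disjoint (J \ J') (J' \ J) := by
    rw [disjoint_left]; intro x; simp; tauto
  have hsplit : ∀ f : ι → ℝ, ∑ j ∈ J ∪ J', f j =
      ∑ j ∈ J \ J', f j + ∑ j ∈ J' \ J, f j + ∑ j ∈ J ∩ J', f j := by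
    intro f
    rw [hJ, sum_union hd1, sum_union hd2]
  have hl : ∀ f : ι → ℝ, ∑ j ∈ J, f j = ∑ j ∈ J \ J', f j + ∑ j ∈ J ∩ J', f j := fun f => by
    rw [add_comm, sum_inter_add_sum_sdiff]
  have hr : ∀ f : ι → ℝ, ∑ j ∈ J', f j = ∑ j ∈ J' \ J, f j + ∑ j ∈ J ∩ J', f j := fun f => by
    rw [add_comm, inter_comm, sum_inter_add_sum_sdiff]
  have h1 : ∑ j ∈ J \ J', (v j - #((T ∪ T') ∩ A j)) ≤ ∑ j ∈ J \ J', (v j - #(T ∩ A j)) :=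
    sum_le_sum fun j _ => sub_le_sub_left (hmono j subset_union_left) _
  have h2 : ∑ j ∈ J' \ J, (v j - #((T ∪ T') ∩ A j)) ≤ ∑ j ∈ J' \ J, (v j - #(T' ∩ A j)) :=
    sum_le_sum fun j _ => sub_le_sub_left (hmono j subset_union_right) _
  have h3 : ∑ j ∈ J ∩ J', (v j - #((T ∪ T') ∩ A j)) + ∑ j ∈ J ∩ J', (v j - #((T ∩ T') ∩ A j)) =
      ∑ j ∈ J ∩ J', (v j - #(T ∩ A j)) + ∑ j ∈ J ∩ J', (v j - #(T' ∩ A j)) := by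
    rw [← sum_add_distrib, ← sum_add_distrib]
    exact sum_congr rfl fun j _ => by linarith [hset j]
  unfold cappedCard
  rw [hsplit, hl fun j => v j - #(T ∩ A j), hr fun j => v j - #(T' ∩ A j)]
  linarith

theorem sum_add_card_sdiff_le_cappedCard {α ι : Type*} [DecidableEq α] [DecidableEq ι]
    (A : ι → Finset α) (v : ι → ℝ) {τ d : ℕ} (hA : ∀ i j, i ≠ j → #(A i ∩ A j) ≤ d)
    (T : Finset α) {J : Finset ι} (hJ : #J ≤ 2 * τ) :
    ∑ j ∈ J, (v j - 2 * τ * d) + #(T \ J.biUnion A) ≤ cappedCard A v T J := by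
  have h := sum_card_inter_le A hA T J
  have h' : ∑ j ∈ J, (#(T ∩ A j) : ℝ) ≤ #(T ∩ J.biUnion A) + #J * #J * d := by
    exact_mod_cast h
  have hT : (#(T \ J.biUnion A) : ℝ) + #(T ∩ J.biUnion A) = #T := by
    exact_mod_cast card_sdiff_add_card_inter T (J.biUnion A)
  have hJ' : (#J : ℝ) ≤ 2 * τ := by exact_mod_cast hJ
  have hb : (#J : ℝ) * #J * d ≤ #J * (2 * τ * d) := by
    rw [mul_assoc]; gcongr
  unfold cappedCard
  rw [sum_sub_distrib, sum_sub_distrib, sum_const, nsmul_eq_mul]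
  linarith

theorem exists_min_over_supersets {α ι : Type*} [Fintype α] [Fintype ι]
    (k : ℕ) (G : Finset α → Finset ι → ℝ) :
    ∃ p : Finset α → ℝ, (∀ {S T J}, S ⊆ T → #J ≤ k → p S ≤ G T J) ∧
      ∀ S, ∃ T J, S ⊆ T ∧ #J ≤ k ∧ p S = G T J := by
  classical
  have h : ∀ S, ∃ x ∈ univ.filter fun x : Finset α × Finset ι => S ⊆ x.1 ∧ #x.2 ≤ k,
      ∀ y ∈ univ.filter fun x : Finset α × Finset ι => S ⊆ x.1 ∧ #x.2 ≤ k,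
        G x.1 x.2 ≤ G y.1 y.2 := fun S =>
    exists_min_image _ _ ⟨(S, ∅), by simp⟩
  choose m hm hmin using h
  refine ⟨fun S => G (m S).1 (m S).2, fun {S T J} hST hJ => hmin S (T, J) (by simp [hST, hJ]),
    fun S => ⟨(m S).1, (m S).2, ?_⟩⟩
  have := hm S
  simp only [mem_filter, mem_univ, true_and] at this
  exact ⟨this.1, this.2, rfl⟩

/-- For an almost disjoint family of large sets, any assignment of values in a suitable range is
attained up to a factor two by a monotone submodular function. -/
theorem exists_monotone_submodular_near {α ι : Type*} [Fintype α] [DecidableEq α] [Fintype ι]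
    [DecidableEq ι] (A : ι → Finset α) (v : ι → ℝ) {τ d : ℕ} (hτ : 0 < τ)
    (hA : ∀ i j, i ≠ j → #(A i ∩ A j) ≤ d) (hcard : ∀ i, 4 * τ * τ * d ≤ #(A i))
    (hlow : ∀ i, 4 * τ * d ≤ v i) (hhigh : ∀ i, v i ≤ 2 * τ * τ * d) :
    ∃ p : Finset α → ℝ, (∀ S, 0 ≤ p S) ∧ p ∅ = 0 ∧ (∀ S T, S ⊆ T → p S ≤ p T) ∧
      (∀ S T, p (S ∪ T) + p (S ∩ T) ≤ p S + p T) ∧ ∀ i, v i / 2 ≤ p (A i) ∧ p (A i) ≤ v i := by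
  obtain ⟨H, hH⟩ : ∃ H : ℝ, H = 2 * τ * τ * d := ⟨_, rfl⟩
  have hH0 : 0 ≤ H := by rw [hH]; positivity
  rw [← hH] at hhigh
  have hτ1 : (1 : ℝ) ≤ τ := by exact_mod_cast hτ
  have hτd : (0 : ℝ) ≤ 2 * τ * d := by positivity
  have hterm : ∀ j, 2 * τ * d ≤ v j - 2 * τ * d := fun j => by linarith [hlow j]
  have hcap : ∀ T (J : Finset ι), #J ≤ 2 * τ → #J * (2 * τ * d) ≤ cappedCard A v T J := by
    intro T J hJ
    refine le_trans ?_ (sum_add_card_sdiff_le_cappedCard A v hA T hJ)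
    have : #J * (2 * τ * d : ℝ) ≤ ∑ j ∈ J, (v j - 2 * τ * d) := by
      rw [← nsmul_eq_mul]; exact card_nsmul_le_sum _ _ _ fun j _ => hterm j
    have h0 : (0 : ℝ) ≤ #(T \ J.biUnion A) := Nat.cast_nonneg _
    linarith
  have hsmall : ∀ T (J : Finset ι), #J ≤ 2 * τ → cappedCard A v T J < H → #J ≤ τ := by
    intro T J hJ hlt
    by_contra! hcon
    have h1 : (τ : ℝ) ≤ #J := by exact_mod_cast hcon.le
    have h2 := hcap T J hJ
    have h3 : τ * (2 * τ * d : ℝ) ≤ #J * (2 * τ * d) := by gcongr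
    nlinarith
  obtain ⟨p, hple, hex⟩ := exists_min_over_supersets (2 * τ)
    fun T J => min H (cappedCard A v T J)
  have hpH : ∀ S, p S ≤ H := fun S =>
    (hple subset_rfl (J := ∅) (by simp)).trans (min_le_left _ _)
  have hp0 : ∀ S, 0 ≤ p S := by
    intro S
    obtain ⟨T, J, -, hJ, h⟩ := hex S
    rw [h]
    exact le_min hH0 ((by positivity : (0 : ℝ) ≤ #J * (2 * τ * d)).trans (hcap T J hJ))
  have hmono : ∀ S T, S ⊆ T → p S ≤ p T := by
    intro S T hST
    obtain ⟨U, J, hU, hJ, h⟩ := hex T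
    rw [h]
    exact hple (hST.trans hU) hJ
  refine ⟨p, hp0, ?_, hmono, ?_, fun i => ⟨?_, ?_⟩⟩
  · refine le_antisymm ?_ (hp0 ∅)
    exact (hple subset_rfl (J := ∅) (by simp)).trans
      ((min_le_right _ _).trans (by simp [cappedCard]))
  · intro S T
    obtain ⟨U, J, hU, hJ, hS⟩ := hex S
    obtain ⟨U', J', hU', hJ', hT⟩ := hex T
    rcases le_or_gt H (cappedCard A v U J) with h | h
    · have : p S = H := by rw [hS, min_eq_left h]
      linarith [hpH (S ∪ T), hmono _ _ (inter_subset_right : S ∩ T ⊆ T)]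
    rcases le_or_gt H (cappedCard A v U' J') with h' | h'
    · have : p T = H := by rw [hT, min_eq_left h']
      linarith [hpH (S ∪ T), hmono _ _ (inter_subset_left : S ∩ T ⊆ S)]
    rw [hS, hT, min_eq_right h.le, min_eq_right h'.le]
    have hc := hsmall U J hJ h
    have hc' := hsmall U' J' hJ' h'
    have h1 := (hple (union_subset_union hU hU') (J := J ∪ J')
      ((card_union_le _ _).trans (by omega))).trans (min_le_right _ _)
    have h2 := (hple (inter_subset_inter hU hU') (J := J ∩ J')
      ((card_le_card inter_subset_left).trans hJ)).trans (min_le_right _ _)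
    linarith [cappedCard_union_add_inter_le A v U U' J J']
  · obtain ⟨T, J, hT, hJ, h⟩ := hex (A i)
    have hv := hlow i
    have hle := sum_add_card_sdiff_le_cappedCard A v hA T hJ
    rw [h]
    refine le_min (by linarith [hhigh i]) (le_trans ?_ hle)
    by_cases hi : i ∈ J
    · have h1 := single_le_sum (f := fun j => v j - 2 * τ * d)
        (fun j _ => hτd.trans (hterm j)) hi
      have h0 : (0 : ℝ) ≤ #(T \ J.biUnion A) := Nat.cast_nonneg _
      linarith
    · have h1 : (0 : ℝ) ≤ ∑ j ∈ J, (v j - 2 * τ * d) :=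
        sum_nonneg fun j _ => hτd.trans (hterm j)
      have h2 : #(A i ∩ J.biUnion A) ≤ #J * d := by
        rw [inter_biUnion]
        exact card_biUnion_le_card_mul _ _ _ fun j hj => hA i j fun e => hi (e ▸ hj)
      have h3 : #(A i ∩ J.biUnion A) ≤ 2 * τ * d := h2.trans (by gcongr)
      have h4 := card_sdiff_add_card_inter (A i) (J.biUnion A)
      have h5 : #(A i \ J.biUnion A) ≤ #(T \ J.biUnion A) :=
        card_le_card (sdiff_subset_sdiff hT subset_rfl)
      have h6 : 4 * τ * τ * d ≤ #(T \ J.biUnion A) + 2 * τ * d := by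
        have := hcard i
        omega
      have h7 : (4 * τ * τ * d : ℝ) ≤ #(T \ J.biUnion A) + 2 * τ * d := by exact_mod_cast h6
      have h8 : (2 * τ * d : ℝ) ≤ 2 * τ * d * τ := le_mul_of_one_le_right hτd hτ1
      linarith [hhigh i]
  · refine (hple subset_rfl (J := {i}) (by simp; omega)).trans ((min_le_right _ _).trans ?_)
    simp [cappedCard]

theorem lotVal_singleMinded {n : ℕ} (S : Finset (Fin n)) (w : ℝ) (lam : PMF (Finset (Fin n))) :
    lotVal (singleMinded S w) lam = w * lotVal (singleMinded S 1) lam := by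
  simp only [lotVal, singleMinded, mul_sum]
  refine sum_congr rfl fun T _ => ?_
  split_ifs <;> ring

theorem lotVal_singleMinded_one_mem_Icc {n : ℕ} (S : Finset (Fin n))
    (lam : PMF (Finset (Fin n))) : lotVal (singleMinded S 1) lam ∈ Set.Icc (0 : ℝ) 1 := by
  have hsum : ∑ T, (lam T).toReal = 1 := by
    rw [← ENNReal.toReal_sum fun T _ => lam.apply_ne_top T, ← tsum_fintype (L := .unconditional _),
      lam.tsum_coe, ENNReal.toReal_one]
  constructor
  · refine sum_nonneg fun T _ => mul_nonneg ENNReal.toReal_nonneg ?_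
    unfold singleMinded
    split_ifs <;> norm_num
  · refine le_trans (sum_le_sum (g := fun T => (lam T).toReal) fun T _ =>
      mul_le_of_le_one_right ENNReal.toReal_nonneg ?_) hsum.le
    unfold singleMinded
    split_ifs <;> norm_num

/-- The supremal utility of a single-minded buyer under the lottery pricing `q`. -/
noncomputable def indirectUtility {n : ℕ} (q : PMF (Finset (Fin n)) → ℝ) (S : Finset (Fin n))
    (w : ℝ) : ℝ :=
  ⨆ lam, (lotVal (singleMinded S w) lam - q lam)

section IndirectUtility

variable {n : ℕ} {q : PMF (Finset (Fin n)) → ℝ} (S : Finset (Fin n)) {w : ℝ}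

theorem lotVal_sub_le (hq : ∀ lam, 0 ≤ q lam) (hw : 0 ≤ w) (lam : PMF (Finset (Fin n))) :
    lotVal (singleMinded S w) lam - q lam ≤ w := by
  rw [lotVal_singleMinded]
  linarith [hq lam, mul_le_of_le_one_right hw (lotVal_singleMinded_one_mem_Icc S lam).2]

theorem lotVal_sub_le_indirectUtility (hq : ∀ lam, 0 ≤ q lam) (hw : 0 ≤ w)
    (lam : PMF (Finset (Fin n))) :
    lotVal (singleMinded S w) lam - q lam ≤ indirectUtility q S w :=
  le_ciSup (f := fun lam => lotVal (singleMinded S w) lam - q lam)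
    ⟨w, Set.forall_mem_range.2 (lotVal_sub_le S hq hw)⟩ lam

theorem indirectUtility_le (hq : ∀ lam, 0 ≤ q lam) (hw : 0 ≤ w) : indirectUtility q S w ≤ w :=
  have : Nonempty (PMF (Finset (Fin n))) := ⟨PMF.pure ∅⟩
  ciSup_le (lotVal_sub_le S hq hw)

theorem indirectUtility_nonneg (hq : ∀ lam, 0 ≤ q lam) (hq0 : q (PMF.pure ∅) = 0) (hw : 0 ≤ w) :
    0 ≤ indirectUtility q S w := by
  refine le_trans ?_ (lotVal_sub_le_indirectUtility S hq hw (PMF.pure ∅))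
  rw [lotVal_singleMinded, hq0, sub_zero]
  exact mul_nonneg hw (lotVal_singleMinded_one_mem_Icc S _).1

theorem two_mul_indirectUtility_le (hq : ∀ lam, 0 ≤ q lam) (hw : 0 ≤ w) :
    2 * indirectUtility q S w ≤ indirectUtility q S (2 * w) := by
  have : Nonempty (PMF (Finset (Fin n))) := ⟨PMF.pure ∅⟩
  have h : indirectUtility q S w ≤ indirectUtility q S (2 * w) / 2 := by
    refine ciSup_le fun lam => ?_
    have h := lotVal_sub_le_indirectUtility S hq (mul_nonneg zero_le_two hw) lam
    rw [lotVal_singleMinded] at h ⊢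
    linarith [hq lam]
  linarith

/-- Doubling the value raises the utility by at least the value of the purchased lottery, which
bounds its price. -/
theorem price_le_of_optimal (hq : ∀ lam, 0 ≤ q lam) (hw : 0 ≤ w) {sel : PMF (Finset (Fin n))}
    (hsel : ∀ lam, lotVal (singleMinded S w) lam - q lam ≤
      lotVal (singleMinded S w) sel - q sel) :
    q sel ≤ indirectUtility q S (2 * w) - 2 * indirectUtility q S w := by
  have : Nonempty (PMF (Finset (Fin n))) := ⟨sel⟩
  have h1 : indirectUtility q S w ≤ lotVal (singleMinded S w) sel - q sel := ciSup_le hsel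
  have h2 := lotVal_sub_le_indirectUtility S hq (mul_nonneg zero_le_two hw) sel
  rw [lotVal_singleMinded] at h1 h2
  linarith

/-- The bound of `price_le_of_optimal` at value `2 ^ j * w`, relative to twice that value. -/
noncomputable def priceBound (q : PMF (Finset (Fin n)) → ℝ) (S : Finset (Fin n)) (w : ℝ)
    (j : ℕ) : ℝ :=
  indirectUtility q S (2 ^ (j + 1) * w) / (2 ^ (j + 1) * w) -
    indirectUtility q S (2 ^ j * w) / (2 ^ j * w)

theorem mul_priceBound (hw : 0 < w) (j : ℕ) :
    2 ^ (j + 1) * w * priceBound q S w j =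
      indirectUtility q S (2 * (2 ^ j * w)) - 2 * indirectUtility q S (2 ^ j * w) := by
  rw [priceBound, show (2 : ℝ) ^ (j + 1) * w = 2 * (2 ^ j * w) by ring]
  field_simp

theorem priceBound_nonneg (hq : ∀ lam, 0 ≤ q lam) (hw : 0 < w) (j : ℕ) :
    0 ≤ priceBound q S w j := by
  have h := two_mul_indirectUtility_le S hq (w := 2 ^ j * w) (by positivity)
  refine nonneg_of_mul_nonneg_right (a := 2 ^ (j + 1) * w) ?_ (by positivity)
  rw [mul_priceBound S hw]
  linarith

theorem sum_priceBound_le_one (hq : ∀ lam, 0 ≤ q lam) (hq0 : q (PMF.pure ∅) = 0) (hw : 0 < w)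
    (l : ℕ) : ∑ j : Fin l, priceBound q S w j ≤ 1 := by
  rw [Fin.sum_univ_eq_sum_range fun j => priceBound q S w j]
  unfold priceBound
  rw [sum_range_sub fun j => indirectUtility q S (2 ^ j * w) / (2 ^ j * w)]
  have h1 : indirectUtility q S (2 ^ l * w) / (2 ^ l * w) ≤ 1 :=
    div_le_one_of_le₀ (indirectUtility_le S hq (by positivity)) (by positivity)
  have h0 : 0 ≤ indirectUtility q S (2 ^ 0 * w) / (2 ^ 0 * w) :=
    div_nonneg (indirectUtility_nonneg S hq hq0 (by positivity)) (by positivity)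
  linarith

end IndirectUtility

/-- A single-minded buyer who strictly prefers buying the demand set pays exactly its price. -/
theorem price_eq_of_optimal {n : ℕ} {p : Finset (Fin n) → ℝ} (hp : ∀ S, 0 ≤ p S)
    (hmono : ∀ S T, S ⊆ T → p S ≤ p T) {S T : Finset (Fin n)} {w : ℝ} (hw : p S < w)
    (hT : ∀ U, singleMinded S w U - p U ≤ singleMinded S w T - p T) : p T = p S := by
  have h := hT S
  by_cases hST : S ⊆ T
  · simp only [singleMinded, subset_rfl, hST, if_true] at h
    exact le_antisymm (by linarith) (hmono S T hST)
  · simp only [singleMinded, subset_rfl, hST, if_true, if_false] at h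
    linarith [hp T]

theorem exists_prime_of_sixteen_le {t : ℕ} (ht : 16 ≤ t) :
    ∃ r : ℕ, r.Prime ∧ r ≤ t ^ 3 ∧ t ^ 3 < 2 * r := by
  have h : 16 ^ 3 ≤ t ^ 3 := Nat.pow_le_pow_left ht 3
  obtain ⟨r, hr, h1, h2⟩ := Nat.exists_prime_lt_and_le_two_mul (t ^ 3 / 2) (by omega)
  exact ⟨r, hr, by omega, by omega⟩

theorem card_lt_exp {t l r : ℕ} {x c : ℝ} (ht : 16 ≤ t) (hl : 0 < l) (hlt : l ≤ t) (hr : 4 ≤ r)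
    (hx : x < t + 1) (hc : c ≤ 2 ^ ((2 : ℝ) ^ (x / 16))) :
    c < Real.exp ((r ^ t : ℕ) / l) := by
  have hl' : (0 : ℝ) < l := by exact_mod_cast hl
  have ht' : (16 : ℝ) ≤ t := by exact_mod_cast ht
  have h1 : (2 : ℝ) ^ (x / 16) ≤ 2 ^ t := by
    rw [← Real.rpow_natCast]
    exact Real.rpow_le_rpow_of_exponent_le one_le_two (by linarith)
  have h2 : (2 : ℝ) ^ t ≤ (r ^ t : ℕ) / l := by
    rw [le_div_iff₀ hl']
    have : 2 ^ t * l ≤ r ^ t := calc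
      2 ^ t * l ≤ 2 ^ t * 2 ^ t := by
        gcongr
        exact hlt.trans Nat.lt_two_pow_self.le
      _ = 4 ^ t := by rw [← mul_pow]; norm_num
      _ ≤ r ^ t := Nat.pow_le_pow_left hr t
    exact_mod_cast this
  have h3 : (0 : ℝ) < 2 ^ (x / 16) := by positivity
  refine hc.trans_lt ?_
  rw [Real.rpow_def_of_pos two_pos]
  refine Real.exp_lt_exp.2 (lt_of_lt_of_le ?_ (h1.trans h2))
  exact mul_lt_of_lt_one_left h3 (Real.log_two_lt_d9.trans (by norm_num))

/-- for all large `n`, for every family `Q` of lottery-pricing mechanisms with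
`|Q| ≤ 2^{2^{n^{1/6}/16}}`, there is a distribution `D` over single-minded valuations and a
monotone submodular deterministic pricing `p` such that every `q ∈ Q` (under any
buyer-optimal purchasing) satisfies `Rev_D(p) ≥ (log₂ n / C)·Rev_D(q)`, for an absolute
constant `C`. -/
theorem lb_single_minded :
    ∃ C : ℝ, 0 < C ∧ ∃ n₀ : ℕ, ∀ n : ℕ, n₀ ≤ n →
      ∀ Q : Set (PMF (Finset (Fin n)) → ℝ), Q.Finite →
        (∀ q ∈ Q, (∀ lam, 0 ≤ q lam) ∧ q (PMF.pure ∅) = 0) →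
        (Q.ncard : ℝ) ≤ 2 ^ ((2 : ℝ) ^ ((n : ℝ) ^ ((1 : ℝ) / 6) / 16)) →
        ∃ (K : ℕ) (_ : 0 < K) (dem : Fin K → Finset (Fin n)) (wval wt : Fin K → ℝ)
          (p : Finset (Fin n) → ℝ),
          (∀ i, (dem i).Nonempty ∧ 0 ≤ wval i) ∧
          (∀ i, 0 ≤ wt i) ∧ (∑ i, wt i) = 1 ∧
          (∀ S, 0 ≤ p S) ∧ p ∅ = 0 ∧
          (∀ S T : Finset (Fin n), S ⊆ T → p S ≤ p T) ∧
          (∀ S T : Finset (Fin n), p (S ∪ T) + p (S ∩ T) ≤ p S + p T) ∧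
          ∀ selp : Fin K → Finset (Fin n),
            (∀ i, ∀ T : Finset (Fin n),
              singleMinded (dem i) (wval i) T - p T ≤
                singleMinded (dem i) (wval i) (selp i) - p (selp i)) →
            ∀ q ∈ Q, ∀ selq : Fin K → PMF (Finset (Fin n)),
              (∀ i, ∀ lam : PMF (Finset (Fin n)),
                lotVal (singleMinded (dem i) (wval i)) lam - q lam ≤
                  lotVal (singleMinded (dem i) (wval i)) (selq i) - q (selq i)) →
              (Real.logb 2 n / C) * (∑ i, wt i * q (selq i)) ≤ ∑ i, wt i * p (selp i) := by
  refine ⟨720, by norm_num, 16 ^ 6, fun n hn Q hQfin hQ hQcard => ?_⟩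
  classical
  set x : ℝ := (n : ℝ) ^ ((1 : ℝ) / 6) with hx
  have hx0 : 0 ≤ x := by positivity
  have hx6 : x ^ 6 = n := by
    rw [hx, ← Real.rpow_natCast, ← Real.rpow_mul (Nat.cast_nonneg n)]
    norm_num
  set t : ℕ := ⌊x⌋₊ with ht
  have htx : (t : ℝ) ≤ x := Nat.floor_le hx0
  have hxt : x < t + 1 := Nat.lt_floor_add_one x
  have ht16 : 16 ≤ t := by
    refine Nat.le_floor ?_
    refine le_of_pow_le_pow_left₀ (n := 6) (by norm_num) hx0 ?_
    rw [hx6]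
    exact_mod_cast hn
  have htn : t ^ 6 ≤ n := by
    have : (t : ℝ) ^ 6 ≤ n := hx6 ▸ pow_le_pow_left₀ (Nat.cast_nonneg t) htx 6
    exact_mod_cast this
  obtain ⟨l, hl1, hlt, htl⟩ : ∃ l, 1 ≤ l ∧ 2 ^ (l + 3) ≤ t ∧ t < 2 ^ (l + 4) := by
    have h4 : 4 ≤ Nat.log 2 t := Nat.le_log_of_pow_le one_lt_two ht16
    refine ⟨Nat.log 2 t - 3, by omega, ?_, ?_⟩
    · rw [Nat.sub_add_cancel (by omega)]
      exact Nat.pow_log_le_self 2 (by omega)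
    · rw [show Nat.log 2 t - 3 + 4 = Nat.log 2 t + 1 by omega]
      exact Nat.lt_pow_succ_log_self one_lt_two t
  have hlog : Real.logb 2 n ≤ 30 * l := by
    have hnpos : (0 : ℝ) < n := by
      have : 0 < n := lt_of_lt_of_le (by norm_num) hn
      exact_mod_cast this
    rw [Real.logb_le_iff_le_rpow one_lt_two hnpos]
    have h1 : x ≤ 2 ^ (l + 4) := hxt.le.trans (by exact_mod_cast htl)
    have h2 : (n : ℝ) ≤ (2 ^ (l + 4)) ^ 6 := hx6 ▸ pow_le_pow_left₀ hx0 h1 6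
    refine h2.trans ?_
    rw [← pow_mul, show (30 : ℝ) * l = ((30 * l : ℕ) : ℝ) by push_cast; ring, Real.rpow_natCast]
    exact pow_le_pow_right₀ one_le_two (by omega)
  obtain ⟨r, hrp, hr1, hr2⟩ := exists_prime_of_sixteen_le ht16
  have : Fact r.Prime := ⟨hrp⟩
  have hrn : r * r ≤ n := (Nat.mul_le_mul hr1 hr1).trans (by rwa [← pow_add])
  have hr4 : 4 ≤ r := by
    have : 16 ^ 3 ≤ t ^ 3 := Nat.pow_le_pow_left ht16 3
    omega
  obtain ⟨A, hAcard, hAinter⟩ := exists_finset_family_small_inter hrn t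
  set τ : ℕ := 2 ^ (l + 1) with hτ
  have hτpos : 0 < τ := by positivity
  have hτt : 4 * τ ≤ t := le_trans (by rw [hτ]; ring_nf; rfl) hlt
  have hτr : 4 * τ * τ * t ≤ r := by
    have h : (4 * τ) * (4 * τ) * t ≤ t ^ 3 := by
      rw [pow_succ, pow_two]
      gcongr
    have : (4 * τ) * (4 * τ) * t = 4 * (4 * τ * τ * t) := by ring
    omega
  set L : ℝ := 4 * τ * t with hL
  have htpos : (0 : ℝ) < t := by
    have : 0 < t := by omega
    exact_mod_cast this
  have hLpos : 0 < L := by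
    have : (0 : ℝ) < τ := by exact_mod_cast hτpos
    positivity
  set w : ℝ := 2 * L with hw
  have hwpos : 0 < w := by positivity
  have hQcard' : (#hQfin.toFinset : ℝ) < Real.exp ((r ^ t : ℕ) / l) := by
    rw [← Set.ncard_eq_toFinset_card Q hQfin]
    exact card_lt_exp ht16 hl1
      (by have := (Nat.lt_two_pow_self (n := l + 3)).le.trans hlt; omega) hr4 hxt hQcard
  obtain ⟨s, hs⟩ := exists_assignment_sum_le hl1 hQfin.toFinset
    (fun q i (j : Fin l) => priceBound q (A i) w j)
    (fun q hq i j => priceBound_nonneg (A i) (hQ q (hQfin.mem_toFinset.1 hq)).1 hwpos j)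
    (fun q hq i => sum_priceBound_le_one (A i) (hQ q (hQfin.mem_toFinset.1 hq)).1
      (hQ q (hQfin.mem_toFinset.1 hq)).2 hwpos l) hQcard'
  obtain ⟨p, hp0, hpe, hpmono, hpsub, hpA⟩ := exists_monotone_submodular_near A
    (fun i => 2 ^ (s i : ℕ) * L) hτpos hAinter (fun i => by rw [hAcard]; exact hτr)
    (fun i => le_mul_of_one_le_left hLpos.le (one_le_pow₀ one_le_two))
    (fun i => by
      have h : (2 : ℝ) ^ (s i : ℕ) * 2 ≤ τ := by
        rw [hτ, ← pow_succ]
        push_cast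
        exact pow_le_pow_right₀ one_le_two (by have := (s i).2; omega)
      calc (2 : ℝ) ^ (s i : ℕ) * L = 2 ^ (s i : ℕ) * 2 * (2 * τ * t) := by rw [hL]; ring
        _ ≤ τ * (2 * τ * t) := by gcongr
        _ = _ := by ring)
  have hK : 0 < r ^ t := Nat.pow_pos (by omega)
  have : Nonempty (Fin (r ^ t)) := ⟨⟨0, hK⟩⟩
  set W : ℝ := ∑ i, ((2 : ℝ) ^ (s i : ℕ))⁻¹ with hW
  have hWpos : 0 < W := sum_pos (fun i _ => by positivity) univ_nonempty
  refine ⟨r ^ t, hK, A, fun i => 2 ^ (s i : ℕ) * w, fun i => ((2 : ℝ) ^ (s i : ℕ))⁻¹ / W, p,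
    fun i => ⟨card_pos.1 (by rw [hAcard]; omega), by positivity⟩, fun i => by positivity,
    by rw [← sum_div, div_self hWpos.ne'], hp0, hpe, hpmono, hpsub, ?_⟩
  intro selp hselp q hq selq hselq
  have hlpos : (0 : ℝ) < l := by exact_mod_cast hl1
  have hrevp : (r ^ t : ℕ) * (w / 4) / W ≤ ∑ i, ((2 : ℝ) ^ (s i : ℕ))⁻¹ / W * p (selp i) := by
    calc (r ^ t : ℕ) * (w / 4) / W = ∑ _i : Fin (r ^ t), w / 4 / W := by
          rw [sum_const, card_univ, Fintype.card_fin, nsmul_eq_mul]; ring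
      _ ≤ _ := by
          refine sum_le_sum fun i _ => ?_
          have h2 : (0 : ℝ) < 2 ^ (s i : ℕ) := by positivity
          have hlt : p (A i) < 2 ^ (s i : ℕ) * w := (hpA i).2.trans_lt (by rw [hw]; nlinarith)
          rw [price_eq_of_optimal hp0 hpmono hlt (hselp i)]
          calc w / 4 / W = ((2 : ℝ) ^ (s i : ℕ))⁻¹ / W * (2 ^ (s i : ℕ) * L / 2) := by
                rw [hw]; field_simp; ring
            _ ≤ _ := by gcongr; exact (hpA i).1
  have hrevq : ∑ i, ((2 : ℝ) ^ (s i : ℕ))⁻¹ / W * q (selq i) ≤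
      2 * w / W * (3 * ((r ^ t : ℕ) / l)) := by
    calc _ ≤ ∑ i, 2 * w / W * priceBound q (A i) w (s i) := by
          refine sum_le_sum fun i _ => ?_
          have h := price_le_of_optimal (A i) (hQ q hq).1 (by positivity) (hselq i)
          rw [← mul_priceBound (A i) hwpos] at h
          calc _ ≤ ((2 : ℝ) ^ (s i : ℕ))⁻¹ / W *
                (2 ^ ((s i : ℕ) + 1) * w * priceBound q (A i) w (s i)) := by gcongr
            _ = _ := by rw [pow_succ]; field_simp
      _ = 2 * w / W * ∑ i, priceBound q (A i) w (s i) := by rw [mul_sum]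
      _ ≤ _ := by
          gcongr
          exact hs q (hQfin.mem_toFinset.2 hq)
  have hrev0 : 0 ≤ ∑ i, ((2 : ℝ) ^ (s i : ℕ))⁻¹ / W * q (selq i) :=
    sum_nonneg fun i _ => mul_nonneg (by positivity) ((hQ q hq).1 _)
  calc _ ≤ 30 * l / 720 * (2 * w / W * (3 * ((r ^ t : ℕ) / l))) := by gcongr
    _ = (r ^ t : ℕ) * (w / 4) / W := by field_simp; ring
    _ ≤ _ := hrevp
end

section
/- For all sufficiently large n the following holds. There exists a distribution D over additive valuations on n items and a monotone subadditive deterministic pricing p : 2^[n] → ℝ≥0 such that for every family Q of pricings of lotteries with |Q| ≤ 2^{2^{n^{1/6}/16}} (assuming buyer-optimal lotteries exist under each q ∈ Q for each valuation in the support of D), every q ∈ Q satisfies Rev_D(p) ≥ (log₂ n / C)·Rev_D(q), where C is an absolute constant. That is, no family of mechanisms of description complexity 2^{o(n^{1/6})} bits can obtain a o(log n) fraction of the optimal deterministic Sybil-proof revenue, even for additive buyers. -/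
/-- The additive valuation with item values `w`. -/
def additiveVal {n : ℕ} (w : Fin n → ℝ) : Finset (Fin n) → ℝ :=
  fun T => ∑ i ∈ T, w i

/-- The best utility, per unit of scale, of a buyer whose value for the lottery `lam` is
`2 ^ t * x lam` under the pricing `q`. -/
noncomputable def scaledUtility {α : Type*} (x q : α → ℝ) (t : ℕ) : ℝ :=
  ⨆ lam, (x lam - q lam / 2 ^ t)

section ScaledUtility

variable {α : Type*} {x q : α → ℝ}

lemma le_scaledUtility (hx : ∀ a, x a ≤ 1) (hq : ∀ a, 0 ≤ q a) (t : ℕ) (a : α) :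
    x a - q a / 2 ^ t ≤ scaledUtility x q t := by
  refine le_ciSup (f := fun a => x a - q a / 2 ^ t) ⟨1, ?_⟩ a
  rintro _ ⟨b, rfl⟩
  have h : 0 ≤ q b / 2 ^ t := div_nonneg (hq b) (by positivity)
  have := hx b
  dsimp only
  linarith

lemma scaledUtility_le_one [Nonempty α] (hx : ∀ a, x a ≤ 1) (hq : ∀ a, 0 ≤ q a) (t : ℕ) :
    scaledUtility x q t ≤ 1 := by
  refine ciSup_le fun b => ?_
  have h : 0 ≤ q b / 2 ^ t := div_nonneg (hq b) (by positivity)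
  have := hx b
  linarith

lemma scaledUtility_mono [Nonempty α] (hx : ∀ a, x a ≤ 1) (hq : ∀ a, 0 ≤ q a) :
    Monotone (scaledUtility x q) := by
  refine monotone_nat_of_le_succ fun t => ciSup_le fun a => ?_
  refine le_trans ?_ (le_scaledUtility hx hq (t + 1) a)
  have : q a / 2 ^ (t + 1) ≤ q a / 2 ^ t :=
    div_le_div_of_nonneg_left (hq a) (by positivity)
      (pow_le_pow_right₀ (by norm_num) (Nat.le_succ t))
  linarith

/-- The price paid at scale `2 ^ t` is controlled by the growth of the scaled utility. -/
lemma price_le_scaledUtility_sub (hx : ∀ a, x a ≤ 1) (hq : ∀ a, 0 ≤ q a) (t : ℕ) (a : α)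
    (ha : ∀ b, 2 ^ t * x b - q b ≤ 2 ^ t * x a - q a) :
    q a / 2 ^ t ≤ 2 * (scaledUtility x q (t + 1) - scaledUtility x q t) := by
  have : Nonempty α := ⟨a⟩
  have h1 := le_scaledUtility hx hq (t + 1) a
  have h2 : scaledUtility x q t ≤ x a - q a / 2 ^ t := by
    refine ciSup_le fun b => ?_
    have hp : (0 : ℝ) < 2 ^ t := by positivity
    have e : ∀ c, x c - q c / 2 ^ t = (2 ^ t * x c - q c) / 2 ^ t := fun c => by field_simp
    rw [e, e]
    exact div_le_div_of_nonneg_right (ha b) hp.le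
  have h3 : q a / 2 ^ (t + 1) = q a / 2 ^ t / 2 := by rw [pow_succ]; field_simp
  rw [h3] at h1
  linarith

end ScaledUtility

lemma Real.exp_le_one_add_two_mul {x : ℝ} (h0 : 0 ≤ x) (h1 : x ≤ 1) :
    Real.exp x ≤ 1 + 2 * x := by
  have h := Real.abs_exp_sub_one_sub_id_le (x := x) (by rw [abs_of_nonneg h0]; exact h1)
  have := (abs_le.1 h).2
  nlinarith

/-- Exponential moments and a union bound over a random choice of one level per index. -/
lemma exists_choice_forall_sum_le {ι κ α : Type*} [Fintype ι] [DecidableEq ι] [Fintype κ]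
    [Nonempty κ] (A : Finset α) (X : α → ι → κ → ℝ)
    (hX0 : ∀ a ∈ A, ∀ j t, 0 ≤ X a j t) (hX1 : ∀ a ∈ A, ∀ j t, X a j t ≤ 1)
    (hXs : ∀ a ∈ A, ∀ j, ∑ t, X a j t ≤ 1)
    (hA : (A.card : ℝ) < Real.exp (Fintype.card ι / Fintype.card κ)) :
    ∃ t : ι → κ, ∀ a ∈ A,
      ∑ j, X a j (t j) ≤ 3 * (Fintype.card ι / Fintype.card κ : ℝ) := by
  by_contra! hcon
  set m : ℝ := (Fintype.card ι : ℝ) with hm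
  set L : ℝ := (Fintype.card κ : ℝ) with hL
  have hLpos : 0 < L := by rw [hL]; exact_mod_cast Fintype.card_pos
  have lower : L ^ Fintype.card ι * Real.exp (3 * (m / L)) ≤
      ∑ t : ι → κ, ∑ a ∈ A, Real.exp (∑ j, X a j (t j)) := by
    have : ∑ _t : ι → κ, Real.exp (3 * (m / L)) = L ^ Fintype.card ι * Real.exp (3 * (m / L)) := by
      simp [hL]
    rw [← this]
    refine Finset.sum_le_sum fun t _ => ?_
    obtain ⟨a, ha, hlt⟩ := hcon t
    refine le_trans (Real.exp_le_exp.2 hlt.le) ?_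
    exact Finset.single_le_sum (f := fun a => Real.exp (∑ j, X a j (t j)))
      (fun b _ => (Real.exp_pos _).le) ha
  have upper : ∑ t : ι → κ, ∑ a ∈ A, Real.exp (∑ j, X a j (t j)) ≤
      A.card * (L ^ Fintype.card ι * Real.exp (2 * (m / L))) := by
    rw [Finset.sum_comm, ← nsmul_eq_mul]
    refine Finset.sum_le_card_nsmul _ _ _ fun a ha => ?_
    have e : ∑ t : ι → κ, Real.exp (∑ j, X a j (t j)) = ∏ j, ∑ s, Real.exp (X a j s) := by
      simp only [Real.exp_sum]
      exact (Fintype.prod_sum fun j s => Real.exp (X a j s)).symm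
    rw [e]
    have hj : ∀ j, ∑ s, Real.exp (X a j s) ≤ L * Real.exp (2 / L) := by
      intro j
      calc ∑ s, Real.exp (X a j s) ≤ ∑ s, (1 + 2 * X a j s) :=
            Finset.sum_le_sum fun s _ =>
              Real.exp_le_one_add_two_mul (hX0 a ha j s) (hX1 a ha j s)
        _ = L + 2 * ∑ s, X a j s := by
            rw [Finset.sum_add_distrib, ← Finset.mul_sum]; simp [hL]
        _ ≤ L + 2 := by linarith [hXs a ha j]
        _ = L * (2 / L + 1) := by field_simp; ring
        _ ≤ L * Real.exp (2 / L) :=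
            mul_le_mul_of_nonneg_left (Real.add_one_le_exp _) hLpos.le
    calc ∏ j, ∑ s, Real.exp (X a j s) ≤ ∏ _j : ι, L * Real.exp (2 / L) :=
          Finset.prod_le_prod (fun j _ => Finset.sum_nonneg fun s _ => (Real.exp_pos _).le)
            fun j _ => hj j
      _ = L ^ Fintype.card ι * Real.exp (2 * (m / L)) := by
          rw [Finset.prod_const, mul_pow, ← Real.exp_nat_mul, Finset.card_univ]
          congr 2
          rw [hm]; ring
  have key := lower.trans upper
  have hpow : 0 < L ^ Fintype.card ι := by positivity
  have h3 : Real.exp (3 * (m / L)) = Real.exp (m / L) * Real.exp (2 * (m / L)) := by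
    rw [← Real.exp_add]; ring_nf
  rw [h3] at key
  have : L ^ Fintype.card ι * Real.exp (2 * (m / L)) * Real.exp (m / L) ≤
      L ^ Fintype.card ι * Real.exp (2 * (m / L)) * A.card := by linarith
  have := le_of_mul_le_mul_left this (by positivity)
  linarith

lemma additiveVal_biUnion_le {n : ℕ} {ι : Type*} {S : ι → Finset (Fin n)} {w : Fin n → ℝ}
    (hw : ∀ x, 0 ≤ w x) (I : Finset ι) :
    additiveVal w (I.biUnion S) ≤ ∑ i ∈ I, additiveVal w (S i) := by
  classical
  induction I using Finset.induction_on with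
  | empty => simp [additiveVal]
  | insert i I hi ih =>
    rw [Finset.sum_insert hi, Finset.biUnion_insert]
    refine le_trans ?_ (add_le_add_right ih _)
    unfold additiveVal
    rw [← Finset.sum_union_inter]
    exact le_add_of_nonneg_right (Finset.sum_nonneg fun x _ => hw x)

section CoverPrice

variable {n : ℕ} {ι : Type*} [Fintype ι]

/-- The cheapest way to obtain `T` by buying sets `S i` at prices `c i` and single items at
price `M`. -/
noncomputable def coverPrice (S : ι → Finset (Fin n)) (c : ι → ℝ) (M : ℝ)
    (T : Finset (Fin n)) : ℝ :=
  Finset.univ.inf' Finset.univ_nonempty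
    fun I : Finset ι => ∑ i ∈ I, c i + M * ((T \ I.biUnion S).card : ℝ)

variable {S : ι → Finset (Fin n)} {c : ι → ℝ} {M : ℝ}

lemma coverPrice_le (T : Finset (Fin n)) (I : Finset ι) :
    coverPrice S c M T ≤ ∑ i ∈ I, c i + M * ((T \ I.biUnion S).card : ℝ) :=
  Finset.inf'_le _ (Finset.mem_univ I)

lemma exists_coverPrice_eq (T : Finset (Fin n)) :
    ∃ I : Finset ι, coverPrice S c M T = ∑ i ∈ I, c i + M * ((T \ I.biUnion S).card : ℝ) := by
  obtain ⟨I, -, hI⟩ := Finset.exists_mem_eq_inf' (Finset.univ_nonempty (α := Finset ι))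
    fun I : Finset ι => ∑ i ∈ I, c i + M * ((T \ I.biUnion S).card : ℝ)
  exact ⟨I, hI⟩

lemma coverPrice_nonneg (hc : ∀ i, 0 ≤ c i) (hM : 0 ≤ M) (T : Finset (Fin n)) :
    0 ≤ coverPrice S c M T := by
  obtain ⟨I, hI⟩ := exists_coverPrice_eq (S := S) (c := c) (M := M) T
  rw [hI]
  have := Finset.sum_nonneg fun i (_ : i ∈ I) => hc i
  positivity

lemma coverPrice_empty (hc : ∀ i, 0 ≤ c i) (hM : 0 ≤ M) : coverPrice S c M ∅ = 0 :=
  le_antisymm (by simpa using coverPrice_le (S := S) (c := c) (M := M) ∅ ∅)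
    (coverPrice_nonneg hc hM _)

lemma coverPrice_mono (hM : 0 ≤ M) {T U : Finset (Fin n)} (h : T ⊆ U) :
    coverPrice S c M T ≤ coverPrice S c M U := by
  obtain ⟨I, hI⟩ := exists_coverPrice_eq (S := S) (c := c) (M := M) U
  rw [hI]
  refine (coverPrice_le T I).trans ?_
  gcongr

lemma coverPrice_union_le [DecidableEq ι] (hc : ∀ i, 0 ≤ c i) (hM : 0 ≤ M) (T U : Finset (Fin n)) :
    coverPrice S c M (T ∪ U) ≤ coverPrice S c M T + coverPrice S c M U := by
  obtain ⟨I, hI⟩ := exists_coverPrice_eq (S := S) (c := c) (M := M) T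
  obtain ⟨J, hJ⟩ := exists_coverPrice_eq (S := S) (c := c) (M := M) U
  rw [hI, hJ]
  refine (coverPrice_le (T ∪ U) (I ∪ J)).trans ?_
  have h1 : ∑ i ∈ I ∪ J, c i ≤ ∑ i ∈ I, c i + ∑ i ∈ J, c i := by
    rw [← Finset.sum_union_inter]
    linarith [Finset.sum_nonneg fun i (_ : i ∈ I ∩ J) => hc i]
  have h2 : (((T ∪ U) \ (I ∪ J).biUnion S).card : ℝ) ≤
      ((T \ I.biUnion S).card : ℝ) + ((U \ J.biUnion S).card : ℝ) := by
    rw [← Nat.cast_add]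
    refine Nat.cast_le.2 (le_trans (Finset.card_le_card ?_) (Finset.card_union_le _ _))
    intro x
    simp only [Finset.mem_sdiff, Finset.mem_union, Finset.mem_biUnion]
    grind
  nlinarith

/-- A buyer who gains from the set `S j`, but for whom every other `S i` and every single item
costs at least its value, only buys sets costing at least `c j`. -/
lemma le_coverPrice_of_optimal {w : Fin n → ℝ} (hw : ∀ x, 0 ≤ w x) (hc : ∀ i, 0 ≤ c i)
    (hM : 0 ≤ M) (j : ι) (hgain : c j < additiveVal w (S j))
    (hother : ∀ i, i ≠ j → additiveVal w (S i) ≤ c i) (hitem : ∀ x, w x ≤ M)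
    (T : Finset (Fin n))
    (hT : additiveVal w (S j) - coverPrice S c M (S j) ≤
      additiveVal w T - coverPrice S c M T) :
    c j ≤ coverPrice S c M T := by
  obtain ⟨I, hI⟩ := exists_coverPrice_eq (S := S) (c := c) (M := M) T
  have hj : coverPrice S c M (S j) ≤ c j := by
    simpa using coverPrice_le (S := S) (c := c) (M := M) (S j) {j}
  have hmem : j ∈ I := by
    by_contra hjI
    have h1 : additiveVal w T ≤
        additiveVal w (I.biUnion S) + additiveVal w (T \ I.biUnion S) := by
      unfold additiveVal
      rw [← Finset.sum_union Finset.disjoint_sdiff]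
      refine Finset.sum_le_sum_of_subset_of_nonneg ?_ fun x _ _ => hw x
      intro x hx
      by_cases h : x ∈ I.biUnion S <;> simp [hx, h]
    have h2 : additiveVal w (I.biUnion S) ≤ ∑ i ∈ I, additiveVal w (S i) :=
      additiveVal_biUnion_le hw I
    have h3 : ∑ i ∈ I, additiveVal w (S i) ≤ ∑ i ∈ I, c i :=
      Finset.sum_le_sum fun i hi => hother i fun h => hjI (h ▸ hi)
    have h4 : additiveVal w (T \ I.biUnion S) ≤ M * ((T \ I.biUnion S).card : ℝ) := by
      unfold additiveVal
      rw [mul_comm, ← nsmul_eq_mul]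
      exact Finset.sum_le_card_nsmul _ _ _ fun x _ => hitem x
    linarith
  rw [hI]
  have h5 : c j ≤ ∑ i ∈ I, c i := Finset.single_le_sum (fun i _ => hc i) hmem
  have h6 : 0 ≤ M * ((T \ I.biUnion S).card : ℝ) := by positivity
  linarith

end CoverPrice

/-- Graphs of polynomials of degree less than `d` over a prime field, as subsets of `Fin n`. -/
lemma exists_almost_disjoint_family {n r d : ℕ} (hr : r.Prime) (hn : r * r ≤ n) :
    ∃ S : Fin (r ^ d) → Finset (Fin n),
      (∀ j, (S j).card = r) ∧ ∀ i j, i ≠ j → (S i ∩ S j).card ≤ d := by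
  classical
  have : Fact r.Prime := ⟨hr⟩
  have hcard : Fintype.card (ZMod r × ZMod r) ≤ Fintype.card (Fin n) := by
    simpa [Fintype.card_prod, ZMod.card] using hn
  obtain ⟨e⟩ := Function.Embedding.nonempty_of_card_le hcard
  have hcardeq : Fintype.card (Fin (r ^ d)) = Fintype.card (Fin d → ZMod r) := by
    simp [ZMod.card]
  let f := Fintype.equivOfCardEq hcardeq
  let P : (Fin d → ZMod r) → Polynomial (ZMod r) := fun a =>
    ((Polynomial.degreeLTEquiv (ZMod r) d).symm a : Polynomial.degreeLT (ZMod r) d)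
  have hPinj : Function.Injective P := fun a b h =>
    (Polynomial.degreeLTEquiv (ZMod r) d).symm.injective (Subtype.ext h)
  have hPdeg : ∀ a, (P a).degree < d := fun a =>
    Polynomial.mem_degreeLT.1 ((Polynomial.degreeLTEquiv (ZMod r) d).symm a).2
  let G : Fin (r ^ d) → ZMod r ↪ Fin n := fun j =>
    ⟨fun x => e (x, (P (f j)).eval x), fun x y h => (Prod.ext_iff.1 (e.injective h)).1⟩
  refine ⟨fun j => Finset.univ.map (G j), fun j => by simp [ZMod.card], fun i j hij => ?_⟩
  have hne : P (f i) - P (f j) ≠ 0 := sub_ne_zero.2 fun h => hij (f.injective (hPinj h))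
  have hsub : Finset.univ.map (G i) ∩ Finset.univ.map (G j) ⊆
      (P (f i) - P (f j)).roots.toFinset.map (G i) := by
    intro x hx
    simp only [Finset.mem_inter, Finset.mem_map, Finset.mem_univ, true_and] at hx
    obtain ⟨⟨a, rfl⟩, b, hb⟩ := hx
    have hab := Prod.ext_iff.1 (e.injective hb)
    have h1 : b = a := hab.1
    have h2 : (P (f j)).eval b = (P (f i)).eval a := hab.2
    refine Finset.mem_map_of_mem _ ?_
    rw [Multiset.mem_toFinset, Polynomial.mem_roots hne, Polynomial.IsRoot.def,
      Polynomial.eval_sub, ← h2, h1, sub_self]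
  refine (Finset.card_le_card hsub).trans ?_
  rw [Finset.card_map]
  refine (Multiset.toFinset_card_le _).trans ?_
  have h1 : ((P (f i) - P (f j)).roots.card : WithBot ℕ) ≤ (P (f i) - P (f j)).degree :=
    Polynomial.card_roots hne
  have h2 : (P (f i) - P (f j)).degree < d :=
    (Polynomial.degree_sub_le _ _).trans_lt (max_lt (hPdeg _) (hPdeg _))
  exact_mod_cast (h1.trans_lt h2).le

lemma lotVal_additiveVal_const_mul {n : ℕ} (c : ℝ) (w : Fin n → ℝ)
    (lam : PMF (Finset (Fin n))) :
    lotVal (additiveVal fun x => c * w x) lam = c * lotVal (additiveVal w) lam := by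
  simp only [lotVal, additiveVal, Finset.mul_sum]
  refine Finset.sum_congr rfl fun T _ => Finset.sum_congr rfl fun x _ => by ring

lemma lotVal_le_of_forall_le {n : ℕ} {v : Finset (Fin n) → ℝ} {B : ℝ} (hv : ∀ T, v T ≤ B)
    (lam : PMF (Finset (Fin n))) : lotVal v lam ≤ B := by
  have hsum : ∑ T, (lam T).toReal = 1 := by
    have h := lam.tsum_coe
    rw [tsum_fintype] at h
    rw [← ENNReal.toReal_sum fun T _ => lam.apply_ne_top T, h, ENNReal.toReal_one]
  calc lotVal v lam ≤ ∑ T, (lam T).toReal * B :=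
        Finset.sum_le_sum fun T _ => mul_le_mul_of_nonneg_left (hv T) ENNReal.toReal_nonneg
    _ = B := by rw [← Finset.sum_mul, hsum, one_mul]

/-- The valuation spreading a total value of one evenly over `S`. -/
noncomputable def uniformValue {n : ℕ} (S : Finset (Fin n)) (x : Fin n) : ℝ :=
  if x ∈ S then (S.card : ℝ)⁻¹ else 0

section UniformValue

variable {n : ℕ} (S : Finset (Fin n))

lemma uniformValue_nonneg (x : Fin n) : 0 ≤ uniformValue S x := by
  unfold uniformValue; split_ifs <;> positivity

lemma uniformValue_le_one (x : Fin n) : uniformValue S x ≤ 1 := by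
  unfold uniformValue
  split_ifs
  · exact Nat.cast_inv_le_one _
  · exact zero_le_one

lemma additiveVal_mul_uniformValue (c : ℝ) (T : Finset (Fin n)) :
    additiveVal (fun x => c * uniformValue S x) T = c * ((T ∩ S).card / S.card) := by
  simp only [additiveVal, uniformValue, ← Finset.mul_sum]
  rw [← Finset.sum_filter, Finset.filter_mem_eq_inter, Finset.sum_const, nsmul_eq_mul,
    div_eq_mul_inv]

lemma lotVal_uniformValue_le_one (lam : PMF (Finset (Fin n))) :
    lotVal (additiveVal (uniformValue S)) lam ≤ 1 := by
  refine lotVal_le_of_forall_le (fun T => ?_) lam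
  have h := additiveVal_mul_uniformValue S 1 T
  simp only [one_mul] at h
  rw [h]
  exact div_le_one_of_le₀ (Nat.cast_le.2 (Finset.card_le_card Finset.inter_subset_right))
    (Nat.cast_nonneg _)

end UniformValue

/-- The revenue gap for an almost disjoint family of `m` sets and `L` value levels. -/
lemma exists_revenue_gap {n m L k d : ℕ} (hm : 0 < m) (hL : 0 < L) (hk : 0 < k)
    (S : Fin m → Finset (Fin n)) (hS : ∀ j, (S j).card = k)
    (hSS : ∀ i j, i ≠ j → (S i ∩ S j).card ≤ d) (hd : 2 ^ (L + 1) * d ≤ k)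
    (Q : Set (PMF (Finset (Fin n)) → ℝ)) (hQfin : Q.Finite)
    (hQ : ∀ q ∈ Q, (∀ lam, 0 ≤ q lam) ∧ q (PMF.pure ∅) = 0)
    (hcard : (Q.ncard : ℝ) < Real.exp (m / L)) :
    ∃ (K : ℕ) (_ : 0 < K) (w : Fin K → Fin n → ℝ) (wt : Fin K → ℝ)
      (p : Finset (Fin n) → ℝ),
      (∀ i j, 0 ≤ w i j) ∧
      (∀ i, 0 ≤ wt i) ∧ (∑ i, wt i) = 1 ∧
      (∀ S, 0 ≤ p S) ∧ p ∅ = 0 ∧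
      (∀ S T : Finset (Fin n), S ⊆ T → p S ≤ p T) ∧
      (∀ S T : Finset (Fin n), p (S ∪ T) ≤ p S + p T) ∧
      ∀ selp : Fin K → Finset (Fin n),
        (∀ i, ∀ T : Finset (Fin n),
          additiveVal (w i) T - p T ≤ additiveVal (w i) (selp i) - p (selp i)) →
        ∀ q ∈ Q, ∀ selq : Fin K → PMF (Finset (Fin n)),
          (∀ i, ∀ lam : PMF (Finset (Fin n)),
            lotVal (additiveVal (w i)) lam - q lam ≤
              lotVal (additiveVal (w i)) (selq i) - q (selq i)) →
          L * (∑ i, wt i * q (selq i)) ≤ 12 * ∑ i, wt i * p (selp i) := by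
  classical
  have : Nonempty (Fin L) := ⟨⟨0, hL⟩⟩
  have : Nonempty (PMF (Finset (Fin n))) := ⟨PMF.pure ∅⟩
  have : Nonempty (Fin m) := ⟨⟨0, hm⟩⟩
  let x : Fin m → PMF (Finset (Fin n)) → ℝ := fun j =>
    lotVal (additiveVal (uniformValue (S j)))
  have hx : ∀ j lam, x j lam ≤ 1 := fun j => lotVal_uniformValue_le_one (S j)
  have hx0 : ∀ j, x j (PMF.pure ∅) = 0 := by
    intro j
    refine Finset.sum_eq_zero fun T _ => ?_
    by_cases hT : T = ∅
    · simp [hT, additiveVal]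
    · simp [hT]
  let X : (PMF (Finset (Fin n)) → ℝ) → Fin m → Fin L → ℝ := fun q j t =>
    scaledUtility (x j) q (t + 1) - scaledUtility (x j) q t
  have hg0 : ∀ q ∈ Q, ∀ j t, 0 ≤ scaledUtility (x j) q t := by
    intro q hq j t
    have h := le_scaledUtility (hx j) (hQ q hq).1 t (PMF.pure ∅)
    rwa [hx0, (hQ q hq).2, zero_div, sub_zero] at h
  obtain ⟨t, ht⟩ := exists_choice_forall_sum_le hQfin.toFinset X
    (fun q hq j t => sub_nonneg.2
      (scaledUtility_mono (hx j) (hQ q (hQfin.mem_toFinset.1 hq)).1 (Nat.le_succ _)))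
    (fun q hq j t => by
      have hq := hQfin.mem_toFinset.1 hq
      have h1 := scaledUtility_le_one (hx j) (hQ q hq).1 (t + 1)
      have h2 := hg0 q hq j t
      dsimp only [X]
      linarith)
    (fun q hq j => by
      have hq := hQfin.mem_toFinset.1 hq
      have h1 := scaledUtility_le_one (hx j) (hQ q hq).1 L
      have h2 := hg0 q hq j 0
      rw [Fin.sum_univ_eq_sum_range
        (fun s => scaledUtility (x j) q (s + 1) - scaledUtility (x j) q s),
        Finset.sum_range_sub]
      linarith)
    (by rw [← Set.ncard_eq_toFinset_card Q hQfin]; simpa using hcard)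
  simp only [Fintype.card_fin, Set.Finite.mem_toFinset] at ht
  let c : Fin m → ℝ := fun j => 2 ^ (t j : ℕ) / 2
  let M : ℝ := 2 ^ L
  let w : Fin m → Fin n → ℝ := fun j y => 2 ^ (t j : ℕ) * uniformValue (S j) y
  let Z : ℝ := ∑ j, (2 ^ (t j : ℕ))⁻¹
  have hZ : 0 < Z := Finset.sum_pos (fun j _ => by positivity) Finset.univ_nonempty
  have hc : ∀ j, 0 ≤ c j := fun j => by positivity
  have hM : 0 ≤ M := by positivity
  have htL : ∀ j, (2 : ℝ) ^ (t j : ℕ) ≤ M := fun j =>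
    pow_le_pow_right₀ (by norm_num) (t j).2.le
  have hw : ∀ j y, 0 ≤ w j y := fun j y => mul_nonneg (by positivity) (uniformValue_nonneg _ _)
  have hkpos : (0 : ℝ) < k := Nat.cast_pos.2 hk
  refine ⟨m, hm, w, fun j => (2 ^ (t j : ℕ))⁻¹ / Z, coverPrice S c M, hw,
    fun j => by positivity, by rw [← Finset.sum_div]; exact div_self hZ.ne',
    coverPrice_nonneg hc hM, coverPrice_empty hc hM, fun _ _ => coverPrice_mono hM,
    coverPrice_union_le hc hM, ?_⟩
  intro selp hselp q hq selq hselq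
  have hp : ∀ j, c j ≤ coverPrice S c M (selp j) := by
    intro j
    refine le_coverPrice_of_optimal (hw j) hc hM j ?_ ?_ ?_ _ (hselp j (S j))
    · rw [additiveVal_mul_uniformValue, Finset.inter_self, hS, div_self hkpos.ne', mul_one]
      exact half_lt_self (by positivity)
    · intro i hij
      rw [additiveVal_mul_uniformValue, hS]
      have h1 : ((S i ∩ S j).card : ℝ) ≤ d := Nat.cast_le.2 (hSS i j hij)
      have h2 : 2 * M * d ≤ k := by
        have : ((2 ^ (L + 1) * d : ℕ) : ℝ) ≤ k := Nat.cast_le.2 hd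
        push_cast at this
        rw [pow_succ] at this
        dsimp only [M]
        linarith
      have h3 : (1 : ℝ) ≤ 2 ^ (t i : ℕ) := one_le_pow₀ (by norm_num)
      have h4 : (2 : ℝ) ^ (t j : ℕ) * (S i ∩ S j).card ≤ M * d :=
        mul_le_mul (htL j) h1 (Nat.cast_nonneg _) hM
      calc (2 : ℝ) ^ (t j : ℕ) * ((S i ∩ S j).card / k)
          = 2 ^ (t j : ℕ) * (S i ∩ S j).card / k := by ring
        _ ≤ 1 / 2 := by rw [div_le_iff₀ hkpos]; linarith
        _ ≤ c i := by dsimp only [c]; linarith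
    · intro y
      calc w j y ≤ 2 ^ (t j : ℕ) * 1 :=
            mul_le_mul_of_nonneg_left (uniformValue_le_one _ _) (by positivity)
        _ ≤ M := by rw [mul_one]; exact htL j
  have hrevp : (m : ℝ) / 2 / Z ≤
      ∑ j, (2 ^ (t j : ℕ))⁻¹ / Z * coverPrice S c M (selp j) := by
    calc (m : ℝ) / 2 / Z = ∑ j : Fin m, 1 / 2 / Z := by simp; ring
      _ ≤ _ := by
        refine Finset.sum_le_sum fun j _ => ?_
        calc 1 / 2 / Z = (2 ^ (t j : ℕ))⁻¹ / Z * c j := by dsimp only [c]; field_simp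
          _ ≤ _ := mul_le_mul_of_nonneg_left (hp j) (by positivity)
  have hrevq : ∑ j, (2 ^ (t j : ℕ))⁻¹ / Z * q (selq j) ≤ 6 * (m / L) / Z := by
    calc ∑ j, (2 ^ (t j : ℕ))⁻¹ / Z * q (selq j)
        = (∑ j, q (selq j) / 2 ^ (t j : ℕ)) / Z := by
          rw [Finset.sum_div]; exact Finset.sum_congr rfl fun j _ => by ring
      _ ≤ (∑ j, 2 * X q j (t j)) / Z := by
          refine div_le_div_of_nonneg_right (Finset.sum_le_sum fun j _ => ?_) hZ.le
          refine price_le_scaledUtility_sub (hx j) (hQ q hq).1 _ _ fun lam => ?_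
          have h := hselq j lam
          simp only [w, lotVal_additiveVal_const_mul] at h
          exact h
      _ ≤ 6 * (m / L) / Z := by
          refine div_le_div_of_nonneg_right ?_ hZ.le
          rw [← Finset.mul_sum]
          linarith [ht q hq]
  have hLpos : (0 : ℝ) < L := Nat.cast_pos.2 hL
  calc (L : ℝ) * ∑ j, (2 ^ (t j : ℕ))⁻¹ / Z * q (selq j) ≤ L * (6 * (m / L) / Z) :=
        mul_le_mul_of_nonneg_left hrevq hLpos.le
    _ = 12 * (m / 2 / Z) := by field_simp; ring
    _ ≤ _ := by linarith

lemma rpow_tower_lt_exp {n a r : ℕ} (ha : 0 < a) (hn : n < 2 ^ (12 * a + 12))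
    (hr : 2 * a ≤ r) :
    (2 : ℝ) ^ ((2 : ℝ) ^ ((n : ℝ) ^ ((1 : ℝ) / 6) / 16)) <
      Real.exp ((r ^ 2 ^ (2 * a) : ℕ) / a) := by
  set d : ℕ := 2 ^ (2 * a) with hd
  have hd0 : d ≠ 0 := by positivity
  have hapos : (0 : ℝ) < a := Nat.cast_pos.2 ha
  have h1 : (n : ℝ) ^ ((1 : ℝ) / 6) / 16 ≤ d := by
    have hle : (n : ℝ) ≤ (2 ^ (2 * a + 2)) ^ (6 : ℕ) := by
      rw [← pow_mul, show (2 * a + 2) * 6 = 12 * a + 12 by ring]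
      exact_mod_cast hn.le
    have := Real.rpow_le_rpow (Nat.cast_nonneg n) hle (show (0 : ℝ) ≤ 1 / 6 by norm_num)
    rw [show (1 : ℝ) / 6 = ((6 : ℕ) : ℝ)⁻¹ by norm_num,
      Real.pow_rpow_inv_natCast (by positivity) (by norm_num)] at this
    rw [show (1 : ℝ) / 6 = ((6 : ℕ) : ℝ)⁻¹ by norm_num]
    have e : (2 : ℝ) ^ (2 * a + 2) = 4 * d := by rw [hd]; push_cast; ring
    have : (0 : ℝ) ≤ d := Nat.cast_nonneg d
    linarith
  have h2 : (2 : ℝ) ^ ((n : ℝ) ^ ((1 : ℝ) / 6) / 16) ≤ 2 ^ d := by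
    rw [← Real.rpow_natCast]
    exact Real.rpow_le_rpow_of_exponent_le (by norm_num) h1
  have h3 : (2 : ℝ) ^ d ≤ (r ^ d : ℕ) / a := by
    rw [le_div_iff₀ hapos]
    have : 2 ^ d * a ≤ r ^ d :=
      calc 2 ^ d * a ≤ 2 ^ d * a ^ d := Nat.mul_le_mul_left _ (Nat.le_self_pow hd0 a)
        _ = (2 * a) ^ d := (mul_pow _ _ _).symm
        _ ≤ r ^ d := Nat.pow_le_pow_left hr d
    exact_mod_cast this
  rw [Real.rpow_def_of_pos (by norm_num), Real.exp_lt_exp]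
  have hlog : Real.log 2 < 1 := by linarith [Real.log_two_lt_d9]
  have hpos : (0 : ℝ) < 2 ^ ((n : ℝ) ^ ((1 : ℝ) / 6) / 16) := by positivity
  calc Real.log 2 * 2 ^ ((n : ℝ) ^ ((1 : ℝ) / 6) / 16)
      < 1 * 2 ^ ((n : ℝ) ^ ((1 : ℝ) / 6) / 16) := mul_lt_mul_of_pos_right hlog hpos
    _ ≤ _ := by rw [one_mul]; exact h2.trans h3

/-- for all large `n`, for every family `Q` of lottery-pricing mechanisms with
`|Q| ≤ 2^{2^{n^{1/6}/16}}`, there is a distribution `D` over additive valuations and a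
monotone subadditive deterministic pricing `p` such that every `q ∈ Q` (under any
buyer-optimal purchasing) satisfies `Rev_D(p) ≥ (log₂ n / C)·Rev_D(q)`, for an absolute
constant `C`. -/
theorem lb_additive :
    ∃ C : ℝ, 0 < C ∧ ∃ n₀ : ℕ, ∀ n : ℕ, n₀ ≤ n →
      ∀ Q : Set (PMF (Finset (Fin n)) → ℝ), Q.Finite →
        (∀ q ∈ Q, (∀ lam, 0 ≤ q lam) ∧ q (PMF.pure ∅) = 0) →
        (Q.ncard : ℝ) ≤ 2 ^ ((2 : ℝ) ^ ((n : ℝ) ^ ((1 : ℝ) / 6) / 16)) →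
        ∃ (K : ℕ) (_ : 0 < K) (w : Fin K → Fin n → ℝ) (wt : Fin K → ℝ)
          (p : Finset (Fin n) → ℝ),
          (∀ i j, 0 ≤ w i j) ∧
          (∀ i, 0 ≤ wt i) ∧ (∑ i, wt i) = 1 ∧
          (∀ S, 0 ≤ p S) ∧ p ∅ = 0 ∧
          (∀ S T : Finset (Fin n), S ⊆ T → p S ≤ p T) ∧
          (∀ S T : Finset (Fin n), p (S ∪ T) ≤ p S + p T) ∧
          ∀ selp : Fin K → Finset (Fin n),
            (∀ i, ∀ T : Finset (Fin n),
              additiveVal (w i) T - p T ≤ additiveVal (w i) (selp i) - p (selp i)) →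
            ∀ q ∈ Q, ∀ selq : Fin K → PMF (Finset (Fin n)),
              (∀ i, ∀ lam : PMF (Finset (Fin n)),
                lotVal (additiveVal (w i)) lam - q lam ≤
                  lotVal (additiveVal (w i)) (selq i) - q (selq i)) →
              (Real.logb 2 n / C) * (∑ i, wt i * q (selq i)) ≤ ∑ i, wt i * p (selp i) := by
  refine ⟨288, by norm_num, 2 ^ 12, fun n hn Q hQfin hQ hcard => ?_⟩
  have hn0 : n ≠ 0 := by positivity
  obtain ⟨a, ha⟩ : ∃ a, a = Nat.log 2 n / 12 := ⟨_, rfl⟩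
  have hlog : 12 ≤ Nat.log 2 n := Nat.le_log_of_pow_le (by norm_num) hn
  have ha1 : 1 ≤ a := by omega
  have hlow : 2 ^ (12 * a) ≤ n :=
    (Nat.pow_le_pow_right (by norm_num) (by omega)).trans (Nat.pow_log_le_self 2 hn0)
  have hup : n < 2 ^ (12 * a + 12) :=
    (Nat.lt_pow_succ_log_self (by norm_num) n).trans_le
      (Nat.pow_le_pow_right (by norm_num) (by omega))
  obtain ⟨r, hr, hr1, hr2⟩ :=
    Nat.exists_prime_lt_and_le_two_mul (2 ^ (6 * a - 1)) (by positivity)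
  have hr3 : r ≤ 2 ^ (6 * a) := by
    rwa [← pow_succ', show 6 * a - 1 + 1 = 6 * a by omega] at hr2
  have hrn : r * r ≤ n := by
    refine le_trans (Nat.mul_le_mul hr3 hr3) ?_
    rwa [← pow_add, show 6 * a + 6 * a = 12 * a by ring]
  have hra : 2 * a ≤ r := by
    have h1 : 6 * a - 1 < 2 ^ (6 * a - 1) := Nat.lt_two_pow_self
    omega
  have hrd : 2 ^ (a + 1) * 2 ^ (2 * a) ≤ r := by
    rw [← pow_add]
    exact (Nat.pow_le_pow_right (by norm_num) (by omega)).trans hr1.le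
  obtain ⟨S, hS, hSS⟩ := exists_almost_disjoint_family (d := 2 ^ (2 * a)) hr hrn
  obtain ⟨K, hK, w, wt, p, hw, hwt, hwt1, hp0, hpe, hpm, hps, hrev⟩ :=
    exists_revenue_gap (pow_pos hr.pos _) ha1 hr.pos S hS hSS hrd Q hQfin hQ
      (hcard.trans_lt (rpow_tower_lt_exp ha1 hup hra))
  refine ⟨K, hK, w, wt, p, hw, hwt, hwt1, hp0, hpe, hpm, hps, ?_⟩
  intro selp hselp q hq selq hselq
  have h := hrev selp hselp q hq selq hselq
  have hnonneg : 0 ≤ ∑ i, wt i * q (selq i) :=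
    Finset.sum_nonneg fun i _ => mul_nonneg (hwt i) ((hQ q hq).1 _)
  have hlogb : Real.logb 2 n ≤ 24 * a := by
    have h1 : (n : ℝ) ≤ 2 ^ (24 * a) := by
      exact_mod_cast hup.le.trans (Nat.pow_le_pow_right (by norm_num) (by omega))
    rw [Real.logb_le_iff_le_rpow (by norm_num) (by positivity)]
    exact_mod_cast h1
  calc Real.logb 2 n / 288 * ∑ i, wt i * q (selq i)
      ≤ 24 * a / 288 * ∑ i, wt i * q (selq i) := by gcongr
    _ = a * (∑ i, wt i * q (selq i)) / 12 := by ring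
    _ ≤ _ := by linarith
end

section
/- Let s, t > 0 and let S_1,...,S_N be subsets of [n], each of size s, with |S_i ∩ S_j| ≤ t for all i ≠ j. Let b_1,...,b_N be reals with 2t ≤ b_i ≤ s for all i. Fix i ∈ [N] and let v be the additive valuation assigning value b_i/s to each item of S_i and 0 to every other item. Then for any distinct indices i_1,...,i_k, all different from i: v(S_{i_1} ∪ ... ∪ S_{i_k}) ≤ k·(t/s)·b_i, and consequently v(S_{i_1} ∪ ... ∪ S_{i_k}) − Σ_{j=1}^k (b_{i_j}/2) ≤ 0; i.e., buying any collection of sets other than S_i at half prices b_{i_j}/2 yields the buyer nonpositive utility. -/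
/-- for sets `S_1, …, S_N` of size `s` with pairwise intersections of size at
most `t`, and prices `b_i ∈ [2t, s]`, the additive buyer with value `b_i/s` on each item of
`S_i` assigns value at most `k·(t/s)·b_i` to the union of any `k` sets other than `S_i`;
hence buying any such collection at half prices yields nonpositive utility. -/
theorem other_sets_useless (n N : ℕ) (s t : ℝ) (hs : 0 < s) (ht : 0 < t)
    (S : Fin N → Finset (Fin n))
    (hcard : ∀ i, ((S i).card : ℝ) = s)
    (hint : ∀ i j, i ≠ j → (((S i ∩ S j).card : ℝ)) ≤ t)
    (b : Fin N → ℝ) (hb : ∀ i, 2 * t ≤ b i ∧ b i ≤ s)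
    (i : Fin N)
    (v : Finset (Fin n) → ℝ)
    (hv : ∀ T : Finset (Fin n), v T = ∑ j ∈ T, if j ∈ S i then b i / s else 0)
    (k : ℕ) (ι : Fin k → Fin N) (hinj : Function.Injective ι) (hne : ∀ j, ι j ≠ i) :
    v (Finset.univ.biUnion fun j => S (ι j)) ≤ (k : ℝ) * (t / s) * b i ∧
    v (Finset.univ.biUnion fun j => S (ι j)) - (∑ j : Fin k, b (ι j) / 2) ≤ 0 := by
  have hbi : 0 ≤ b i := by linarith [(hb i).1]
  have hval : ∀ T : Finset (Fin n), v T = ((T ∩ S i).card : ℝ) * (b i / s) := by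
    intro T
    rw [hv, ← Finset.sum_filter, Finset.sum_const, nsmul_eq_mul, Finset.filter_mem_eq_inter]
  have hunion : (((Finset.univ.biUnion fun j => S (ι j)) ∩ S i).card : ℝ) ≤ k * t := by
    rw [Finset.biUnion_inter]
    calc ((Finset.univ.biUnion fun j => S (ι j) ∩ S i).card : ℝ)
        ≤ ∑ j : Fin k, ((S (ι j) ∩ S i).card : ℝ) := mod_cast Finset.card_biUnion_le
      _ ≤ ∑ _j : Fin k, t := Finset.sum_le_sum fun j _ => hint _ _ (hne j)
      _ = k * t := by simp
  have hmain : v (Finset.univ.biUnion fun j => S (ι j)) ≤ (k : ℝ) * (t / s) * b i := by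
    rw [hval]
    calc _ ≤ (k * t : ℝ) * (b i / s) :=
          mul_le_mul_of_nonneg_right hunion (div_nonneg hbi hs.le)
      _ = (k : ℝ) * (t / s) * b i := by ring
  refine ⟨hmain, sub_nonpos.mpr (hmain.trans ?_)⟩
  calc (k : ℝ) * (t / s) * b i = k * t * (b i / s) := by ring
    _ ≤ k * t := mul_le_of_le_one_right (by positivity) ((div_le_one hs).mpr (hb i).2)
    _ = ∑ _j : Fin k, t := by simp
    _ ≤ ∑ j : Fin k, b (ι j) / 2 :=
        Finset.sum_le_sum fun j _ => by linarith [(hb (ι j)).1]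
end

section
/- Let μ > 0, b_min > 0, set ε = b_min/(4μ) and τ = 2μ/b_min, and let S_1,...,S_N ⊆ [n] with |S_j| = μ for all j, satisfying the expansion condition |∪_{j∈J} S_j| ≥ (1−ε)·μ·|J| for all J ⊆ [N] with |J| ≤ 2τ − 2. Let b_1,...,b_N be reals with b_j ≥ b_min for all j, and define h(J) = Σ_{j∈J} b_j − μ·|J| + |∪_{j∈J} S_j|. Then h(J) ≥ 3εμ·|J| for every J with |J| ≤ 2τ − 2; in particular h(J) ≥ 0 for all J with |J| < τ, and h(J) ≥ (3/2)·μ ≥ μ for all J with τ ≤ |J| ≤ 2τ − 2 (i.e., h is (μ,τ)-large on this range). -/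
/-- with `ε = b_min/(4μ)` and `τ = 2μ/b_min`, under the expansion condition
`|∪_{j∈J} S_j| ≥ (1−ε)μ|J|` for `|J| ≤ 2τ−2`, the function
`h(J) = Σ_{j∈J} b_j − μ|J| + |∪_{j∈J} S_j|` satisfies `h(J) ≥ 3εμ|J|` for `|J| ≤ 2τ−2`;
in particular `h(J) ≥ 0` for `|J| < τ` and `h(J) ≥ (3/2)μ ≥ μ` for `τ ≤ |J| ≤ 2τ−2`,
i.e. `h` is `(μ,τ)`-large on this range. -/
theorem h_is_large (n N : ℕ) (μ bmin : ℝ) (hμ : 0 < μ) (hbmin : 0 < bmin)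
    (ε τ : ℝ) (hε : ε = bmin / (4 * μ)) (hτ : τ = 2 * μ / bmin) (hτ2 : 2 ≤ τ)
    (S : Fin N → Finset (Fin n)) (hcard : ∀ j, ((S j).card : ℝ) = μ)
    (hexpand : ∀ J : Finset (Fin N), (J.card : ℝ) ≤ 2 * τ - 2 →
      (1 - ε) * μ * J.card ≤ ((J.biUnion S).card : ℝ))
    (b : Fin N → ℝ) (hb : ∀ j, bmin ≤ b j)
    (h : Finset (Fin N) → ℝ)
    (hh : ∀ J : Finset (Fin N),
      h J = (∑ j ∈ J, b j) - μ * J.card + ((J.biUnion S).card : ℝ)) :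
    (∀ J : Finset (Fin N), (J.card : ℝ) ≤ 2 * τ - 2 → 3 * ε * μ * J.card ≤ h J) ∧
    (∀ J : Finset (Fin N), (J.card : ℝ) < τ → 0 ≤ h J) ∧
    (∀ J : Finset (Fin N), τ ≤ (J.card : ℝ) → (J.card : ℝ) ≤ 2 * τ - 2 →
      (3 / 2) * μ ≤ h J) ∧
    μ ≤ (3 / 2) * μ := by
  have hεμ : ε * μ = bmin / 4 := by rw [hε]; field_simp
  have hτb : bmin * τ = 2 * μ := by rw [hτ]; field_simp
  have key : ∀ J : Finset (Fin N), (J.card : ℝ) ≤ 2 * τ - 2 → 3 * ε * μ * J.card ≤ h J := by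
    intro J hJ
    have hsum : (J.card : ℝ) * bmin ≤ ∑ j ∈ J, b j := by
      simpa using J.card_nsmul_le_sum b bmin fun j _ => hb j
    have hεJ : ε * μ * J.card = bmin / 4 * J.card := by rw [hεμ]
    rw [hh]
    linarith [hexpand J hJ]
  refine ⟨key, fun J hJ => ?_, fun J hτJ hJ => ?_, by linarith⟩
  · refine le_trans ?_ (key J (by linarith))
    rw [mul_assoc 3, hεμ]
    positivity
  · refine le_trans ?_ (key J hJ)
    rw [mul_assoc 3, hεμ]
    linarith [mul_le_mul_of_nonneg_left hτJ hbmin.le]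
end
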